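/- arXiv:2004.12561 — 2 statements merged into one kernel-verified Lean document; each statement's English description precedes it below -/
import Mathlib

section
/- For every integer k ≥ 3 there exists ε₀ > 0 such that for every real ε with 0 < ε < ε₀ there exist ρ₀ > 0 and n₀ such that the following holds for every real ρ with 0 < ρ < ρ₀ and all integers n ≥ n₀ with k | n and t with n/(3k²) ≤ t ≤ n/(2k). Let H be a (1,k)-partite (k+1)-graph with partition classes A = {x_1, …, x_{n/k}} and B = [n] (so k|A| = |B| = n), where A is partitioned into A_1 = {x_1,…,x_t} and A_2 = A ∖ A_1. Suppose d_H(x) > C(n,k) − C(n−t+1,k) − ρ·n^k for every x ∈ A_1 and d_H(x) = C(n,k) for every x ∈ A_2. If H is not ε-close to ℋ_t(k,n), then there exists a spanning subgraph H' of H such that: (1) for all vertices x ∈ V(H') with at most n^{0.99} exceptions, |d_{H'}(x) − n^{0.2}| ≤ n^{0.19}; (2) d_{H'}(x) < 2·n^{0.2} for every x ∈ V(H'); (3) d_{H'}({x,y}) < n^{0.19} for every pair of distinct vertices x, y. -/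
/-- `H_k(t,n)`: the `k`-graph on `Fin n` whose edges are the `k`-subsets meeting `[t]`. -/
def Hk (n k t : ℕ) : Finset (Finset (Fin n)) :=
  (Finset.univ.powersetCard k).filter fun e => ∃ v ∈ e, (v : ℕ) < t

/-- The `(1,k)`-partite `(k+1)`-graph `ℋ_t(k,n)` (with `k ∣ n`, so `t + m = n/k`):
partition classes `Fin (n/k)`, `Fin n`; edges `{x_i} ∪ e` with `e ∈ H_k(t,n)` for `i < t`
and `{x_i} ∪ e` for all `k`-sets `e` for `t ≤ i < n/k`. -/
def HtE (n k t : ℕ) : Finset (Finset (Fin (n / k) ⊕ Fin n)) :=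
  Finset.univ.biUnion fun i : Fin (n / k) =>
    (if (i : ℕ) < t then Hk n k t else Finset.univ.powersetCard k).image
      fun e => insert (Sum.inl i) (e.image Sum.inr)

/-- `E₂` is `ε`-close to `E₁`. -/
def isClose {V : Type*} [DecidableEq V] (E₁ E₂ : Finset (Finset V)) (ε : ℝ) : Prop :=
  ∃ σ : Equiv.Perm V, ((E₁ \ E₂.image fun e => e.image σ).card : ℝ) ≤ ε * E₁.card

open Finset

/-- Sums over the `(j+1)`-subsets of `O` through `v`, indexed by the remaining `j` elements. -/
theorem sum_powersetCard_mem {V M : Type*} [DecidableEq V] [AddCommMonoid M] (O : Finset V) {v : V}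
    (hv : v ∈ O) (j : ℕ) (F : Finset V → M) :
    ∑ e ∈ (O.powersetCard (j + 1)).filter (fun e => v ∈ e), F e =
      ∑ g ∈ (O.erase v).powersetCard j, F (insert v g) := by
  symm
  refine sum_bij' (fun g _ => insert v g) (fun e _ => e.erase v) ?_ ?_ ?_ ?_ ?_
  · intro g hg
    simp only [mem_powersetCard, subset_erase] at hg
    simp only [mem_filter, mem_powersetCard, mem_insert_self, and_true]
    exact ⟨insert_subset hv hg.1.1, by rw [card_insert_of_notMem hg.1.2, hg.2]⟩
  · intro e he
    simp only [mem_filter, mem_powersetCard] at he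
    simp only [mem_powersetCard]
    exact ⟨erase_subset_erase v he.1.1, by rw [card_erase_of_mem he.2, he.1.2]; rfl⟩
  · intro g hg
    simp only [mem_powersetCard, subset_erase] at hg
    exact erase_insert hg.1.2
  · intro e he
    exact insert_erase (mem_filter.1 he).2
  · intro g _
    rfl

theorem card_powersetCard_mem {V : Type*} [DecidableEq V] (O : Finset V) {v : V}
    (hv : v ∈ O) (j : ℕ) :
    ((O.powersetCard (j + 1)).filter (fun e => v ∈ e)).card = (O.card - 1).choose j := by
  have := sum_powersetCard_mem O hv j (fun _ => 1)
  simpa [card_erase_of_mem hv] using this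

/-- Double counting of incidences between a family of finite sets and the points of `O`. -/
theorem sum_sum_mem_comm {V : Type*} [DecidableEq V] (O : Finset V) (S : Finset (Finset V))
    (hS : ∀ e ∈ S, e ⊆ O) (b : V → ℝ) :
    ∑ e ∈ S, ∑ v ∈ e, b v = ∑ v ∈ O, b v * (S.filter (fun e => v ∈ e)).card := by
  have : ∀ e ∈ S, ∑ v ∈ e, b v = ∑ v ∈ O, if v ∈ e then b v else 0 := by
    intro e he
    rw [← sum_filter, filter_mem_eq_inter, inter_eq_right.2 (hS e he)]
  rw [sum_congr rfl this, sum_comm]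
  refine sum_congr rfl fun v _ => ?_
  rw [← sum_filter, sum_const, nsmul_eq_mul, mul_comm]

theorem card_mul_sum_powersetCard {V : Type*} [DecidableEq V] (O : Finset V) (j : ℕ) (b : V → ℝ) :
    (O.card : ℝ) * ∑ g ∈ O.powersetCard j, ∑ v ∈ g, b v =
      j * O.card.choose j * ∑ v ∈ O, b v := by
  cases j with
  | zero => simp
  | succ j =>
    rw [sum_sum_mem_comm O _ (fun e he => (mem_powersetCard.1 he).1), mul_sum, mul_sum]
    refine sum_congr rfl fun v hv => ?_
    rw [card_powersetCard_mem O hv]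
    obtain ⟨c, hc⟩ : ∃ c, O.card = c + 1 :=
      ⟨O.card - 1, (Nat.succ_pred_eq_of_pos (card_pos.2 ⟨v, hv⟩)).symm⟩
    have := Nat.add_one_mul_choose_eq c j
    rw [hc, Nat.add_sub_cancel]
    have h2 : ((c + 1 : ℕ) : ℝ) * (c.choose j : ℝ) =
      ((c + 1).choose (j + 1) : ℝ) * ((j + 1 : ℕ) : ℝ) := by exact_mod_cast this
    linear_combination b v * h2

/-- A quantitative, stable form of the Erdős matching bound for threshold `k`-graphs,
`k = j + 1`: if `b` has total weight about `|T|` and `T` carries the largest weights, then few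
`k`-sets have weight at least `1`, unless `b` is close to the indicator function of `T`. -/
theorem card_threshold_le {V : Type*} [Fintype V] [DecidableEq V] (T : Finset V) (b : V → ℝ)
    (j : ℕ) (ξ : ℝ) (hT : 1 ≤ T.card) (hn : 2 * (j + 1) * T.card ≤ Fintype.card V)
    (hb : ∀ v, 0 ≤ b v) (hξ : 0 ≤ ξ) (hsum : ∑ v, b v ≤ T.card * (1 + ξ))
    (htop : ∀ u ∈ T, ∀ v ∉ T, b v ≤ b u) :
    (((univ.powersetCard (j + 1)).filter fun e => 1 ≤ ∑ v ∈ e, b v).card : ℝ) +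
      (Fintype.card V - T.card).choose j *
        ((∑ v ∈ T, (1 - b v)) / (2 * j + 1) - 2 * ξ * T.card) ≤
      (Fintype.card V).choose (j + 1) - (Fintype.card V - T.card).choose (j + 1) := by
  set n := Fintype.card V with hndef
  set t := T.card with htdef
  set O := Tᶜ with hO
  have hOc : O.card = n - t := card_compl T
  have htn : t ≤ n := card_le_univ T
  have hOcR : (O.card : ℝ) = n - t := by rw [hOc, Nat.cast_sub htn]
  set N : ℝ := ((n - t).choose j : ℝ) with hN
  have hN0 : 0 ≤ N := Nat.cast_nonneg _
  set Z := ∑ v ∈ T, (1 - b v) with hZ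
  set B := ∑ v ∈ O, b v with hB
  have hB0 : 0 ≤ B := sum_nonneg fun v _ => hb v
  have hBZ : B ≤ Z + ξ * t := by
    have : ∑ v, b v = ∑ v ∈ T, b v + B := (sum_add_sum_compl T b).symm
    have hZ' : Z = t - ∑ v ∈ T, b v := by simp [hZ, htdef]
    linarith
  have htR : (1 : ℝ) ≤ t := by exact_mod_cast hT
  have hnR : 2 * ((j : ℝ) + 1) * t ≤ n := by exact_mod_cast hn
  have hj0 : (0 : ℝ) ≤ j := Nat.cast_nonneg _
  -- total weight of the `j`-subsets of `O`
  set W := ∑ g ∈ O.powersetCard j, ∑ v ∈ g, b v with hW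
  have hW0 : 0 ≤ W := sum_nonneg fun g _ => sum_nonneg fun v _ => hb v
  have hWeq : ((n : ℝ) - t) * W = j * N * B := by
    have := card_mul_sum_powersetCard O j b
    rwa [hOcR, hOc] at this
  have hWle : (2 * j + 1) * (t * W) ≤ j * N * (Z + ξ * t) := by
    have h1 : (2 * j + 1) * (t * W) ≤ ((n : ℝ) - t) * W := by
      nlinarith
    have h2 : j * N * B ≤ j * N * (Z + ξ * t) :=
      mul_le_mul_of_nonneg_left hBZ (mul_nonneg hj0 hN0)
    linarith
  -- the maximal weight on `O`
  have hOne : O.Nonempty := by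
    rw [← card_pos, hOc]
    have : 2 * (j + 1) * t = t + (2 * j + 1) * t := by ring
    have : 0 < (2 * j + 1) * t := by positivity
    omega
  obtain ⟨v₀, hv₀, hmax⟩ := exists_max_image O b hOne
  set F := (O.powersetCard j).filter fun g => 1 - b v₀ ≤ ∑ v ∈ g, b v with hF
  have hFN : (F.card : ℝ) ≤ N := by
    have : F.card ≤ (n - t).choose j := by
      rw [← hOc, ← card_powersetCard]; exact card_filter_le _ _
    rw [hN]
    exact_mod_cast this
  have hFW : (1 - b v₀) * F.card ≤ W := by
    calc (1 - b v₀) * F.card = ∑ g ∈ F, (1 - b v₀) := by rw [sum_const, nsmul_eq_mul, mul_comm]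
      _ ≤ ∑ g ∈ F, ∑ v ∈ g, b v := sum_le_sum fun g hg => (mem_filter.1 hg).2
      _ ≤ W := sum_le_sum_of_subset_of_nonneg (filter_subset _ _)
        fun g _ _ => sum_nonneg fun v _ => hb v
  have hZt : Z ≤ t * (1 - b v₀) := by
    rw [hZ, htdef, ← nsmul_eq_mul, ← sum_const]
    refine sum_le_sum fun u hu => ?_
    have := htop u hu v₀ (mem_compl.1 hv₀)
    linarith
  -- heavy sets avoiding `T`
  set E₀ := (O.powersetCard (j + 1)).filter fun e => 1 ≤ ∑ v ∈ e, b v with hE₀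
  have hE₀B : (E₀.card : ℝ) ≤ B * F.card := by
    calc (E₀.card : ℝ) = ∑ e ∈ E₀, (1 : ℝ) := by simp
      _ ≤ ∑ e ∈ E₀, ∑ v ∈ e, b v := sum_le_sum fun e he => (mem_filter.1 he).2
      _ = ∑ v ∈ O, b v * (E₀.filter (fun e => v ∈ e)).card :=
        sum_sum_mem_comm O _ (fun e he => (mem_powersetCard.1 (mem_filter.1 he).1).1) b
      _ ≤ ∑ v ∈ O, b v * F.card := by
        refine sum_le_sum fun v hv => mul_le_mul_of_nonneg_left ?_ (hb v)
        norm_cast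
        refine card_le_card_of_injOn (fun e => e.erase v) ?_ ?_
        · intro e he
          simp only [hE₀, coe_filter, mem_filter, mem_powersetCard, Set.mem_ofPred_eq] at he
          simp only [hF, coe_filter, mem_powersetCard, Set.mem_ofPred_eq]
          refine ⟨⟨(erase_subset _ _).trans he.1.1.1, ?_⟩, ?_⟩
          · rw [card_erase_of_mem he.2, he.1.1.2]; rfl
          · have h1 := add_sum_erase e b he.2
            have h2 := hmax v hv
            linarith [he.1.2]
        · intro e he e' he' h
          have h1 := (mem_filter.1 (mem_coe.1 he)).2
          have h2 := (mem_filter.1 (mem_coe.1 he')).2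
          rw [← insert_erase h1, ← insert_erase h2]
          exact congrArg _ h
      _ = B * F.card := by rw [hB, sum_mul]
  have hE₀le : (E₀.card : ℝ) ≤ t * W + ξ * t * N := by
    have hF0 : (0 : ℝ) ≤ F.card := Nat.cast_nonneg _
    have h1 : B * F.card ≤ (t * (1 - b v₀) + ξ * t) * F.card :=
      mul_le_mul_of_nonneg_right (by linarith) hF0
    have h2 : t * ((1 - b v₀) * F.card) ≤ t * W :=
      mul_le_mul_of_nonneg_left hFW (by linarith)
    have h3 : ξ * t * F.card ≤ ξ * t * N :=
      mul_le_mul_of_nonneg_left hFN (by positivity)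
    linarith
  -- light sets meeting `T` in one vertex
  set Q := (T ×ˢ O.powersetCard j).filter fun p => b p.1 + ∑ v ∈ p.2, b v < 1 with hQ
  have hQle : Z * N - t * W ≤ Q.card := by
    have h1 : ∑ p ∈ T ×ˢ O.powersetCard j, (1 - b p.1 - ∑ v ∈ p.2, b v) = Z * N - t * W := by
      rw [sum_product]
      simp only [sum_sub_distrib, sum_const, nsmul_eq_mul, card_powersetCard, hOc]
      rw [hZ, sum_sub_distrib, ← mul_sum, ← hW, ← hN]
      simp only [sum_const, nsmul_eq_mul]
      ring
    have h2 : ∑ p ∈ T ×ˢ O.powersetCard j, (1 - b p.1 - ∑ v ∈ p.2, b v) ≤ Q.card := by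
      rw [hQ, card_filter]
      push_cast
      refine sum_le_sum fun p _ => ?_
      have h3 := hb p.1
      have h4 : 0 ≤ ∑ v ∈ p.2, b v := sum_nonneg fun v _ => hb v
      split_ifs with h <;> linarith
    linarith
  -- the heavy sets, the light sets, and the sets avoiding `T`
  set E := (univ.powersetCard (j + 1)).filter fun e => 1 ≤ ∑ v ∈ e, b v with hE
  have hcount : E.card + Q.card + (n - t).choose (j + 1) ≤ n.choose (j + 1) + E₀.card := by
    set ins : V × Finset V → Finset V := fun p => insert p.1 p.2 with hins
    have hmemQ : ∀ p ∈ Q, p.1 ∈ T ∧ p.2 ⊆ O ∧ p.2.card = j ∧ p.1 ∉ p.2 ∧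
        b p.1 + ∑ v ∈ p.2, b v < 1 := by
      intro p hp
      simp only [hQ, mem_filter, mem_product, mem_powersetCard] at hp
      exact ⟨hp.1.1, hp.1.2.1, hp.1.2.2, fun h => (mem_compl.1 (hp.1.2.1 h)) hp.1.1, hp.2⟩
    have hcardI : (Q.image ins).card = Q.card := by
      refine card_image_of_injOn fun p hp q hq h => ?_
      obtain ⟨hp1, hp2, -, hp4, -⟩ := hmemQ p hp
      obtain ⟨hq1, hq2, -, hq4, -⟩ := hmemQ q hq
      change insert p.1 p.2 = insert q.1 q.2 at h
      have h1 : p.1 = q.1 := by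
        have : p.1 ∈ insert q.1 q.2 := h ▸ mem_insert_self _ _
        rcases mem_insert.1 this with h | h
        · exact h
        · exact absurd hp1 (mem_compl.1 (hq2 h))
      refine Prod.ext h1 ?_
      rw [← erase_insert hp4, ← erase_insert hq4, h, h1]
    have hdis1 : Disjoint (E \ E₀) (Q.image ins) := by
      rw [disjoint_left]
      intro e he he'
      obtain ⟨p, hp, rfl⟩ := mem_image.1 he'
      obtain ⟨-, -, -, hp4, hp5⟩ := hmemQ p hp
      have := (mem_filter.1 (mem_sdiff.1 he).1).2
      rw [hins] at this
      simp only [sum_insert hp4] at this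
      linarith
    have hdis2 : Disjoint (E \ E₀ ∪ Q.image ins) (O.powersetCard (j + 1)) := by
      rw [disjoint_left]
      intro e he he'
      rcases mem_union.1 he with he | he
      · obtain ⟨h1, h2⟩ := mem_sdiff.1 he
        exact h2 (mem_filter.2 ⟨he', (mem_filter.1 h1).2⟩)
      · obtain ⟨p, hp, rfl⟩ := mem_image.1 he
        obtain ⟨hp1, -⟩ := hmemQ p hp
        exact (mem_compl.1 ((mem_powersetCard.1 he').1 (mem_insert_self _ _))) hp1
    have hsub : (E \ E₀ ∪ Q.image ins) ∪ O.powersetCard (j + 1) ⊆ univ.powersetCard (j + 1) := by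
      refine union_subset (union_subset ?_ ?_) (powersetCard_mono (subset_univ _))
      · exact sdiff_subset.trans (filter_subset _ _)
      · intro e he
        obtain ⟨p, hp, rfl⟩ := mem_image.1 he
        obtain ⟨-, -, hp3, hp4, -⟩ := hmemQ p hp
        exact mem_powersetCard_univ.2 (by rw [card_insert_of_notMem hp4, hp3])
    have h1 := card_le_card hsub
    rw [card_union_of_disjoint hdis2, card_union_of_disjoint hdis1, hcardI,
      card_powersetCard, card_powersetCard, hOc, card_univ, ← hndef] at h1
    have h2 := card_le_card_sdiff_add_card (s := E) (t := E₀)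
    omega
  have hcountR : (E.card : ℝ) + Q.card + (n - t).choose (j + 1) ≤
      n.choose (j + 1) + E₀.card := by exact_mod_cast hcount
  have hfinal : N * (Z / (2 * j + 1) - 2 * ξ * t) ≤ Z * N - 2 * (t * W) - ξ * t * N := by
    have hd : (0 : ℝ) < 2 * j + 1 := by positivity
    have h1 : t * W ≤ j * N * (Z + ξ * t) / (2 * j + 1) := by
      rw [le_div_iff₀ hd]; linarith
    have h2 : Z * N - 2 * (j * N * (Z + ξ * t) / (2 * j + 1)) - ξ * t * N =
      N * (Z / (2 * j + 1) - (2 * j / (2 * j + 1)) * (ξ * t) - ξ * t) := by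
      field_simp; ring
    have h3 : 2 * (j : ℝ) / (2 * j + 1) ≤ 1 := by
      rw [div_le_one hd]; linarith
    have h4 : 0 ≤ ξ * t := by positivity
    have h5 : N * (Z / (2 * j + 1) - 2 * ξ * t) ≤
      N * (Z / (2 * j + 1) - (2 * j / (2 * j + 1)) * (ξ * t) - ξ * t) := by
      refine mul_le_mul_of_nonneg_left ?_ hN0
      nlinarith
    linarith
  linarith

/-- Every finite type has a set of `t` points of largest weight. -/
theorem exists_top_subset {V : Type*} [Fintype V] [DecidableEq V] (b : V → ℝ) (t : ℕ)
    (ht : t ≤ Fintype.card V) :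
    ∃ T : Finset V, T.card = t ∧ ∀ u ∈ T, ∀ v ∉ T, b v ≤ b u := by
  obtain ⟨T, hT, hmax⟩ := exists_max_image (univ.powersetCard t) (fun T => ∑ v ∈ T, b v)
    (powersetCard_nonempty.2 (by simpa using ht))
  rw [mem_powersetCard_univ] at hT
  refine ⟨T, hT, fun u hu v hv => ?_⟩
  have hv' : v ∉ T.erase u := fun h => hv (mem_of_mem_erase h)
  have h1 := hmax (insert v (T.erase u)) (mem_powersetCard_univ.2 (by
    rw [card_insert_of_notMem hv', card_erase_add_one hu, hT]))
  rw [sum_insert hv'] at h1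
  have h2 := add_sum_erase T b hu
  linarith

/-- If many members of `G` have `f`-value below `s`, then the penalty sum controls `α - s`. -/
theorem le_add_penalty {E : Type*} (G : Finset E) (f : E → ℝ) (s η K M α : ℝ) (hM : 0 < M)
    (hK : 0 ≤ K) (hKη : 1 ≤ K * η) (hG : η * M ≤ (G.filter fun e => f e < s).card) :
    α ≤ s + K / M * ∑ e ∈ G, max (α - f e) 0 := by
  have hKM : 0 ≤ K / M := div_nonneg hK hM.le
  rcases le_total α s with h | h
  · have : 0 ≤ K / M * ∑ e ∈ G, max (α - f e) 0 :=
      mul_nonneg hKM (sum_nonneg fun e _ => le_max_right _ _)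
    linarith
  · have h1 : η * M * (α - s) ≤ ∑ e ∈ G, max (α - f e) 0 := by
      calc η * M * (α - s) ≤ (G.filter fun e => f e < s).card * (α - s) :=
            mul_le_mul_of_nonneg_right hG (by linarith)
        _ = ∑ e ∈ G.filter fun e => f e < s, (α - s) := by rw [sum_const, nsmul_eq_mul]
        _ ≤ ∑ e ∈ G.filter fun e => f e < s, max (α - f e) 0 :=
            sum_le_sum fun e he => le_max_of_le_left (by linarith [(mem_filter.1 he).2])
        _ ≤ ∑ e ∈ G, max (α - f e) 0 :=
            sum_le_sum_of_subset_of_nonneg (filter_subset _ _) fun e _ _ => le_max_right _ _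
    have h2 : K / M * (η * M * (α - s)) ≤ K / M * ∑ e ∈ G, max (α - f e) 0 :=
      mul_le_mul_of_nonneg_left h1 hKM
    have h3 : K / M * (η * M * (α - s)) = K * η * (α - s) := by field_simp
    nlinarith

section Threshold

variable {V : Type*} [Fintype V] [DecidableEq V] (T : Finset V) (b : V → ℝ) (j : ℕ)
  (G : Finset (Finset V)) (c δ M : ℝ)

theorem card_le_card_filter_add {E : Type*} [DecidableEq E] (G U : Finset E) (hG : G ⊆ U)
    (f : E → ℝ) (s : ℝ) :
    G.card ≤ (G.filter fun e => f e < s).card + (U.filter fun e => s ≤ f e).card := by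
  rw [← card_filter_add_card_filter_not (s := G) (fun e => f e < s)]
  refine Nat.add_le_add_left (card_le_card fun e he => ?_) _
  rw [mem_filter, not_lt] at he
  exact mem_filter.2 ⟨hG he.1, he.2⟩

theorem le_one_add_penalty (hT : 1 ≤ T.card) (hn : 2 * (j + 1) * T.card ≤ Fintype.card V)
    (hb : ∀ v, 0 ≤ b v) (hsum : ∑ v, b v ≤ T.card)
    (htop : ∀ u ∈ T, ∀ v ∉ T, b v ≤ b u) (hM : 0 < M)
    (hc : c * M ≤ (Fintype.card V - T.card).choose j * T.card)
    (hGsub : G ⊆ univ.powersetCard (j + 1))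
    (hG : ((Fintype.card V).choose (j + 1) : ℝ) - (Fintype.card V - T.card).choose (j + 1) -
      δ * M ≤ G.card)
    (κ K α : ℝ) (hκ : 0 < κ) (hκ1 : κ ≤ 1)
    (hδ : δ ≤ c * κ / (4 * (2 * j + 1))) (hK : 0 ≤ K)
    (hKc : 1 ≤ K * (c * κ / (4 * (2 * j + 1)))) :
    α ≤ 1 + κ + K / M * ∑ e ∈ G, max (α - ∑ v ∈ e, b v) 0 := by
  have hs : (0 : ℝ) < 1 + κ := by linarith
  refine le_add_penalty G (fun e => ∑ v ∈ e, b v) (1 + κ) _ K M α hM hK hKc ?_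
  have hthr := card_threshold_le T (fun v => b v / (1 + κ)) j 0 hT hn
    (fun v => div_nonneg (hb v) hs.le) le_rfl (by
      rw [← sum_div, div_le_iff₀ hs]
      have : (0 : ℝ) ≤ T.card := Nat.cast_nonneg _
      nlinarith) (fun u hu v hv => div_le_div_of_nonneg_right (htop u hu v hv) hs.le)
  have hset : ((univ.powersetCard (j + 1)).filter fun e : Finset V => 1 ≤ ∑ v ∈ e, b v / (1 + κ)) =
      (univ.powersetCard (j + 1)).filter fun e : Finset V => 1 + κ ≤ ∑ v ∈ e, b v := by
    refine filter_congr fun e _ => ?_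
    rw [← sum_div, le_div_iff₀ hs, one_mul]
  rw [hset] at hthr
  have hcard : (G.card : ℝ) ≤ _ := Nat.cast_le.2
    (card_le_card_filter_add G _ hGsub (fun e => ∑ v ∈ e, b v) (1 + κ))
  push_cast at hcard
  have hZ : T.card * (κ / 2) ≤ ∑ v ∈ T, (1 - b v / (1 + κ)) := by
    have h1 : ∑ v ∈ T, b v ≤ T.card :=
      (sum_le_sum_of_subset_of_nonneg (subset_univ _) fun v _ _ => hb v).trans hsum
    rw [sum_sub_distrib, ← sum_div, sum_const, nsmul_eq_mul, mul_one]
    have h2 : (∑ v ∈ T, b v) / (1 + κ) ≤ T.card / (1 + κ) := by gcongr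
    have h3 : (T.card : ℝ) / (1 + κ) ≤ T.card * (1 - κ / 2) := by
      rw [div_le_iff₀ hs]
      have : (0 : ℝ) ≤ T.card := Nat.cast_nonneg _
      nlinarith [mul_nonneg this (mul_nonneg hκ.le (sub_nonneg.2 hκ1))]
    linarith
  have hd : (0 : ℝ) < 2 * j + 1 := by positivity
  set N : ℝ := ((Fintype.card V - T.card).choose j : ℝ) with hN
  have hN0 : 0 ≤ N := Nat.cast_nonneg _
  have h1 : 2 * (c * κ / (4 * (2 * j + 1))) * M ≤
      N * ((∑ v ∈ T, (1 - b v / (1 + κ))) / (2 * j + 1) - 2 * 0 * T.card) := by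
    calc 2 * (c * κ / (4 * (2 * j + 1))) * M = (c * M) * (κ / 2) / (2 * j + 1) := by
          field_simp; ring
      _ ≤ (N * T.card) * (κ / 2) / (2 * j + 1) := by gcongr
      _ = N * ((T.card * (κ / 2)) / (2 * j + 1)) := by ring
      _ ≤ N * ((∑ v ∈ T, (1 - b v / (1 + κ))) / (2 * j + 1)) := by gcongr
      _ = _ := by ring
  have h2 : δ * M ≤ c * κ / (4 * (2 * j + 1)) * M := mul_le_mul_of_nonneg_right hδ hM.le
  linarith

theorem le_one_sub_penalty_or_card_missing_le (hT : 1 ≤ T.card)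
    (hn : 2 * (j + 1) * T.card ≤ Fintype.card V)
    (hb : ∀ v, 0 ≤ b v) (hsum : ∑ v, b v ≤ T.card)
    (htop : ∀ u ∈ T, ∀ v ∉ T, b v ≤ b u) (hM : M = (Fintype.card V : ℝ) ^ (j + 1))
    (hc0 : 0 < c) (hc : c * M ≤ (Fintype.card V - T.card).choose j * T.card)
    (hGsub : G ⊆ univ.powersetCard (j + 1))
    (hG : ((Fintype.card V).choose (j + 1) : ℝ) - (Fintype.card V - T.card).choose (j + 1) -
      δ * M ≤ G.card)
    (κ η K : ℝ) (hκ : 0 < κ) (hκ1 : κ ≤ 1 / 2) (hK : 0 ≤ K) (hKη : 1 ≤ K * η) :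
    (∀ α, α ≤ 1 - κ + K / M * ∑ e ∈ G, max (α - ∑ v ∈ e, b v) 0) ∨
    (((univ.powersetCard (j + 1)).filter fun e => (∃ v ∈ e, v ∈ T) ∧ e ∉ G).card : ℝ) ≤
      (δ + η + (2 * j + 1) * (δ + η + 4 * κ) / c + 2 * κ) * M := by
  set n := Fintype.card V with hndef
  have hd : (0 : ℝ) < 2 * j + 1 := by positivity
  have htn : T.card ≤ n := card_le_univ T
  have htR : (1 : ℝ) ≤ T.card := by exact_mod_cast hT
  have htnR : (T.card : ℝ) ≤ n := by exact_mod_cast htn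
  have hn0 : (0 : ℝ) < n := by linarith
  have hM0 : 0 < M := by rw [hM]; positivity
  by_cases hlight : η * M ≤ (G.filter fun e => ∑ v ∈ e, b v < 1 - κ).card
  · exact Or.inl fun α => le_add_penalty G (fun e => ∑ v ∈ e, b v) (1 - κ) η K M α hM0 hK hKη hlight
  right
  push Not at hlight
  have hs : (0 : ℝ) < 1 - κ := by linarith
  set b' : V → ℝ := fun v => min (b v / (1 - κ)) 1 with hb'
  have hb'0 : ∀ v, 0 ≤ b' v := fun v => le_min (div_nonneg (hb v) hs.le) zero_le_one
  have hsum' : ∑ v, b' v ≤ T.card * (1 + 2 * κ) := by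
    calc ∑ v, b' v ≤ ∑ v, b v / (1 - κ) := sum_le_sum fun v _ => min_le_left _ _
      _ = (∑ v, b v) / (1 - κ) := by rw [sum_div]
      _ ≤ T.card / (1 - κ) := by gcongr
      _ ≤ T.card * (1 + 2 * κ) := by
        rw [div_le_iff₀ hs]
        have h : 0 ≤ κ * (1 - 2 * κ) := mul_nonneg hκ.le (by linarith)
        nlinarith
  have hthr := card_threshold_le T b' j (2 * κ) hT hn hb'0 (by linarith) hsum'
    (fun u hu v hv => min_le_min_right _ (div_le_div_of_nonneg_right (htop u hu v hv) hs.le))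
  have hheavy : ∀ e : Finset V, 1 - κ ≤ ∑ v ∈ e, b v → 1 ≤ ∑ v ∈ e, b' v := by
    intro e he
    by_cases hex : ∃ v ∈ e, 1 ≤ b v / (1 - κ)
    · obtain ⟨v, hv, hv1⟩ := hex
      calc (1 : ℝ) = b' v := (min_eq_right hv1).symm
        _ ≤ ∑ v ∈ e, b' v := single_le_sum (fun v _ => hb'0 v) hv
    · push Not at hex
      rw [sum_congr rfl fun v hv => min_eq_left (hex v hv).le, ← sum_div, le_div_iff₀ hs, one_mul]
      exact he
  have hcard : (G.card : ℝ) ≤ _ := Nat.cast_le.2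
    (card_le_card_filter_add G _ hGsub (fun e => ∑ v ∈ e, b v) (1 - κ))
  push_cast at hcard
  have hcard2 : (((univ.powersetCard (j + 1)).filter fun e : Finset V =>
      1 - κ ≤ ∑ v ∈ e, b v).card : ℝ) ≤
      ((univ.powersetCard (j + 1)).filter fun e : Finset V => 1 ≤ ∑ v ∈ e, b' v).card := by
    exact_mod_cast card_le_card (monotone_filter_right _ fun e _ he => hheavy e he)
  set N : ℝ := ((n - T.card).choose j : ℝ) with hN
  set Z := ∑ v ∈ T, (1 - b' v) with hZ
  have hNn : N ≤ (n : ℝ) ^ j := by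
    have : (n - T.card).choose j ≤ n ^ j :=
      (Nat.choose_le_pow _ _).trans (Nat.pow_le_pow_left (Nat.sub_le _ _) _)
    rw [hN]; exact_mod_cast this
  have hZ0 : 0 ≤ Z := sum_nonneg fun v _ => sub_nonneg.2 (min_le_right _ _)
  have hNt : N * T.card ≤ M := by
    rw [hM, pow_succ]; gcongr
  have hZle : Z ≤ (2 * j + 1) * (δ + η + 4 * κ) / c * T.card := by
    have h1 : N * (Z / (2 * j + 1) - 2 * (2 * κ) * T.card) ≤ (δ + η) * M := by linarith
    have h2 : N * Z / (2 * j + 1) ≤ (δ + η + 4 * κ) * M := by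
      have : N * (Z / (2 * j + 1) - 2 * (2 * κ) * T.card) =
        N * Z / (2 * j + 1) - 4 * κ * (N * T.card) := by ring
      have h3 : 4 * κ * (N * T.card) ≤ 4 * κ * M := by gcongr
      linarith
    rw [div_le_iff₀ hd] at h2
    have h3 : c * M * Z ≤ (δ + η + 4 * κ) * M * (2 * j + 1) * T.card := by
      calc c * M * Z ≤ (N * T.card) * Z := by gcongr
        _ = N * Z * T.card := by ring
        _ ≤ _ := by gcongr
    have h4 : c * Z ≤ (δ + η + 4 * κ) * (2 * j + 1) * T.card := by
      refine le_of_mul_le_mul_left ?_ hM0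
      linarith
    rw [div_mul_eq_mul_div, le_div_iff₀ hc0]
    linarith
  have hB : ∑ v ∈ Tᶜ, b' v ≤ Z + 2 * κ * T.card := by
    have h1 := sum_add_sum_compl T b'
    have h2 : Z = T.card - ∑ v ∈ T, b' v := by simp [hZ]
    linarith
  have hE₀ : (((Tᶜ.powersetCard (j + 1)).filter fun e => 1 ≤ ∑ v ∈ e, b' v).card : ℝ) ≤
      (Z + 2 * κ * T.card) * (n : ℝ) ^ j := by
    calc (((Tᶜ.powersetCard (j + 1)).filter fun e => 1 ≤ ∑ v ∈ e, b' v).card : ℝ)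
        = ∑ e ∈ (Tᶜ.powersetCard (j + 1)).filter fun e => 1 ≤ ∑ v ∈ e, b' v, (1 : ℝ) := by simp
      _ ≤ ∑ e ∈ (Tᶜ.powersetCard (j + 1)).filter fun e => 1 ≤ ∑ v ∈ e, b' v, ∑ v ∈ e, b' v :=
          sum_le_sum fun e he => (mem_filter.1 he).2
      _ ≤ ∑ e ∈ Tᶜ.powersetCard (j + 1), ∑ v ∈ e, b' v :=
          sum_le_sum_of_subset_of_nonneg (filter_subset _ _)
            fun e _ _ => sum_nonneg fun v _ => hb'0 v
      _ = ∑ v ∈ Tᶜ, b' v * ((Tᶜ.powersetCard (j + 1)).filter (fun e => v ∈ e)).card :=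
          sum_sum_mem_comm _ _ (fun e he => (mem_powersetCard.1 he).1) b'
      _ ≤ ∑ v ∈ Tᶜ, b' v * (n : ℝ) ^ j := by
          refine sum_le_sum fun v hv => mul_le_mul_of_nonneg_left ?_ (hb'0 v)
          rw [card_powersetCard_mem _ hv]
          have : (Tᶜ.card - 1).choose j ≤ n ^ j :=
            (Nat.choose_le_pow _ _).trans (Nat.pow_le_pow_left
              ((Nat.sub_le _ _).trans (card_le_univ _)) _)
          exact_mod_cast this
      _ = (∑ v ∈ Tᶜ, b' v) * (n : ℝ) ^ j := by rw [sum_mul]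
      _ ≤ _ := by gcongr
  have hE₀M : (Z + 2 * κ * T.card) * (n : ℝ) ^ j ≤
      ((2 * j + 1) * (δ + η + 4 * κ) / c + 2 * κ) * M := by
    have h0 : Z + 2 * κ * T.card ≤
        ((2 * j + 1) * (δ + η + 4 * κ) / c + 2 * κ) * T.card := by linarith
    have hq : 0 ≤ (2 * j + 1) * (δ + η + 4 * κ) / c + 2 * κ := by
      by_contra hneg
      push Not at hneg
      have : 0 ≤ Z + 2 * κ * T.card := by positivity
      nlinarith
    calc (Z + 2 * κ * T.card) * (n : ℝ) ^ j
        ≤ (((2 * j + 1) * (δ + η + 4 * κ) / c + 2 * κ) * n) * (n : ℝ) ^ j := by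
          gcongr
          exact h0.trans (by gcongr)
      _ = _ := by rw [hM]; ring
  have hcount : G.card + ((univ.powersetCard (j + 1)).filter
        fun e => (∃ v ∈ e, v ∈ T) ∧ e ∉ G).card + (n - T.card).choose (j + 1) ≤
      n.choose (j + 1) + (G.filter fun e => ∑ v ∈ e, b v < 1 - κ).card +
        ((Tᶜ.powersetCard (j + 1)).filter fun e => 1 ≤ ∑ v ∈ e, b' v).card := by
    set R := (univ.powersetCard (j + 1)).filter fun e : Finset V => (∃ v ∈ e, v ∈ T) ∧ e ∉ G
    set L := G.filter fun e => ∑ v ∈ e, b v < 1 - κ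
    set E₀ := (Tᶜ.powersetCard (j + 1)).filter fun e => 1 ≤ ∑ v ∈ e, b' v
    have hcover : G ∪ R ⊆ (G.filter fun e => ∃ v ∈ e, v ∈ T) ∪ R ∪ (L ∪ E₀) := by
      intro e he
      rcases mem_union.1 he with he | he
      · by_cases hmeet : ∃ v ∈ e, v ∈ T
        · exact mem_union_left _ (mem_union_left _ (mem_filter.2 ⟨he, hmeet⟩))
        · refine mem_union_right _ ?_
          by_cases hl : ∑ v ∈ e, b v < 1 - κ
          · exact mem_union_left _ (mem_filter.2 ⟨he, hl⟩)
          · refine mem_union_right _ (mem_filter.2 ⟨mem_powersetCard.2 ⟨fun v hv => ?_, ?_⟩, ?_⟩)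
            · exact mem_compl.2 fun hvT => hmeet ⟨v, hv, hvT⟩
            · exact mem_powersetCard_univ.1 (hGsub he)
            · exact hheavy e (not_lt.1 hl)
      · exact mem_union_left _ (mem_union_right _ he)
    have hGR : Disjoint G R := disjoint_left.2 fun e he he' => (mem_filter.1 he').2.2 he
    have hA : Disjoint ((G.filter fun e => ∃ v ∈ e, v ∈ T) ∪ R) (Tᶜ.powersetCard (j + 1)) := by
      refine disjoint_left.2 fun e he he' => ?_
      have : ∃ v ∈ e, v ∈ T := by
        rcases mem_union.1 he with he | he
        · exact (mem_filter.1 he).2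
        · exact (mem_filter.1 he).2.1
      obtain ⟨v, hv, hvT⟩ := this
      exact mem_compl.1 ((mem_powersetCard.1 he').1 hv) hvT
    have hA2 : ((G.filter fun e => ∃ v ∈ e, v ∈ T) ∪ R) ∪ Tᶜ.powersetCard (j + 1) ⊆
        univ.powersetCard (j + 1) :=
      union_subset (union_subset ((filter_subset _ _).trans hGsub) (filter_subset _ _))
        (powersetCard_mono (subset_univ _))
    have h1 := card_le_card hA2
    rw [card_union_of_disjoint hA, card_powersetCard, card_powersetCard, card_univ, card_compl,
      ← hndef] at h1
    have h2 := card_le_card hcover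
    rw [card_union_of_disjoint hGR] at h2
    have h3 := card_union_le ((G.filter fun e => ∃ v ∈ e, v ∈ T) ∪ R) (L ∪ E₀)
    have h4 := card_union_le L E₀
    omega
  have hcountR : (G.card : ℝ) + ((univ.powersetCard (j + 1)).filter
        fun e => (∃ v ∈ e, v ∈ T) ∧ e ∉ G).card + (n - T.card).choose (j + 1) ≤
      n.choose (j + 1) + (G.filter fun e => ∑ v ∈ e, b v < 1 - κ).card +
        ((Tᶜ.powersetCard (j + 1)).filter fun e => 1 ≤ ∑ v ∈ e, b' v).card := by
    exact_mod_cast hcount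
  linarith

end Threshold

/-- Dual feasibility with uniform constants, for weights of total mass at most `|I|`. -/
theorem exists_dual_constants (j : ℕ) (c ε : ℝ) (hc0 : 0 < c) (hε : 0 < ε) :
    ∃ δ > 0, ∃ K > 0, ∀ {V ι : Type} [Fintype V] [DecidableEq V] (I : Finset ι)
      (G : ι → Finset (Finset V)), 1 ≤ I.card → 2 * (j + 1) * I.card ≤ Fintype.card V →
      c * (Fintype.card V : ℝ) ^ (j + 1) ≤ (Fintype.card V - I.card).choose j * I.card →
      (∀ i ∈ I, G i ⊆ univ.powersetCard (j + 1)) →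
      (∀ i ∈ I, ((Fintype.card V).choose (j + 1) : ℝ) - (Fintype.card V - I.card).choose (j + 1) -
        δ * (Fintype.card V : ℝ) ^ (j + 1) ≤ (G i).card) →
      (∀ T : Finset V, T.card = I.card → ε * (Fintype.card V : ℝ) ^ (j + 2) ≤
        ∑ i ∈ I, (((univ.powersetCard (j + 1)).filter
          fun e => (∃ v ∈ e, v ∈ T) ∧ e ∉ G i).card : ℝ)) →
      ∀ (α : ι → ℝ) (b : V → ℝ), (∀ v, 0 ≤ b v) →
        ∑ i ∈ I, α i ≤ ∑ v, b v + K / (Fintype.card V : ℝ) ^ (j + 1) *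
          ∑ i ∈ I, ∑ e ∈ G i, max (α i - ∑ v ∈ e, b v) 0 := by
  classical
  have hd : (0 : ℝ) < 2 * j + 1 := by positivity
  set D : ℝ := 4 + 6 * (2 * j + 1) / c with hD
  have hD0 : 0 < D := by positivity
  set x : ℝ := min (1 / 2) (ε / 2 / (2 * D)) with hx
  have hx0 : 0 < x := lt_min (by norm_num) (by positivity)
  have hx1 : x ≤ 1 / 2 := min_le_left _ _
  have hxD : x * D < ε / 2 := by
    have : x ≤ ε / 2 / (2 * D) := min_le_right _ _
    have h2 : x * D ≤ ε / 2 / (2 * D) * D := by gcongr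
    have h3 : ε / 2 / (2 * D) * D = ε / 4 := by field_simp; norm_num
    linarith
  set κ : ℝ := min 1 (ε / 2 * x) with hκ
  have hκ0 : 0 < κ := lt_min one_pos (by positivity)
  set y : ℝ := c * κ / (4 * (2 * j + 1)) with hy
  have hy0 : 0 < y := by positivity
  set δ : ℝ := min x y
  set K : ℝ := max (1 / x) (1 / y) with hK
  have hK0 : 0 < K := lt_max_of_lt_left (by positivity)
  have hKx : 1 ≤ K * x := by
    have : 1 / x * x ≤ K * x := by gcongr; exact le_max_left _ _
    rwa [one_div_mul_cancel hx0.ne'] at this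
  have hKy : 1 ≤ K * y := by
    have : 1 / y * y ≤ K * y := by gcongr; exact le_max_right _ _
    rwa [one_div_mul_cancel hy0.ne'] at this
  refine ⟨δ, lt_min hx0 hy0, K, hK0, ?_⟩
  intro V ι _ _ I G hI1 hn hc hGsub hG hmiss α b hb
  set n := Fintype.card V with hndef
  set M : ℝ := (n : ℝ) ^ (j + 1) with hM
  have hIR : (1 : ℝ) ≤ I.card := by exact_mod_cast hI1
  have hIn : I.card ≤ n := by nlinarith
  have hInR : (I.card : ℝ) ≤ n := by exact_mod_cast hIn
  have hn0 : (0 : ℝ) < n := by linarith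
  have hM0 : 0 < M := by positivity
  -- normalized weights
  have key : ∀ (α : ι → ℝ) (b : V → ℝ), (∀ v, 0 ≤ b v) → ∑ v, b v = I.card →
      ∑ i ∈ I, α i ≤ I.card + K / M * ∑ i ∈ I, ∑ e ∈ G i, max (α i - ∑ v ∈ e, b v) 0 := by
    intro α b hb hsum
    obtain ⟨T, hTc, htop⟩ := exists_top_subset b I.card hIn
    rw [← hTc] at hI1 hn hc hsum
    set R : ι → ℝ := fun i => (((univ.powersetCard (j + 1)).filter
          fun e => (∃ v ∈ e, v ∈ T) ∧ e ∉ G i).card : ℝ) with hR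
    set bad := I.filter fun i => ε / 2 * M < R i with hbad
    have hRM : ∀ i, R i ≤ M := by
      intro i
      have h1 : ((univ.powersetCard (j + 1)).filter
          fun e => (∃ v ∈ e, v ∈ T) ∧ e ∉ G i).card ≤ n ^ (j + 1) := by
        refine (card_filter_le _ _).trans ?_
        rw [card_powersetCard, card_univ]
        exact Nat.choose_le_pow _ _
      simp only [hM, hR]; exact_mod_cast h1
    have hbadcard : ε / 2 * n ≤ bad.card := by
      have h1 : ∑ i ∈ I, R i ≤ ∑ i ∈ I, ((if ε / 2 * M < R i then M else 0) + ε / 2 * M) := by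
        refine sum_le_sum fun i _ => ?_
        have := hRM i
        split_ifs with h
        · have : 0 < ε / 2 * M := by positivity
          linarith
        · linarith
      rw [sum_add_distrib, ← sum_filter, sum_const, sum_const, nsmul_eq_mul, nsmul_eq_mul] at h1
      have h2 := hmiss T hTc
      have h3 : ε * (n : ℝ) ^ (j + 2) = ε * n * M := by rw [hM]; ring
      have h4 : (I.card : ℝ) * (ε / 2 * M) ≤ n * (ε / 2 * M) := by gcongr
      refine le_of_mul_le_mul_right ?_ hM0
      change _ ≤ (bad.card : ℝ) * M
      linarith
    have hterm : ∀ i ∈ I, α i ≤ 1 + κ - (if ε / 2 * M < R i then κ + x else 0) +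
        K / M * ∑ e ∈ G i, max (α i - ∑ v ∈ e, b v) 0 := by
      intro i hi
      have hGi := hG i hi
      rw [← hTc] at hGi
      split_ifs with h
      · rcases le_one_sub_penalty_or_card_missing_le T b j (G i) c δ M hI1 hn hb hsum.le htop hM hc0
          hc (hGsub i hi) hGi x x K hx0 hx1 hK0.le hKx with h1 | h1
        · linarith [h1 (α i)]
        · exfalso
          change R i ≤ _ at h1
          have h2 : δ ≤ x := min_le_left _ _
          have h3 : (δ + x + (2 * j + 1) * (δ + x + 4 * x) / c + 2 * x) ≤ x * D := by
            calc (δ + x + (2 * j + 1) * (δ + x + 4 * x) / c + 2 * x)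
                ≤ (x + x + (2 * j + 1) * (x + x + 4 * x) / c + 2 * x) := by gcongr
              _ = x * D := by rw [hD]; ring
          have h4 : (δ + x + (2 * j + 1) * (δ + x + 4 * x) / c + 2 * x) * M ≤ ε / 2 * M := by
            gcongr; linarith
          linarith
      · have := le_one_add_penalty T b j (G i) c δ M hI1 hn hb hsum.le htop hM0
          hc (hGsub i hi) hGi κ K (α i) hκ0 (min_le_left _ _) (min_le_right _ _) hK0.le hKy
        linarith
    have h1 := sum_le_sum hterm
    rw [sum_add_distrib, sum_sub_distrib, ← sum_filter, ← mul_sum, sum_const, sum_const,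
      nsmul_eq_mul, nsmul_eq_mul] at h1
    change _ ≤ (I.card : ℝ) * (1 + κ) - (bad.card : ℝ) * (κ + x) + _ at h1
    have h2 : (I.card : ℝ) * κ ≤ bad.card * (κ + x) := by
      calc (I.card : ℝ) * κ ≤ n * (ε / 2 * x) := by gcongr; exact min_le_right _ _
        _ = (ε / 2 * n) * x := by ring
        _ ≤ bad.card * x := by gcongr
        _ ≤ bad.card * (κ + x) := by gcongr; linarith
    linarith
  -- weights of positive total mass
  have pos : ∀ (b : V → ℝ), (∀ v, 0 ≤ b v) → 0 < ∑ v, b v →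
      ∑ i ∈ I, α i ≤ ∑ v, b v + K / M * ∑ i ∈ I, ∑ e ∈ G i, max (α i - ∑ v ∈ e, b v) 0 := by
    intro b hb hpos
    set β := (∑ v, b v) / I.card with hβ
    have hβ0 : 0 < β := by positivity
    have h1 := key (fun i => α i / β) (fun v => b v / β) (fun v => div_nonneg (hb v) hβ0.le) (by
      rw [← sum_div, hβ]; field_simp)
    have h2 : ∀ i ∈ I, ∀ e ∈ G i, max (α i / β - ∑ v ∈ e, b v / β) 0 =
        max (α i - ∑ v ∈ e, b v) 0 / β := by
      intro i _ e _
      rw [← sum_div, ← sub_div, ← zero_div β, max_div_div_right hβ0.le, zero_div]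
    rw [sum_congr rfl fun i hi => sum_congr rfl (h2 i hi)] at h1
    simp only [← sum_div] at h1
    rw [div_le_iff₀ hβ0] at h1
    have h3 : (I.card : ℝ) * β = ∑ v, b v := by rw [hβ]; field_simp
    rw [add_mul, h3, mul_assoc, div_mul_cancel₀ _ hβ0.ne'] at h1
    exact h1
  refine le_of_forall_pos_le_add fun s hs => ?_
  have hs' : 0 < s / n := by positivity
  have h1 := pos (fun v => b v + s / n) (fun v => by have := hb v; positivity) (by
    rw [sum_add_distrib, sum_const, nsmul_eq_mul, card_univ, ← hndef]
    have : 0 ≤ ∑ v, b v := sum_nonneg fun v _ => hb v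
    positivity)
  have h2 : ∑ v, (b v + s / n) = ∑ v, b v + s := by
    rw [sum_add_distrib, sum_const, nsmul_eq_mul, card_univ, ← hndef]
    field_simp
  have h3 : K / M * ∑ i ∈ I, ∑ e ∈ G i, max (α i - ∑ v ∈ e, (b v + s / n)) 0 ≤
      K / M * ∑ i ∈ I, ∑ e ∈ G i, max (α i - ∑ v ∈ e, b v) 0 := by
    gcongr
    linarith
  rw [h2] at h1
  linarith

/-- Linear programming duality: a capacitated fractional matching with prescribed degrees on one
side and degrees at most `1` on the other exists as soon as the dual inequalities hold. -/
theorem exists_capacitated_fractional_matching {ι V : Type*} [Fintype ι] [Fintype V]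
    [DecidableEq ι] [DecidableEq V] (P : Finset (ι × Finset V)) (a : ι → ℝ) (D : ℝ) (hD : 0 ≤ D)
    (hdual : ∀ (α : ι → ℝ) (b : V → ℝ), (∀ v, 0 ≤ b v) →
      ∑ i, a i * α i ≤ ∑ v, b v + D * ∑ x ∈ P, max (α x.1 - ∑ v ∈ x.2, b v) 0) :
    ∃ w : ι × Finset V → ℝ, (∀ x, 0 ≤ w x ∧ w x ≤ D) ∧
      (∀ i, ∑ x ∈ P with x.1 = i, w x = a i) ∧
      (∀ v, ∑ x ∈ P with v ∈ x.2, w x ≤ 1) := by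
  let L : (ι × Finset V → ℝ) →ₗ[ℝ] (ι → ℝ) × (V → ℝ) :=
    { toFun := fun w => (fun i => ∑ x ∈ P with x.1 = i, w x, fun v => ∑ x ∈ P with v ∈ x.2, w x)
      map_add' := fun w w' => by ext <;> simp [sum_add_distrib]
      map_smul' := fun r w => by ext <;> simp [mul_sum] }
  set box : Set (ι × Finset V → ℝ) := Set.Icc 0 (fun _ => D) with hbox
  set C : Set ((ι → ℝ) × (V → ℝ)) := {a} ×ˢ Set.Iic 1 with hC
  by_cases hdis : Disjoint (L '' box) C
  · exfalso
    obtain ⟨f, u, v, hfu, huv, hfv⟩ := geometric_hahn_banach_compact_closed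
      ((convex_Icc _ _).linear_image L)
      (isCompact_Icc.image (LinearMap.continuous_of_finiteDimensional L))
      ((convex_singleton a).prod (convex_Iic _)) (isClosed_singleton.prod isClosed_Iic) hdis
    set α : ι → ℝ := fun i => f (Pi.single i 1, 0) with hα
    set b : V → ℝ := fun v => - f (0, Pi.single v 1) with hb
    have hf : ∀ p q, f (p, q) = ∑ i, p i * α i - ∑ v, q v * b v := by
      intro p q
      have h1 : (p, q) = ∑ i, p i • ((Pi.single i 1, 0) : (ι → ℝ) × (V → ℝ)) +
          ∑ v, q v • ((0, Pi.single v 1) : (ι → ℝ) × (V → ℝ)) := by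
        ext x
        · simp [Prod.fst_sum, Finset.sum_apply, Pi.single_apply]
        · simp [Prod.snd_sum, Finset.sum_apply, Pi.single_apply]
      rw [h1, map_add, map_sum, map_sum]
      simp only [map_smul, smul_eq_mul, hα, hb, mul_neg, sum_neg_distrib, sub_neg_eq_add]
    have hb0 : ∀ v, 0 ≤ b v := by
      intro v₀
      by_contra hneg
      push Not at hneg
      set B := ∑ i, a i * α i - ∑ v, b v with hB
      set s : ℝ := max 0 ((B - v) / (- b v₀)) with hs
      have h1 := hfv (a, fun v => 1 - s * (if v = v₀ then 1 else 0)) (by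
        refine ⟨rfl, fun v => ?_⟩
        have : 0 ≤ s := le_max_left _ _
        simp only [Pi.one_apply]
        split_ifs <;> linarith)
      rw [hf] at h1
      have h2 : ∑ v, (1 - s * (if v = v₀ then (1 : ℝ) else 0)) * b v = ∑ v, b v - s * b v₀ := by
        simp [sub_mul, sum_sub_distrib]
      rw [h2] at h1
      have h3 : (B - v) / (- b v₀) ≤ s := le_max_right _ _
      rw [div_le_iff₀ (by linarith)] at h3
      linarith
    set w : ι × Finset V → ℝ := fun x => if 0 < α x.1 - ∑ v ∈ x.2, b v then D else 0 with hw
    have hwbox : w ∈ box := by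
      constructor <;> intro x <;> simp only [hw, Pi.zero_apply] <;> split_ifs <;> simp [hD]
    have h1 := hfu _ ⟨w, hwbox, rfl⟩
    have h2 := hfv (a, 1) ⟨rfl, Set.mem_Iic.2 le_rfl⟩
    rw [hf] at h2
    have h3 : f (L w) = D * ∑ x ∈ P, max (α x.1 - ∑ v ∈ x.2, b v) 0 := by
      change f (_, _) = _
      rw [hf]
      have e1 : ∑ i, (∑ x ∈ P with x.1 = i, w x) * α i = ∑ x ∈ P, w x * α x.1 := by
        simp only [sum_filter, sum_mul, ite_mul, zero_mul]
        rw [sum_comm]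
        simp
      have e2 : ∑ v, (∑ x ∈ P with v ∈ x.2, w x) * b v = ∑ x ∈ P, w x * ∑ v ∈ x.2, b v := by
        simp only [sum_filter, sum_mul, ite_mul, zero_mul]
        rw [sum_comm]
        simp [mul_sum]
      rw [e1, e2, ← sum_sub_distrib, mul_sum]
      refine sum_congr rfl fun x _ => ?_
      rw [← mul_sub]
      simp only [hw]
      split_ifs with h
      · rw [max_eq_left h.le]
      · rw [max_eq_right (not_lt.1 h)]; simp
    have h4 := hdual α b hb0
    simp only [Pi.one_apply, one_mul] at h2
    linarith
  · obtain ⟨p, ⟨w, hw, rfl⟩, hp⟩ := Set.not_disjoint_iff.1 hdis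
    refine ⟨w, fun x => ⟨hw.1 x, hw.2 x⟩, fun i => ?_, fun v => ?_⟩
    · exact congrFun hp.1 i
    · exact hp.2 v

/-- The exponential moment method: if the Chernoff bounds of all bad events add up to less than `1`,
some subset of `P` avoids all of them. -/
theorem exists_subset_of_sum_exp_lt_one {E J : Type*} [DecidableEq E] (P : Finset E) (p : E → ℝ)
    (hp : ∀ e ∈ P, 0 ≤ p e ∧ p e ≤ 1) (S : Finset J) (Q : J → E → Prop)
    [∀ j, DecidablePred (Q j)] (l c : J → ℝ)
    (h : ∑ j ∈ S, Real.exp ((Real.exp (l j) - 1) * ∑ e ∈ P with Q j e, p e - l j * c j) < 1) :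
    ∃ s ⊆ P, ∀ j ∈ S, l j * (s.filter (Q j)).card < l j * c j := by
  by_contra hcon
  push Not at hcon
  set μ : Finset E → ℝ := fun s => (∏ e ∈ s, p e) * ∏ e ∈ P \ s, (1 - p e) with hμ
  have hμ0 : ∀ s ∈ P.powerset, 0 ≤ μ s := by
    intro s hs
    refine mul_nonneg (prod_nonneg fun e he => (hp e (mem_powerset.1 hs he)).1)
      (prod_nonneg fun e he => sub_nonneg.2 (hp e (mem_sdiff.1 he).1).2)
  have hμ1 : ∑ s ∈ P.powerset, μ s = 1 := by
    rw [hμ, ← prod_add]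
    simp
  have hmgf : ∀ j, ∑ s ∈ P.powerset, μ s * Real.exp (l j * (s.filter (Q j)).card) ≤
      Real.exp ((Real.exp (l j) - 1) * ∑ e ∈ P with Q j e, p e) := by
    intro j
    have h1 : ∀ s ∈ P.powerset, μ s * Real.exp (l j * (s.filter (Q j)).card) =
        (∏ e ∈ s, p e * (if Q j e then Real.exp (l j) else 1)) * ∏ e ∈ P \ s, (1 - p e) := by
      intro s _
      rw [prod_mul_distrib, ← prod_filter, prod_const, ← Real.exp_nat_mul, hμ,
        mul_comm (l j)]
      ring
    rw [sum_congr rfl h1, ← prod_add, sum_filter, mul_sum, Real.exp_sum]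
    refine prod_le_prod (fun e he => ?_) fun e he => ?_
    · have := hp e he
      have h2 : 0 ≤ (if Q j e then Real.exp (l j) else 1) := by split_ifs <;> positivity
      have := mul_nonneg this.1 h2
      linarith [(hp e he).2]
    · split_ifs with hQ
      · have := Real.add_one_le_exp ((Real.exp (l j) - 1) * p e)
        linarith
      · simp
  have hge : ∀ s ∈ P.powerset,
      1 ≤ ∑ j ∈ S, Real.exp (l j * (s.filter (Q j)).card - l j * c j) := by
    intro s hs
    obtain ⟨j, hj, hle⟩ := hcon s (mem_powerset.1 hs)
    calc (1 : ℝ) ≤ Real.exp (l j * (s.filter (Q j)).card - l j * c j) :=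
          Real.one_le_exp (by linarith)
      _ ≤ _ := single_le_sum (f := fun j => Real.exp (l j * (s.filter (Q j)).card - l j * c j))
          (fun j _ => (Real.exp_pos _).le) hj
  have : (1 : ℝ) ≤
      ∑ j ∈ S, Real.exp ((Real.exp (l j) - 1) * ∑ e ∈ P with Q j e, p e - l j * c j) := by
    calc (1 : ℝ) = ∑ s ∈ P.powerset, μ s := hμ1.symm
      _ ≤ ∑ s ∈ P.powerset, μ s *
            ∑ j ∈ S, Real.exp (l j * (s.filter (Q j)).card - l j * c j) :=
          sum_le_sum fun s hs => le_mul_of_one_le_right (hμ0 s hs) (hge s hs)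
      _ = ∑ j ∈ S, (∑ s ∈ P.powerset, μ s * Real.exp (l j * (s.filter (Q j)).card)) *
            Real.exp (- (l j * c j)) := by
          simp only [mul_sum, sum_mul]
          rw [sum_comm]
          refine sum_congr rfl fun j _ => sum_congr rfl fun s _ => ?_
          rw [sub_eq_add_neg, Real.exp_add]; ring
      _ ≤ _ := by
          refine sum_le_sum fun j _ => ?_
          rw [sub_eq_add_neg, Real.exp_add]
          exact mul_le_mul_of_nonneg_right (hmgf j) (Real.exp_pos _).le
  linarith

section Symmetric

variable {V : Type*} [DecidableEq V] (r : V → ℝ)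

theorem sum_powersetCard_mem_prod (S : Finset V) {v : V} (hv : v ∈ S) (j : ℕ) :
    ∑ e ∈ S.powersetCard (j + 1) with v ∈ e, ∏ u ∈ e, r u =
      r v * ∑ g ∈ (S.erase v).powersetCard j, ∏ u ∈ g, r u := by
  rw [sum_powersetCard_mem S hv j, mul_sum]
  refine sum_congr rfl fun g hg => ?_
  rw [prod_insert fun h => notMem_erase v S ((mem_powersetCard.1 hg).1 h)]

theorem succ_mul_sum_powersetCard_prod (S : Finset V) (j : ℕ) :
    ((j : ℝ) + 1) * ∑ e ∈ S.powersetCard (j + 1), ∏ u ∈ e, r u =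
      ∑ v ∈ S, r v * ∑ g ∈ (S.erase v).powersetCard j, ∏ u ∈ g, r u := by
  rw [← sum_congr rfl fun v hv => sum_powersetCard_mem_prod r S hv j]
  simp only [sum_filter]
  rw [sum_comm, mul_sum]
  refine sum_congr rfl fun e he => ?_
  obtain ⟨he1, he2⟩ := mem_powersetCard.1 he
  rw [← sum_filter, filter_mem_eq_inter, inter_eq_right.2 he1, sum_const, he2, nsmul_eq_mul]
  push_cast
  ring

theorem factorial_mul_sum_powersetCard_prod_le (hr : ∀ v, 0 ≤ r v) (j : ℕ) (S : Finset V) :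
    (j.factorial : ℝ) * ∑ e ∈ S.powersetCard j, ∏ u ∈ e, r u ≤ (∑ v ∈ S, r v) ^ j := by
  induction j generalizing S with
  | zero => simp
  | succ j ih =>
    have h0 : 0 ≤ ∑ v ∈ S, r v := sum_nonneg fun v _ => hr v
    calc (((j + 1).factorial : ℕ) : ℝ) * ∑ e ∈ S.powersetCard (j + 1), ∏ u ∈ e, r u
        = j.factorial * (((j : ℝ) + 1) * ∑ e ∈ S.powersetCard (j + 1), ∏ u ∈ e, r u) := by
          rw [Nat.factorial_succ]; push_cast; ring
      _ = ∑ v ∈ S, r v * (j.factorial * ∑ g ∈ (S.erase v).powersetCard j, ∏ u ∈ g, r u) := by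
          rw [succ_mul_sum_powersetCard_prod, mul_sum]
          exact sum_congr rfl fun v _ => by ring
      _ ≤ ∑ v ∈ S, r v * (∑ v ∈ S, r v) ^ j := by
          refine sum_le_sum fun v _ => mul_le_mul_of_nonneg_left ((ih _).trans ?_) (hr v)
          exact pow_le_pow_left₀ (sum_nonneg fun v _ => hr v)
            (sum_le_sum_of_subset_of_nonneg (erase_subset _ _) fun v _ _ => hr v) _
      _ = (∑ v ∈ S, r v) ^ (j + 1) := by rw [← sum_mul]; ring

theorem le_factorial_mul_sum_powersetCard_prod (hr : ∀ v, 0 ≤ r v) (hr1 : ∀ v, r v ≤ 1) (j : ℕ)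
    (S : Finset V) (hS : (j : ℝ) ≤ ∑ v ∈ S, r v) :
    (∑ v ∈ S, r v - j) ^ j ≤ (j.factorial : ℝ) * ∑ e ∈ S.powersetCard j, ∏ u ∈ e, r u := by
  induction j generalizing S with
  | zero => simp
  | succ j ih =>
    push_cast at hS ⊢
    set R := ∑ v ∈ S, r v with hR
    have h0 : 0 ≤ R := sum_nonneg fun v _ => hr v
    calc (R - (j + 1)) ^ (j + 1) = (R - (j + 1)) * (R - (j + 1)) ^ j := by ring
      _ ≤ R * (R - (j + 1)) ^ j := by
          refine mul_le_mul_of_nonneg_right ?_ (pow_nonneg (by linarith) _)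
          have : (0 : ℝ) ≤ j := Nat.cast_nonneg _
          linarith
      _ = ∑ v ∈ S, r v * (R - (j + 1)) ^ j := by rw [← sum_mul]
      _ ≤ ∑ v ∈ S, r v * (j.factorial * ∑ g ∈ (S.erase v).powersetCard j, ∏ u ∈ g, r u) := by
          refine sum_le_sum fun v hv => mul_le_mul_of_nonneg_left ?_ (hr v)
          have h1 := add_sum_erase S r hv
          have h2 := hr1 v
          refine le_trans ?_ (ih (S.erase v) (by linarith))
          exact pow_le_pow_left₀ (by linarith) (by linarith) _
      _ = j.factorial * (((j : ℝ) + 1) * ∑ e ∈ S.powersetCard (j + 1), ∏ u ∈ e, r u) := by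
          rw [succ_mul_sum_powersetCard_prod, mul_sum]
          exact sum_congr rfl fun v _ => by ring
      _ = (((j + 1).factorial : ℕ) : ℝ) * ∑ e ∈ S.powersetCard (j + 1), ∏ u ∈ e, r u := by
          rw [Nat.factorial_succ]; push_cast; ring

end Symmetric

/-- A fractional matching saturating `I` extends to an almost perfect one if all other vertices of
`ι` are joined to all `(j+1)`-sets; the new weights are spread out evenly. -/
theorem exists_fractional_completion {ι V : Type*} [Fintype ι] [Fintype V] [DecidableEq ι]
    [DecidableEq V] (j : ℕ) (I : Finset ι) (P : Finset (ι × Finset V))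
    (hP : ∀ x ∈ P, x.2.card = j + 1) (hPI : ∀ x, x.1 ∉ I → (x ∈ P ↔ x.2.card = j + 1))
    (w : ι × Finset V → ℝ) (D : ℝ) (hw : ∀ x, 0 ≤ w x ∧ w x ≤ D)
    (hwI : ∀ i ∈ I, ∑ x ∈ P with x.1 = i, w x = 1)
    (hwI' : ∀ x ∈ P, x.1 ∉ I → w x = 0)
    (hwV : ∀ v, ∑ x ∈ P with v ∈ x.2, w x ≤ 1)
    (hcard : (j + 1) * Fintype.card ι = Fintype.card V)
    (hI : 2 * (j + 1) * I.card ≤ Fintype.card V) (hV : 2 * (j + 1) ≤ Fintype.card V) :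
    ∃ W : ι × Finset V → ℝ,
      (∀ x, 0 ≤ W x ∧ W x ≤ max D ((j + 1).factorial * 2 ^ (j + 1) / Fintype.card V ^ (j + 1))) ∧
      (∀ i, 1 - 2 * (j + 1) ^ 2 / Fintype.card V ≤ ∑ x ∈ P with x.1 = i, W x ∧
        ∑ x ∈ P with x.1 = i, W x ≤ 1) ∧
      (∀ v, 1 - 2 * (j + 1) ^ 2 / Fintype.card V ≤ ∑ x ∈ P with v ∈ x.2, W x ∧
        ∑ x ∈ P with v ∈ x.2, W x ≤ 1) := by
  set n := Fintype.card V with hn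
  set r : V → ℝ := fun v => 1 - ∑ x ∈ P with v ∈ x.2, w x with hr
  have hr0 : ∀ v, 0 ≤ r v := fun v => sub_nonneg.2 (hwV v)
  have hr1 : ∀ v, r v ≤ 1 := fun v => sub_le_self _ (sum_nonneg fun x _ => (hw x).1)
  set R := ∑ v, r v with hRdef
  have hwsum : ∑ x ∈ P, w x = I.card := by
    have h1 : ∑ x ∈ P, w x = ∑ i, ∑ x ∈ P with x.1 = i, w x := (sum_fiberwise P _ _).symm
    have h2 : ∀ i, ∑ x ∈ P with x.1 = i, w x = if i ∈ I then 1 else 0 := by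
      intro i
      split_ifs with hi
      · exact hwI i hi
      · exact sum_eq_zero fun x hx => hwI' x (mem_filter.1 hx).1 ((mem_filter.1 hx).2 ▸ hi)
    rw [h1, sum_congr rfl fun i _ => h2 i]
    simp
  have hR : R = n - (j + 1) * I.card := by
    simp only [hRdef, hr, sum_sub_distrib, sum_filter]
    rw [sum_comm, ← hwsum, mul_sum]
    simp only [sum_const, card_univ, nsmul_eq_mul, mul_one]
    congr 1
    refine sum_congr rfl fun x hx => ?_
    simp [hP x hx]
  have hIR : 2 * ((j : ℝ) + 1) * I.card ≤ n := by exact_mod_cast hI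
  have hVR : 2 * ((j : ℝ) + 1) ≤ n := by exact_mod_cast hV
  have hj0 : (0 : ℝ) ≤ j := Nat.cast_nonneg _
  have hRn : (n : ℝ) / 2 ≤ R := by linarith
  have hn0 : (0 : ℝ) < n := by linarith
  have hR0 : 0 < R := by linarith
  have hRk : ((j + 1 : ℕ) : ℝ) ≤ R := by push_cast; linarith
  have hIc : ((j : ℝ) + 1) * (Iᶜ.card : ℝ) = R := by
    have h1 : (Iᶜ.card : ℝ) = Fintype.card ι - I.card := by
      rw [card_compl, Nat.cast_sub (card_le_univ I)]
    have h2 : ((j : ℝ) + 1) * Fintype.card ι = n := by exact_mod_cast hcard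
    rw [h1, hR, ← h2]; ring
  set q : ℝ := (j + 1).factorial / R ^ (j + 1) with hq
  have hq0 : 0 ≤ q := by positivity
  have hratio : 1 - 2 * ((j : ℝ) + 1) ^ 2 / n ≤ (1 - (j + 1) / R) ^ (j + 1) := by
    have h1 : (-2 : ℝ) ≤ - ((j + 1) / R) := by
      rw [neg_le_neg_iff, div_le_iff₀ hR0]; push_cast at hRk; linarith
    have h2 := one_add_mul_le_pow h1 (j + 1)
    push_cast at h2
    rw [← sub_eq_add_neg] at h2
    refine le_trans ?_ h2
    have h3 : ((j : ℝ) + 1) * ((j + 1) / R) ≤ 2 * (j + 1) ^ 2 / n := by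
      rw [mul_div_assoc', div_le_div_iff₀ hR0 hn0]
      have : 0 ≤ ((j : ℝ) + 1) ^ 2 := by positivity
      nlinarith
    linarith
  have hbase0 : 0 ≤ 1 - ((j : ℝ) + 1) / R := by
    push_cast at hRk
    rw [sub_nonneg, div_le_one hR0]; exact hRk
  have hbase1 : 1 - ((j : ℝ) + 1) / R ≤ 1 := by
    have : 0 ≤ ((j : ℝ) + 1) / R := by positivity
    linarith
  set W : ι × Finset V → ℝ := fun x => if x.1 ∈ I then w x else q * ∏ v ∈ x.2, r v with hW
  have hfibre : ∀ i ∉ I, ∀ F : ι × Finset V → ℝ,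
      ∑ x ∈ P with x.1 = i, F x = ∑ e ∈ univ.powersetCard (j + 1), F (i, e) := by
    intro i hi F
    refine sum_bij' (fun x _ => x.2) (fun e _ => (i, e)) ?_ ?_ ?_ ?_ ?_
    · intro x hx
      exact mem_powersetCard_univ.2 (hP x (mem_filter.1 hx).1)
    · intro e he
      exact mem_filter.2 ⟨(hPI (i, e) hi).2 (mem_powersetCard_univ.1 he), rfl⟩
    · intro x hx
      exact Prod.ext (mem_filter.1 hx).2.symm rfl
    · intro e _; rfl
    · intro x hx
      rw [← (mem_filter.1 hx).2]
  refine ⟨W, fun x => ?_, fun i => ?_, fun v => ?_⟩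
  · simp only [hW]
    split_ifs
    · exact ⟨(hw x).1, le_max_of_le_left (hw x).2⟩
    · refine ⟨mul_nonneg hq0 (prod_nonneg fun v _ => hr0 v), le_max_of_le_right ?_⟩
      have h1 : ∏ v ∈ x.2, r v ≤ 1 := prod_le_one (fun v _ => hr0 v) fun v _ => hr1 v
      calc q * ∏ v ∈ x.2, r v ≤ q * 1 := by gcongr
        _ = (j + 1).factorial / R ^ (j + 1) := mul_one _
        _ ≤ (j + 1).factorial / (n / 2) ^ (j + 1) := by gcongr
        _ = _ := by rw [div_pow]; field_simp
  · by_cases hi : i ∈ I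
    · have h1 : ∑ x ∈ P with x.1 = i, W x = 1 := by
        rw [← hwI i hi]
        refine sum_congr rfl fun x hx => ?_
        rw [hW]
        simp only [(mem_filter.1 hx).2, if_pos hi]
      rw [h1]
      refine ⟨?_, le_rfl⟩
      have : 0 ≤ 2 * ((j : ℝ) + 1) ^ 2 / n := by positivity
      linarith
    · have h1 : ∑ x ∈ P with x.1 = i, W x =
          ((j + 1).factorial * ∑ e ∈ univ.powersetCard (j + 1), ∏ v ∈ e, r v) / R ^ (j + 1) := by
        rw [hfibre i hi]
        simp only [hW, if_neg hi]
        rw [← mul_sum, hq]; ring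
      rw [h1]
      constructor
      · refine hratio.trans ?_
        rw [le_div_iff₀ (by positivity), ← mul_pow]
        have h2 := le_factorial_mul_sum_powersetCard_prod r hr0 hr1 (j + 1) univ hRk
        have h3 : (1 - ((j : ℝ) + 1) / R) * R = R - ((j + 1 : ℕ) : ℝ) := by
          push_cast; field_simp
        rw [h3]
        exact h2
      · rw [div_le_one (by positivity)]
        exact factorial_mul_sum_powersetCard_prod_le r hr0 (j + 1) univ
  · set e' := ∑ g ∈ (univ.erase v).powersetCard j, ∏ u ∈ g, r u with he'
    have h1 : ∑ x ∈ P with v ∈ x.2, W x = (1 - r v) + r v * (j.factorial * e' / R ^ j) := by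
      have hsplit : ∀ x ∈ P, (if v ∈ x.2 then W x else 0) =
          (if v ∈ x.2 then w x else 0) +
            (if x.1 ∈ Iᶜ then (if v ∈ x.2 then q * ∏ u ∈ x.2, r u else 0) else 0) := by
        intro x hx
        by_cases hxI : x.1 ∈ I
        · simp [hW, hxI]
        · simp [hW, hxI, hwI' x hx hxI]
      rw [sum_filter, sum_congr rfl hsplit, sum_add_distrib, ← sum_filter]
      congr 1
      · simp [hr]
      · have h2 : ∑ x ∈ P, (if x.1 ∈ Iᶜ then (if v ∈ x.2 then q * ∏ u ∈ x.2, r u else 0) else 0) =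
            ∑ i ∈ Iᶜ, ∑ x ∈ P with x.1 = i, (if v ∈ x.2 then q * ∏ u ∈ x.2, r u else 0) := by
          simp only [sum_filter]
          rw [sum_comm]
          refine sum_congr rfl fun x _ => ?_
          rw [sum_ite_eq]
        have h4 : ∀ i ∈ Iᶜ, ∑ x ∈ P with x.1 = i, (if v ∈ x.2 then q * ∏ u ∈ x.2, r u else 0) =
            ∑ e ∈ univ.powersetCard (j + 1), if v ∈ e then q * ∏ u ∈ e, r u else 0 :=
          fun i hi => hfibre i (mem_compl.1 hi) _
        rw [h2, sum_congr rfl h4, sum_const, ← sum_filter, ← mul_sum, sum_powersetCard_mem_prod r univ (mem_univ v) j, ← he', nsmul_eq_mul, hq,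
          pow_succ, Nat.factorial_succ]
        have h3 : (Iᶜ.card : ℝ) = R / (j + 1) := by rw [← hIc]; field_simp
        rw [h3]
        push_cast
        field_simp
    have h2 := add_sum_erase univ r (mem_univ v)
    have hlow : 1 - 2 * ((j : ℝ) + 1) ^ 2 / n ≤ j.factorial * e' / R ^ j := by
      refine hratio.trans ((pow_le_pow_of_le_one hbase0 hbase1 (Nat.le_succ j)).trans ?_)
      rw [le_div_iff₀ (by positivity), ← mul_pow]
      have h3 : (1 - ((j : ℝ) + 1) / R) * R = R - (j + 1) := by field_simp
      push_cast at hRk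
      have h4 := hr1 v
      refine le_trans ?_ (le_factorial_mul_sum_powersetCard_prod r hr0 hr1 j (univ.erase v)
        (by linarith))
      rw [h3]
      exact pow_le_pow_left₀ (by linarith) (by linarith) _
    have hupp : j.factorial * e' / R ^ j ≤ 1 := by
      rw [div_le_one (by positivity)]
      refine (factorial_mul_sum_powersetCard_prod_le r hr0 j (univ.erase v)).trans ?_
      exact pow_le_pow_left₀ (sum_nonneg fun v _ => hr0 v) (by linarith [hr0 v]) _
    rw [h1]
    have herr : 0 ≤ 2 * ((j : ℝ) + 1) ^ 2 / n := by positivity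
    constructor <;> nlinarith [hr0 v, hr1 v]

theorem eventually_sq_mul_exp_lt_one :
    ∀ᶠ n : ℕ in Filter.atTop,
      8 * (n : ℝ) ^ 2 * Real.exp (2 - 3 / 16 * (n : ℝ) ^ (0.18 : ℝ)) < 1 := by
  have h1 : Filter.Tendsto (fun n : ℕ => (n : ℝ) ^ (0.18 : ℝ)) Filter.atTop Filter.atTop :=
    (tendsto_rpow_atTop (by norm_num)).comp tendsto_natCast_atTop_atTop
  have h2 := (tendsto_rpow_mul_exp_neg_mul_atTop_nhds_zero (100 / 9) (3 / 16)
    (by norm_num)).comp h1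
  have h3 := h2.const_mul (8 * Real.exp 2)
  rw [mul_zero] at h3
  filter_upwards [h3.eventually (gt_mem_nhds one_pos)] with n hn
  refine lt_of_eq_of_lt ?_ hn
  have h4 : ((n : ℝ) ^ (0.18 : ℝ)) ^ (100 / 9 : ℝ) = (n : ℝ) ^ 2 := by
    rw [← Real.rpow_mul (Nat.cast_nonneg n), ← Real.rpow_natCast]
    norm_num
  simp only [Function.comp_apply, h4]
  rw [sub_eq_add_neg, Real.exp_add, neg_mul]
  ring

/-- A fractional perfect matching with small weights and small pair weights can be sampled to give
a sparse subgraph which is almost regular with small pair degrees. -/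
theorem exists_almost_regular_subgraph (C : ℝ) :
    ∃ n₀ : ℕ, ∀ n : ℕ, n₀ ≤ n → ∀ {U : Type} [Fintype U] [DecidableEq U],
      Fintype.card U ≤ 2 * n → ∀ (H : Finset (Finset U)) (W : Finset U → ℝ),
      (∀ e ∈ H, 0 ≤ W e ∧ W e ≤ C / n) →
      (∀ x, 1 - C / n ≤ ∑ e ∈ H with x ∈ e, W e ∧ ∑ e ∈ H with x ∈ e, W e ≤ 1) →
      (∀ x y, x ≠ y → ∑ e ∈ H with x ∈ e ∧ y ∈ e, W e ≤ C / n) →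
      ∃ H' ⊆ H,
        (∀ x, |((H'.filter fun e => x ∈ e).card : ℝ) - (n : ℝ) ^ (0.2 : ℝ)| <
          (n : ℝ) ^ (0.19 : ℝ)) ∧
        (∀ x y, x ≠ y → ((H'.filter fun e => x ∈ e ∧ y ∈ e).card : ℝ) < (n : ℝ) ^ (0.19 : ℝ)) := by
  have hev1 : ∀ᶠ n : ℕ in Filter.atTop, C ≤ (n : ℝ) ^ (0.8 : ℝ) :=
    ((tendsto_rpow_atTop (by norm_num)).comp
      tendsto_natCast_atTop_atTop).eventually (Filter.eventually_ge_atTop C)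
  obtain ⟨n₀, hn₀⟩ := Filter.eventually_atTop.1
    ((hev1.and eventually_sq_mul_exp_lt_one).and (Filter.eventually_ge_atTop 1))
  refine ⟨n₀, fun n hn U _ _ hU H W hW hdeg hpair => ?_⟩
  obtain ⟨⟨hC, hexp⟩, hn1⟩ := hn₀ n hn
  have hn1R : (1 : ℝ) ≤ n := by exact_mod_cast hn1
  have hn0 : (0 : ℝ) < n := by linarith
  set D : ℝ := (n : ℝ) ^ (0.2 : ℝ) with hD
  set Δ : ℝ := (n : ℝ) ^ (0.19 : ℝ) with hΔ
  have hD0 : 0 < D := Real.rpow_pos_of_pos hn0 _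
  have hΔ0 : 0 < Δ := Real.rpow_pos_of_pos hn0 _
  have hΔD : Δ ≤ D := Real.rpow_le_rpow_of_exponent_le hn1R (by norm_num)
  have hD1 : 1 ≤ D := Real.one_le_rpow hn1R (by norm_num)
  have hDC : D * (C / n) ≤ 1 := by
    rw [mul_div_assoc', div_le_one hn0]
    calc D * C ≤ D * (n : ℝ) ^ (0.8 : ℝ) := by gcongr
      _ = n := by rw [hD, ← Real.rpow_add hn0]; norm_num
  have hsq : Δ ^ 2 / D = (n : ℝ) ^ (0.18 : ℝ) := by
    rw [hΔ, hD, ← Real.rpow_natCast, ← Real.rpow_mul hn0.le, ← Real.rpow_sub hn0]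
    norm_num
  have hΔ18 : (n : ℝ) ^ (0.18 : ℝ) ≤ Δ := Real.rpow_le_rpow_of_exponent_le hn1R (by norm_num)
  have h18 : 0 < (n : ℝ) ^ (0.18 : ℝ) := Real.rpow_pos_of_pos hn0 _
  set y : ℝ := (n : ℝ) ^ (0.18 : ℝ) with hy
  set l : ℝ := Δ / (4 * D) with hl
  have hl0 : 0 < l := by positivity
  have hl1 : l ≤ 1 := by rw [hl, div_le_one (by positivity)]; linarith
  have hlΔ : l * Δ = y / 4 := by rw [← hsq, hl]; field_simp
  have hlD : l ^ 2 * D = y / 16 := by rw [← hsq, hl]; field_simp; norm_num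
  have hmean : ∀ x, D - 1 ≤ ∑ e ∈ H with x ∈ e, D * W e ∧ ∑ e ∈ H with x ∈ e, D * W e ≤ D := by
    intro x
    rw [← mul_sum]
    constructor
    · nlinarith [(hdeg x).1, mul_le_mul_of_nonneg_left (hdeg x).1 hD0.le]
    · nlinarith [(hdeg x).2]
  have hexpl : ∀ u : ℝ, |u| ≤ 1 → Real.exp u - 1 ≤ u + u ^ 2 := by
    intro u hu
    have := abs_le.1 (Real.abs_exp_sub_one_sub_id_le hu)
    linarith [this.2]
  let Q : U ⊕ U ⊕ U × U → Finset U → Prop := fun j e =>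
    Sum.elim (fun x => x ∈ e) (Sum.elim (fun x => x ∈ e)
      fun z => z.1 ≠ z.2 ∧ z.1 ∈ e ∧ z.2 ∈ e) j
  let L : U ⊕ U ⊕ U × U → ℝ := Sum.elim (fun _ => l) (Sum.elim (fun _ => -l) fun _ => 1)
  let c : U ⊕ U ⊕ U × U → ℝ := Sum.elim (fun _ => D + Δ) (Sum.elim (fun _ => D - Δ) fun _ => Δ)
  classical
  have hbound : ∀ j ∈ (univ : Finset (U ⊕ U ⊕ U × U)),
      Real.exp ((Real.exp (L j) - 1) * ∑ e ∈ H with Q j e, D * W e - L j * c j) ≤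
        Real.exp (2 - 3 / 16 * y) := by
    intro j _
    rw [Real.exp_le_exp]
    rcases j with x | x | ⟨x, z⟩
    · have hm : ∑ e ∈ H with Q (Sum.inl x) e, D * W e ≤ D := by
        convert (hmean x).2
        exact Iff.rfl
      generalize ∑ e ∈ H with Q (Sum.inl x) e, D * W e = M at hm ⊢
      simp only [L, c, Sum.elim_inl]
      have h1 := hexpl l (by rwa [abs_of_pos hl0])
      have h2 : 0 ≤ Real.exp l - 1 := by linarith [Real.add_one_le_exp l]
      nlinarith [mul_le_mul_of_nonneg_left hm h2, mul_le_mul_of_nonneg_right h1 hD0.le]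
    · have hm : D - 1 ≤ ∑ e ∈ H with Q (Sum.inr (Sum.inl x)) e, D * W e := by
        convert (hmean x).1
        exact Iff.rfl
      generalize ∑ e ∈ H with Q (Sum.inr (Sum.inl x)) e, D * W e = M at hm ⊢
      simp only [L, c, Sum.elim_inl, Sum.elim_inr]
      have h1 := hexpl (-l) (by rwa [abs_neg, abs_of_pos hl0])
      have h2 : -l + (-l) ^ 2 ≤ 0 := by nlinarith
      have h3 : 0 ≤ 1 - Real.exp (-l) := by linarith
      nlinarith [mul_le_mul_of_nonneg_left hm h3,
        mul_le_mul_of_nonneg_right h1 (by linarith : 0 ≤ D - 1)]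
    · have h1 : ∑ e ∈ H with Q (Sum.inr (Sum.inr (x, z))) e, D * W e ≤ 1 := by
        by_cases hxz : x = z
        · simp [Q, hxz]
        · simp only [Q, Sum.elim_inr, ne_eq, hxz, not_false_eq_true, true_and]
          rw [← mul_sum]
          refine (mul_le_mul_of_nonneg_left ?_ hD0.le).trans hDC
          convert hpair x z hxz
      generalize ∑ e ∈ H with Q (Sum.inr (Sum.inr (x, z))) e, D * W e = M at h1 ⊢
      simp only [L, c, Sum.elim_inr]
      have h2 : Real.exp 1 - 1 ≤ 2 := (hexpl 1 (by simp)).trans (by norm_num)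
      have h3 : 0 ≤ Real.exp 1 - 1 := by linarith [Real.add_one_le_exp (1 : ℝ)]
      nlinarith [mul_le_mul_of_nonneg_left h1 h3]
  have hUR : (Fintype.card U : ℝ) ≤ 2 * n := by exact_mod_cast hU
  have hcard : (Fintype.card (U ⊕ U ⊕ U × U) : ℝ) ≤ 8 * (n : ℝ) ^ 2 := by
    simp only [Fintype.card_sum, Fintype.card_prod]
    push_cast
    have h0 : (0 : ℝ) ≤ Fintype.card U := Nat.cast_nonneg _
    nlinarith
  have hsum : ∑ j, Real.exp ((Real.exp (L j) - 1) * ∑ e ∈ H with Q j e, D * W e - L j * c j) < 1 := by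
    refine (sum_le_card_nsmul _ _ _ hbound).trans_lt ?_
    rw [nsmul_eq_mul, card_univ]
    exact (mul_le_mul_of_nonneg_right hcard (Real.exp_pos _).le).trans_lt hexp
  obtain ⟨s, hs, hsQ⟩ := exists_subset_of_sum_exp_lt_one H (fun e => D * W e)
    (fun e he => ⟨mul_nonneg hD0.le (hW e he).1,
      (mul_le_mul_of_nonneg_left (hW e he).2 hD0.le).trans hDC⟩) univ Q L c hsum
  refine ⟨s, hs, fun x => abs_lt.2 ⟨?_, ?_⟩, fun x z hxz => ?_⟩
  · have h := hsQ (Sum.inr (Sum.inl x)) (mem_univ _)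
    have hf : s.filter (Q (Sum.inr (Sum.inl x))) = s.filter fun e => x ∈ e := by
      ext e; simp only [mem_filter]; rfl
    rw [hf] at h
    simp only [L, c, Sum.elim_inl, Sum.elim_inr, neg_mul, neg_lt_neg_iff] at h
    linarith [lt_of_mul_lt_mul_left h hl0.le]
  · have h := hsQ (Sum.inl x) (mem_univ _)
    have hf : s.filter (Q (Sum.inl x)) = s.filter fun e => x ∈ e := by
      ext e; simp only [mem_filter]; rfl
    rw [hf] at h
    simp only [L, c, Sum.elim_inl] at h
    linarith [lt_of_mul_lt_mul_left h hl0.le]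
  · have h := hsQ (Sum.inr (Sum.inr (x, z))) (mem_univ _)
    simp only [L, c, Q, Sum.elim_inr, one_mul, ne_eq, hxz, not_false_eq_true, true_and] at h
    convert h

section Encoding
variable {ι V : Type*} [DecidableEq ι] [DecidableEq V]

/-- The edge `{x_i} ∪ e` of a `(1, k)`-partite hypergraph. -/
def partiteEdge (x : ι × Finset V) : Finset (ι ⊕ V) :=
  insert (Sum.inl x.1) (x.2.image Sum.inr)

theorem inl_mem_partiteEdge {x : ι × Finset V} {i : ι} :
    Sum.inl i ∈ partiteEdge x ↔ x.1 = i := by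
  simp [partiteEdge, eq_comm]

theorem inr_mem_partiteEdge {x : ι × Finset V} {v : V} :
    Sum.inr v ∈ partiteEdge x ↔ v ∈ x.2 := by
  simp [partiteEdge]

theorem partiteEdge_injective : Function.Injective (partiteEdge : ι × Finset V → _) := by
  intro x y h
  refine Prod.ext ?_ (ext fun v => ?_)
  · rw [← inl_mem_partiteEdge, h, inl_mem_partiteEdge]
  · rw [← inr_mem_partiteEdge, h, inr_mem_partiteEdge]

theorem exists_partiteEdge_eq {s : Finset (ι ⊕ V)} {k : ℕ}
    (hs : (s.filter fun v => v.isLeft = true).card = 1) (hk : s.card = k + 1) :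
    ∃ x : ι × Finset V, x.2.card = k ∧ partiteEdge x = s := by
  obtain ⟨a, ha⟩ := card_eq_one.1 hs
  have hmem : ∀ b, b ∈ s ∧ b.isLeft = true ↔ b = a := fun b => by
    have h := Finset.ext_iff.1 ha b
    rwa [mem_filter, mem_singleton] at h
  obtain ⟨has, hal⟩ := (hmem a).2 rfl
  obtain ⟨i, rfl⟩ := Sum.isLeft_iff.1 hal
  have heq : partiteEdge (i, s.toRight) = s := by
    ext b
    rcases b with i' | v
    · rw [inl_mem_partiteEdge]
      constructor
      · rintro rfl; exact has
      · intro h; exact (Sum.inl_injective ((hmem _).1 ⟨h, rfl⟩)).symm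
    · rw [inr_mem_partiteEdge, mem_toRight]
  refine ⟨(i, s.toRight), ?_, heq⟩
  have h := congrArg card heq
  rw [partiteEdge, card_insert_of_notMem (by simp), card_image_of_injective _ Sum.inr_injective,
    hk] at h
  simpa using h

theorem image_partiteEdge (π : Equiv.Perm V) (x : ι × Finset V) :
    (partiteEdge x).image (Equiv.sumCongr (Equiv.refl ι) π) = partiteEdge (x.1, x.2.image π) := by
  simp [partiteEdge, image_insert, image_image, Function.comp_def]

end Encoding

theorem card_filter_mem_mem_le {U : Type*} [DecidableEq U] [Fintype U] {x y : U} (hxy : x ≠ y)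
    (j : ℕ) (H : Finset (Finset U)) (hH : ∀ e ∈ H, e.card = j + 2) :
    (H.filter fun e => x ∈ e ∧ y ∈ e).card ≤ Fintype.card U ^ j := by
  calc (H.filter fun e => x ∈ e ∧ y ∈ e).card
      ≤ ((univ : Finset U).powersetCard j).card := by
        refine card_le_card_of_injOn (fun e => (e.erase x).erase y) (fun e he => ?_)
          fun e he e' he' h => ?_
        · obtain ⟨he, hx, hy⟩ := mem_filter.1 he
          rw [mem_coe, mem_powersetCard_univ,
            card_erase_of_mem (mem_erase.2 ⟨hxy.symm, hy⟩), card_erase_of_mem hx, hH e he]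
          rfl
        · obtain ⟨-, hx, hy⟩ := mem_filter.1 he
          obtain ⟨-, hx', hy'⟩ := mem_filter.1 he'
          dsimp only at h
          rw [← insert_erase hx, ← insert_erase hx', ← insert_erase (mem_erase.2 ⟨hxy.symm, hy⟩),
            ← insert_erase (mem_erase.2 ⟨hxy.symm, hy'⟩), h]
    _ = (Fintype.card U).choose j := by rw [card_powersetCard, card_univ]
    _ ≤ Fintype.card U ^ j := Nat.choose_le_pow _ _

theorem sum_filter_fst_eq {ι V M : Type*} [DecidableEq ι] [DecidableEq V] [Fintype V]
    [AddCommMonoid M] (k : ℕ)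
    (P : Finset (ι × Finset V)) (hP : ∀ x ∈ P, x.2.card = k) (i : ι) (f : ι × Finset V → M) :
    ∑ x ∈ P with x.1 = i, f x = ∑ e ∈ univ.powersetCard k with (i, e) ∈ P, f (i, e) := by
  refine sum_nbij' (fun x => x.2) (fun e => (i, e)) ?_ ?_ ?_ ?_ ?_
  · rintro ⟨i', e⟩ hx
    obtain ⟨hxP, rfl⟩ := mem_filter.1 hx
    exact mem_filter.2 ⟨mem_powersetCard_univ.2 (hP _ hxP), hxP⟩
  · intro e he
    exact mem_filter.2 ⟨(mem_filter.1 he).2, rfl⟩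
  · rintro ⟨i', e⟩ hx
    obtain ⟨hxP, rfl⟩ := mem_filter.1 hx
    rfl
  · intro e _; rfl
  · rintro ⟨i', e⟩ hx
    obtain ⟨hxP, rfl⟩ := mem_filter.1 hx
    rfl

/-- If `P` is far from the extremal configuration, it carries an almost perfect fractional
matching whose weights are of the smallest possible order. -/
theorem exists_fractional_matching_constants (j : ℕ) (c ε : ℝ) (hc : 0 < c) (hε : 0 < ε) :
    ∃ δ > 0, ∃ K > 0, ∀ {V ι : Type} [Fintype V] [DecidableEq V] [Fintype ι] [DecidableEq ι]
      (I : Finset ι) (P : Finset (ι × Finset V)), 1 ≤ I.card →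
      (j + 1) * Fintype.card ι = Fintype.card V → 2 * (j + 1) * I.card ≤ Fintype.card V →
      2 * (j + 1) ≤ Fintype.card V →
      c * (Fintype.card V : ℝ) ^ (j + 1) ≤ (Fintype.card V - I.card).choose j * I.card →
      (∀ x ∈ P, x.2.card = j + 1) → (∀ x, x.1 ∉ I → (x ∈ P ↔ x.2.card = j + 1)) →
      (∀ i ∈ I, ((Fintype.card V).choose (j + 1) : ℝ) - (Fintype.card V - I.card).choose (j + 1) -
        δ * (Fintype.card V : ℝ) ^ (j + 1) ≤ (P.filter fun x => x.1 = i).card) →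
      (∀ T : Finset V, T.card = I.card → ε * (Fintype.card V : ℝ) ^ (j + 2) ≤
        ∑ i ∈ I, (((univ.powersetCard (j + 1)).filter
          fun e => (∃ v ∈ e, v ∈ T) ∧ (i, e) ∉ P).card : ℝ)) →
      ∃ W : ι × Finset V → ℝ, (∀ x, 0 ≤ W x ∧ W x ≤ K / (Fintype.card V : ℝ) ^ (j + 1)) ∧
        (∀ i, 1 - 2 * ((j : ℝ) + 1) ^ 2 / Fintype.card V ≤ ∑ x ∈ P with x.1 = i, W x ∧
          ∑ x ∈ P with x.1 = i, W x ≤ 1) ∧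
        (∀ v, 1 - 2 * ((j : ℝ) + 1) ^ 2 / Fintype.card V ≤ ∑ x ∈ P with v ∈ x.2, W x ∧
          ∑ x ∈ P with v ∈ x.2, W x ≤ 1) := by
  obtain ⟨δ, hδ, K, hK, hdual⟩ := exists_dual_constants j c ε hc hε
  refine ⟨δ, hδ, max K ((j + 1).factorial * 2 ^ (j + 1)), lt_max_of_lt_left hK, ?_⟩
  intro V ι _ _ _ _ I P hI1 hcard hI hV hc' hP hPI hdeg hfar
  have hD : 0 ≤ K / (Fintype.card V : ℝ) ^ (j + 1) := by positivity
  have hG := hdual I (fun i => (univ.powersetCard (j + 1)).filter fun e => (i, e) ∈ P) hI1 hI hc'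
    (fun i _ => filter_subset _ _) (fun i hi => by
      refine (hdeg i hi).trans (le_of_eq ?_)
      have := sum_filter_fst_eq (j + 1) P hP i (fun _ => 1)
      simp only [← card_eq_sum_ones] at this
      rw [this]) (fun T hT => by
      refine (hfar T hT).trans (le_of_eq ?_)
      refine sum_congr rfl fun i _ => ?_
      congr 2
      refine filter_congr fun e he => ?_
      simp only [mem_filter, he, true_and])
  obtain ⟨w, hw, hwi, hwv⟩ := exists_capacitated_fractional_matching P
    (fun i => if i ∈ I then 1 else 0) _ hD (fun α b hb => by
      have h1 : ∑ i, (if i ∈ I then 1 else 0) * α i = ∑ i ∈ I, α i := by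
        simp [ite_mul, sum_ite_mem]
      rw [h1]
      refine (hG α b hb).trans ?_
      gcongr
      rw [← sum_fiberwise P (fun x => x.1)]
      calc _ = ∑ i ∈ I, ∑ x ∈ P with x.1 = i, max (α x.1 - ∑ v ∈ x.2, b v) 0 :=
            sum_congr rfl fun i _ => (sum_filter_fst_eq (j + 1) P hP i
              fun x => max (α x.1 - ∑ v ∈ x.2, b v) 0).symm
        _ ≤ _ := sum_le_sum_of_subset_of_nonneg (subset_univ _) fun i _ _ =>
            sum_nonneg fun x _ => le_max_right _ _)
  obtain ⟨W, hW, hWi, hWv⟩ := exists_fractional_completion j I P hP hPI w _ hw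
    (fun i hi => by rw [hwi i, if_pos hi])
    (fun x hx hxI => by
      have h1 := hwi x.1
      rw [if_neg hxI, sum_eq_zero_iff_of_nonneg fun x _ => (hw x).1] at h1
      exact h1 x (mem_filter.2 ⟨hx, rfl⟩)) hwv hcard hI hV
  refine ⟨W, fun x => ⟨(hW x).1, (hW x).2.trans (max_le ?_ ?_)⟩, hWi, hWv⟩
  · gcongr; exact le_max_left _ _
  · gcongr; exact le_max_right _ _

theorem pow_div_factorial_le_choose {a r : ℕ} {x : ℝ} (hx : 0 ≤ x) (h : x + r ≤ a + 1) :
    x ^ r / r.factorial ≤ a.choose r := by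
  have hr : r ≤ a + 1 := by
    have : (r : ℝ) ≤ ((a + 1 : ℕ) : ℝ) := by push_cast; linarith
    exact_mod_cast this
  have h1 := Nat.pow_le_choose (α := ℝ) r a
  refine le_trans ?_ h1
  gcongr
  rw [Nat.cast_sub hr]
  push_cast
  linarith

theorem exists_perm_mem_iff_lt {n t : ℕ} (ht : t ≤ n) (T : Finset (Fin n)) (hT : T.card = t) :
    ∃ π : Equiv.Perm (Fin n), ∀ v, v ∈ T ↔ (π v : ℕ) < t := by
  have hS : (univ.filter fun v : Fin n => (v : ℕ) < t).card = t := by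
    rw [Fin.card_filter_val_lt, min_eq_right ht]
  let e := Finset.equivOfCardEq (hT.trans hS.symm)
  refine ⟨e.extendSubtype, fun v => ⟨fun hv => ?_, fun hv => ?_⟩⟩
  · have h := e.extendSubtype_mem v hv
    simpa using h
  · by_contra hvT
    have h := e.extendSubtype_not_mem v hvT
    exact h (by simpa using hv)

theorem mem_HtE {n k t : ℕ} {s : Finset (Fin (n / k) ⊕ Fin n)} :
    s ∈ HtE n k t ↔ ∃ x : Fin (n / k) × Finset (Fin n), x.2.card = k ∧
      ((x.1 : ℕ) < t → ∃ v ∈ x.2, (v : ℕ) < t) ∧ partiteEdge x = s := by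
  simp only [HtE, mem_biUnion, mem_univ, true_and, mem_image, Prod.exists]
  refine exists_congr fun i => exists_congr fun e => ?_
  rw [← and_assoc]
  refine and_congr ?_ Iff.rfl
  split_ifs with h <;> simp [Hk, h]

theorem mul_choose_le_card_HtE (n k t : ℕ) (ht : t ≤ n / k) :
    (n / k - t) * n.choose k ≤ (HtE n k t).card := by
  have h1 : (univ.filter fun i : Fin (n / k) => ¬ (i : ℕ) < t).card = n / k - t := by
    have h := card_filter_add_card_filter_not (s := (univ : Finset (Fin (n / k))))
      (fun i => (i : ℕ) < t)
    rw [Fin.card_filter_val_lt, min_eq_right ht, card_univ, Fintype.card_fin] at h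
    omega
  calc (n / k - t) * n.choose k
      = ((univ.filter fun i : Fin (n / k) => ¬ (i : ℕ) < t) ×ˢ
          (univ : Finset (Fin n)).powersetCard k).card := by
        rw [card_product, h1, card_powersetCard, card_univ, Fintype.card_fin]
    _ = (((univ.filter fun i : Fin (n / k) => ¬ (i : ℕ) < t) ×ˢ
          (univ : Finset (Fin n)).powersetCard k).image partiteEdge).card :=
        (card_image_of_injective _ partiteEdge_injective).symm
    _ ≤ _ := by
        refine card_le_card fun s hs => ?_
        obtain ⟨x, hx, rfl⟩ := mem_image.1 hs
        obtain ⟨h2, h3⟩ := mem_product.1 hx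
        exact mem_HtE.2 ⟨x, mem_powersetCard_univ.1 h3,
          fun h => absurd h (mem_filter.1 h2).2, rfl⟩

/-- If the hypergraph encoded by `P` is not `ε`-close to `ℋ_t(k,n)`, then for every `t`-set `T`
many `k`-sets meeting `T` are missing from the links of the first `t` vertices. -/
theorem le_sum_card_missing {n k t : ℕ} {ε : ℝ} (ht : t ≤ n)
    (P : Finset (Fin (n / k) × Finset (Fin n)))
    (hP : ∀ x : Fin (n / k) × Finset (Fin n), t ≤ (x.1 : ℕ) → x.2.card = k → x ∈ P)
    (hfar : ¬ isClose (HtE n k t) (P.image partiteEdge) ε) (T : Finset (Fin n)) (hT : T.card = t) :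
    ε * (HtE n k t).card ≤
      ∑ i ∈ univ.filter fun i : Fin (n / k) => (i : ℕ) < t, (((univ.powersetCard k).filter
          fun e => (∃ v ∈ e, v ∈ T) ∧ (i, e) ∉ P).card : ℝ) := by
  obtain ⟨π, hπ⟩ := exists_perm_mem_iff_lt ht T hT
  let σ : Equiv.Perm (Fin (n / k) ⊕ Fin n) := Equiv.sumCongr (Equiv.refl _) π
  have hlt : ε * (HtE n k t).card <
      ((HtE n k t \ (P.image partiteEdge).image fun e => e.image σ).card : ℝ) := by
    by_contra h
    exact hfar ⟨σ, not_lt.1 h⟩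
  refine hlt.le.trans ?_
  rw [← Nat.cast_sum, ← card_sigma]
  norm_cast
  refine le_trans (card_le_card fun s hs => ?_)
    (card_image_le (f := fun y : (_ : Fin (n / k)) × Finset (Fin n) =>
      partiteEdge (y.1, y.2.image π)))
  obtain ⟨hs, hsσ⟩ := mem_sdiff.1 hs
  obtain ⟨⟨i, e⟩, hcard, hlt, rfl⟩ := mem_HtE.1 hs
  have heq : (e.image π.symm).image π = e := by simp [image_image]
  have hnot : (i, e.image π.symm) ∉ P := fun h => hsσ <| mem_image.2
    ⟨_, mem_image_of_mem _ h, by simp only [σ, image_partiteEdge, heq]⟩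
  have hcard' : (e.image π.symm).card = k := by
    rw [card_image_of_injective _ π.symm.injective]; exact hcard
  have hi : (i : ℕ) < t := by
    by_contra hi
    exact hnot (hP _ (not_lt.1 hi) hcard')
  obtain ⟨v, hv, hvt⟩ := hlt hi
  refine mem_image.2 ⟨⟨i, e.image π.symm⟩, mem_sigma.2 ⟨by simpa using hi, mem_filter.2
    ⟨mem_powersetCard_univ.2 hcard', ⟨π.symm v, mem_image_of_mem _ hv, ?_⟩, hnot⟩⟩, ?_⟩
  · rw [hπ]; simpa using hvt
  · simp only [heq]

theorem sum_image_partiteEdge {ι V : Type*} [DecidableEq ι] [DecidableEq V]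
    (P : Finset (ι × Finset V)) (W : ι × Finset V → ℝ) (Q : Finset (ι ⊕ V) → Prop)
    [DecidablePred Q] :
    ∑ s ∈ P.image partiteEdge with Q s, Function.extend partiteEdge W 0 s =
      ∑ x ∈ P with Q (partiteEdge x), W x := by
  rw [filter_image, sum_image partiteEdge_injective.injOn]
  exact sum_congr rfl fun x _ => partiteEdge_injective.extend_apply W 0 x

theorem card_filter_image_partiteEdge {ι V : Type*} [DecidableEq ι] [DecidableEq V]
    (P : Finset (ι × Finset V)) (i : ι) :
    ((P.image partiteEdge).filter fun s => Sum.inl i ∈ s).card =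
      (P.filter fun x => x.1 = i).card := by
  rw [filter_image, card_image_of_injective _ partiteEdge_injective]
  simp only [inl_mem_partiteEdge]

theorem mem_of_card_filter_eq_choose {ι V : Type*} [DecidableEq ι] [DecidableEq V] [Fintype V]
    {k : ℕ} {P : Finset (ι × Finset V)} (hP : ∀ x ∈ P, x.2.card = k) {i : ι}
    (hi : (P.filter fun x => x.1 = i).card = (Fintype.card V).choose k) {e : Finset V}
    (he : e.card = k) : (i, e) ∈ P := by
  have h := sum_filter_fst_eq k P hP i fun _ => 1
  simp only [← card_eq_sum_ones] at h
  have h2 : (univ.powersetCard k).filter (fun e => (i, e) ∈ P) = univ.powersetCard k :=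
    eq_of_subset_of_card_le (filter_subset _ _) (by
      rw [← h, hi, card_powersetCard, card_univ])
  have h3 : e ∈ (univ.powersetCard k).filter fun e => (i, e) ∈ P := by
    rw [h2]; exact mem_powersetCard_univ.2 he
  exact (mem_filter.1 h3).2

/-- A `(1,k)`-partite hypergraph with the given degrees which is not `ε`-close to `ℋ_t(k,n)` has an
almost perfect fractional matching whose weights are all `O(n⁻ᵏ)`. -/
theorem exists_fractional_matching_of_not_isClose (j : ℕ) (ε : ℝ) (hε : 0 < ε) :
    ∃ ρ₀ > 0, ∃ K > 0, ∃ n₀ : ℕ, ∀ ρ : ℝ, ρ < ρ₀ →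
    ∀ n : ℕ, n₀ ≤ n → j + 1 ∣ n → ∀ t : ℕ,
      (n : ℝ) / (3 * ((j + 1 : ℕ) : ℝ) ^ 2) ≤ t → (t : ℝ) ≤ (n : ℝ) / (2 * ((j + 1 : ℕ) : ℝ)) →
      ∀ H : Finset (Finset (Fin (n / (j + 1)) ⊕ Fin n)),
        (∀ e ∈ H, (e.filter fun v => v.isLeft = true).card = 1 ∧ e.card = j + 1 + 1) →
        (∀ i : Fin (n / (j + 1)), (i : ℕ) < t →
          (n.choose (j + 1) : ℝ) - ((n - t + 1).choose (j + 1) : ℝ) - ρ * (n : ℝ) ^ (j + 1) <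
            ((H.filter fun e => Sum.inl i ∈ e).card : ℝ)) →
        (∀ i : Fin (n / (j + 1)), t ≤ (i : ℕ) →
          (H.filter fun e => Sum.inl i ∈ e).card = n.choose (j + 1)) →
        ¬ isClose (HtE n (j + 1) t) H ε →
        ∃ W : Finset (Fin (n / (j + 1)) ⊕ Fin n) → ℝ,
          (∀ s ∈ H, 0 ≤ W s ∧ W s ≤ K / (n : ℝ) ^ (j + 1)) ∧
          ∀ x, 1 - 2 * ((j : ℝ) + 1) ^ 2 / n ≤ ∑ s ∈ H with x ∈ s, W s ∧
            ∑ s ∈ H with x ∈ s, W s ≤ 1 := by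
  set κ : ℝ := ((j + 1 : ℕ) : ℝ) with hκ
  have hκ1 : 1 ≤ κ := by rw [hκ]; exact_mod_cast Nat.succ_pos j
  have hκ0 : 0 < κ := by linarith
  have hκj : κ = (j : ℝ) + 1 := by rw [hκ]; push_cast; ring
  obtain ⟨δ, hδ, K, hK, hmatch⟩ := exists_fractional_matching_constants j
    (1 / (4 ^ j * j.factorial * (3 * κ ^ 2)))
    (ε / (2 * κ * 2 ^ (j + 1) * (j + 1).factorial)) (by positivity) (by positivity)
  refine ⟨δ / 2, by positivity, K, hK, max (4 * (j + 1)) ⌈2 / δ⌉₊, ?_⟩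
  intro ρ hρδ n hn hkn t ht₁ ht₂ H hH hdeg₁ hdeg₂ hfar
  have hn₂ : 4 * (j + 1) ≤ n := (le_max_left _ _).trans hn
  have hn₃ : 2 / δ ≤ n := (Nat.le_ceil _).trans (by exact_mod_cast (le_max_right _ _).trans hn)
  have hn0 : (0 : ℝ) < n := by
    have : 0 < n := by omega
    exact_mod_cast this
  have hn₂R : 4 * κ ≤ n := by rw [hκ]; exact_mod_cast hn₂
  have hm : (j + 1) * (n / (j + 1)) = n := Nat.mul_div_cancel' hkn
  have ht0 : 1 ≤ t := by
    have h : (0 : ℝ) < t := lt_of_lt_of_le (by positivity) ht₁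
    exact_mod_cast h
  have ht₂R : 2 * κ * t ≤ n := by
    rw [le_div_iff₀ (by positivity)] at ht₂; linarith
  have ht : 2 * (j + 1) * t ≤ n := by rw [hκ] at ht₂R; exact_mod_cast ht₂R
  have htm : t ≤ n / (j + 1) := by
    rw [Nat.le_div_iff_mul_le (Nat.succ_pos j)]; nlinarith
  have htn : t ≤ n := htm.trans (Nat.div_le_self _ _)
  have htnR : (t : ℝ) ≤ n / 2 := by
    have h0 : (0 : ℝ) ≤ t := Nat.cast_nonneg t
    nlinarith
  set I : Finset (Fin (n / (j + 1))) := univ.filter fun i => (i : ℕ) < t with hI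
  have hIcard : I.card = t := by rw [hI, Fin.card_filter_val_lt, min_eq_right htm]
  set P : Finset (Fin (n / (j + 1)) × Finset (Fin n)) :=
    univ.filter fun x => partiteEdge x ∈ H with hPdef
  have hPH : P.image partiteEdge = H := by
    ext s
    constructor
    · intro hs
      obtain ⟨x, hx, rfl⟩ := mem_image.1 hs
      exact (mem_filter.1 hx).2
    · intro hs
      obtain ⟨x, -, rfl⟩ := exists_partiteEdge_eq (hH s hs).1 (hH s hs).2
      exact mem_image_of_mem _ (mem_filter.2 ⟨mem_univ _, hs⟩)
  have hP : ∀ x ∈ P, x.2.card = j + 1 := by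
    intro x hx
    have hs := (mem_filter.1 hx).2
    obtain ⟨y, hy, hyx⟩ := exists_partiteEdge_eq (hH _ hs).1 (hH _ hs).2
    rwa [← partiteEdge_injective hyx]
  have hfull : ∀ x : Fin (n / (j + 1)) × Finset (Fin n), t ≤ (x.1 : ℕ) → x.2.card = j + 1 →
      x ∈ P := by
    intro x hx hcard
    refine mem_of_card_filter_eq_choose hP ?_ hcard
    rw [← card_filter_image_partiteEdge, hPH, hdeg₂ _ hx, Fintype.card_fin]
  have hchoose : ((n : ℝ) / 2) ^ (j + 1) / (j + 1).factorial ≤ n.choose (j + 1) :=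
    pow_div_factorial_le_choose (by positivity) (by linarith)
  have hHtE : (n : ℝ) / (2 * κ) * (((n : ℝ) / 2) ^ (j + 1) / (j + 1).factorial) ≤
      (HtE n (j + 1) t).card := by
    have h1 : (((n / (j + 1) - t : ℕ) : ℝ)) * n.choose (j + 1) ≤ (HtE n (j + 1) t).card := by
      exact_mod_cast mul_choose_le_card_HtE n (j + 1) t htm
    refine le_trans (mul_le_mul ?_ hchoose (by positivity) (by positivity)) h1
    rw [Nat.cast_sub htm, Nat.cast_div hkn (by positivity), ← hκ]
    have h2 : (n : ℝ) / κ = n / (2 * κ) + n / (2 * κ) := by field_simp; norm_num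
    linarith
  obtain ⟨W, hW, hWi, hWv⟩ := hmatch I P (by rw [hIcard]; exact ht0)
    (by simpa using hm) (by simpa [hIcard] using ht) (by rw [Fintype.card_fin]; omega)
    (by
      rw [Fintype.card_fin, hIcard]
      have h1 : ((n : ℝ) / 4) ^ j / j.factorial ≤ (n - t).choose j :=
        pow_div_factorial_le_choose (by positivity) (by
          rw [Nat.cast_sub htn]; linarith)
      refine le_trans (le_of_eq ?_) (mul_le_mul h1 ht₁ (by positivity) (by positivity))
      rw [div_pow, pow_succ (n : ℝ) j, div_div, div_mul_div_comm, one_div, inv_mul_eq_div])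
    hP
    (fun x hx => ⟨hP x, hfull x (by simpa [hI] using hx)⟩)
    (fun i hi => by
      rw [← card_filter_image_partiteEdge, hPH, Fintype.card_fin, hIcard]
      have h1 := hdeg₁ i (by simpa [hI] using hi)
      rw [Nat.choose_succ_succ] at h1
      push_cast at h1
      have h2 : ((n - t).choose j : ℝ) ≤ (n : ℝ) ^ j := by
        have : (n - t).choose j ≤ n ^ j :=
          (Nat.choose_le_pow _ _).trans (Nat.pow_le_pow_left (Nat.sub_le _ _) _)
        exact_mod_cast this
      have h3 : (n : ℝ) ^ j ≤ δ / 2 * (n : ℝ) ^ (j + 1) := by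
        rw [div_le_iff₀ hδ] at hn₃
        rw [pow_succ]
        have h4 : (0 : ℝ) < (n : ℝ) ^ j := by positivity
        nlinarith
      have h5 : ρ * (n : ℝ) ^ (j + 1) ≤ δ / 2 * (n : ℝ) ^ (j + 1) := by gcongr
      linarith)
    (fun T hT => by
      rw [hIcard] at hT
      have h1 := (mul_le_mul_of_nonneg_left hHtE hε.le).trans
        (le_sum_card_missing htn P hfull (by rwa [hPH]) T hT)
      refine le_trans (le_of_eq ?_) (h1.trans (le_of_eq (sum_congr rfl fun i _ => ?_)))
      · rw [Fintype.card_fin, div_pow, pow_succ (n : ℝ) (j + 1)]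
        field_simp
      · congr!)
  simp only [Fintype.card_fin] at hW hWi hWv
  refine ⟨Function.extend partiteEdge W 0, fun s hs => ?_, fun x => ?_⟩
  · rw [← hPH] at hs
    obtain ⟨x, -, rfl⟩ := mem_image.1 hs
    rw [partiteEdge_injective.extend_apply]
    exact hW x
  · rw [← hPH, sum_image_partiteEdge]
    rcases x with i | v
    · simp only [inl_mem_partiteEdge]
      exact hWi i
    · simp only [inr_mem_partiteEdge]
      exact hWv v

/-- Lemma 6.4 of the paper (existence of the sparse spanning subgraph): if `H` is not
`ε`-close to `ℋ_t(k,n)` (with the stated degree conditions) then `H` has a spanning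
subgraph `H'` with `d_{H'}(x) = (1 ± n^{-0.01})n^{0.2}` for all but at most `n^{0.99}`
vertices, `d_{H'}(x) < 2n^{0.2}` everywhere, and pair degrees `< n^{0.19}`. -/
theorem stmt_9 (k : ℕ) (hk : 3 ≤ k) :
    ∃ ε₀ : ℝ, 0 < ε₀ ∧ ∀ ε : ℝ, 0 < ε → ε < ε₀ →
    ∃ ρ₀ : ℝ, 0 < ρ₀ ∧ ∃ n₀ : ℕ, ∀ ρ : ℝ, 0 < ρ → ρ < ρ₀ →
    ∀ n : ℕ, n₀ ≤ n → k ∣ n → ∀ t : ℕ,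
      (n : ℝ) / (3 * k ^ 2) ≤ t → (t : ℝ) ≤ (n : ℝ) / (2 * k) →
      ∀ H : Finset (Finset (Fin (n / k) ⊕ Fin n)),
        (∀ e ∈ H, (e.filter fun v => v.isLeft = true).card = 1 ∧ e.card = k + 1) →
        (∀ i : Fin (n / k), (i : ℕ) < t →
          (Nat.choose n k : ℝ) - (Nat.choose (n - t + 1) k : ℝ) - ρ * (n : ℝ) ^ k <
            ((H.filter fun e => Sum.inl i ∈ e).card : ℝ)) →
        (∀ i : Fin (n / k), t ≤ (i : ℕ) →
          (H.filter fun e => Sum.inl i ∈ e).card = Nat.choose n k) →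
        ¬ isClose (HtE n k t) H ε →
        ∃ H' ⊆ H,
          (((Finset.univ.filter fun x : Fin (n / k) ⊕ Fin n =>
              ¬ |((H'.filter fun e => x ∈ e).card : ℝ) - (n : ℝ) ^ (0.2 : ℝ)|
                  ≤ (n : ℝ) ^ (0.19 : ℝ)).card : ℝ) ≤ (n : ℝ) ^ (0.99 : ℝ)) ∧
          (∀ x : Fin (n / k) ⊕ Fin n,
            ((H'.filter fun e => x ∈ e).card : ℝ) < 2 * (n : ℝ) ^ (0.2 : ℝ)) ∧
          (∀ x y : Fin (n / k) ⊕ Fin n, x ≠ y →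
            ((H'.filter fun e => x ∈ e ∧ y ∈ e).card : ℝ) < (n : ℝ) ^ (0.19 : ℝ)) := by
  obtain ⟨j, rfl⟩ : ∃ j, k = j + 1 := ⟨k - 1, by omega⟩
  refine ⟨1, one_pos, fun ε hε _ => ?_⟩
  obtain ⟨ρ₀, hρ₀, K, hK, n₀, hmatch⟩ := exists_fractional_matching_of_not_isClose j ε hε
  obtain ⟨n₁, hsample⟩ := exists_almost_regular_subgraph (2 ^ j * K + 2 * ((j : ℝ) + 1) ^ 2)
  refine ⟨ρ₀, hρ₀, max (max n₀ n₁) 1, ?_⟩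
  intro ρ _ hρ n hn hkn t ht₁ ht₂ H hH hdeg₁ hdeg₂ hfar
  have hn₀ : n₀ ≤ n := ((le_max_left _ _).trans (le_max_left _ _)).trans hn
  have hn₁ : n₁ ≤ n := ((le_max_right _ _).trans (le_max_left _ _)).trans hn
  have hn1 : (1 : ℝ) ≤ n := by exact_mod_cast (le_max_right _ _).trans hn
  have hn0 : (0 : ℝ) < n := by linarith
  obtain ⟨W, hW, hWx⟩ := hmatch ρ hρ n hn₀ hkn t ht₁ ht₂ H hH hdeg₁ hdeg₂ hfar
  have hpow : K / (n : ℝ) ^ (j + 1) * (2 * n) ^ j = 2 ^ j * K / n := by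
    rw [mul_pow, pow_succ]; field_simp
  have hU : Fintype.card (Fin (n / (j + 1)) ⊕ Fin n) ≤ 2 * n := by
    simp only [Fintype.card_sum, Fintype.card_fin]
    have := Nat.div_le_self n (j + 1)
    omega
  have hUR : (Fintype.card (Fin (n / (j + 1)) ⊕ Fin n) : ℝ) ≤ 2 * n := by exact_mod_cast hU
  have hC₁ : 2 ^ j * K / n ≤ (2 ^ j * K + 2 * ((j : ℝ) + 1) ^ 2) / n := by
    gcongr
    have : 0 ≤ 2 * ((j : ℝ) + 1) ^ 2 := by positivity
    linarith
  have hC₂ : 2 * ((j : ℝ) + 1) ^ 2 / n ≤ (2 ^ j * K + 2 * ((j : ℝ) + 1) ^ 2) / n := by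
    gcongr
    have : 0 ≤ 2 ^ j * K := by positivity
    linarith
  obtain ⟨H', hH', hdeg, hpair⟩ := hsample n hn₁ hU H W
    (fun s hs => by
      refine ⟨(hW s hs).1, (hW s hs).2.trans (le_trans ?_ hC₁)⟩
      rw [← hpow]
      exact le_mul_of_one_le_right (by positivity) (one_le_pow₀ (by linarith)))
    (fun x => ⟨le_trans (by linarith) (hWx x).1, (hWx x).2⟩)
    (fun x y hxy => by
      refine le_trans ?_ hC₁
      rw [← hpow]
      refine (sum_le_card_nsmul _ _ _ fun s hs => (hW s (mem_filter.1 hs).1).2).trans ?_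
      rw [nsmul_eq_mul, mul_comm]
      refine mul_le_mul_of_nonneg_left ?_ (by positivity)
      have h1 : ((H.filter fun e => x ∈ e ∧ y ∈ e).card : ℝ) ≤
          (Fintype.card (Fin (n / (j + 1)) ⊕ Fin n) : ℝ) ^ j := by
        exact_mod_cast card_filter_mem_mem_le hxy j H fun e he => (hH e he).2
      exact h1.trans (pow_le_pow_left₀ (by positivity) hUR j))
  refine ⟨H', hH', ?_, fun x => ?_, hpair⟩
  · rw [filter_false_of_mem fun x _ => not_not.2 (hdeg x).le]
    simpa using Real.rpow_nonneg hn0.le _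
  · have h1 := (abs_lt.1 (hdeg x)).2
    have h2 : (n : ℝ) ^ (0.19 : ℝ) ≤ (n : ℝ) ^ (0.2 : ℝ) :=
      Real.rpow_le_rpow_of_exponent_le hn1 (by norm_num)
    linarith
end

section
/- Let k ≥ 3 be an integer, let m be an integer and 0 < ρ < 1 a real. For all sufficiently large n the following holds. Let H be a (1,k)-partite (k+1)-graph with partition classes A, B where k|A| = |B| = n; let A_1, A_2 be a partition of A with |A_1| ≥ n/(3k²) and |A_2| ≥ n/(3k²); let A_3 ⊆ A and A_4 ⊆ B with |A_3| = |A_4| = ⌈n^{0.99}⌉; and suppose n/k³ ≤ m ≤ n/k and d_H(v) ≥ C(n,k) − C(n−m,k) − ρ·n^k for all v ∈ A. Then, with N = ⌈n^{1.1}⌉, there exist balanced subsets R_1, …, R_N of V(H), each of cardinality divisible by k+1, such that, writing Y_S = |{ i ∈ [N] : S ⊆ R_i }| for S ⊆ V(H): (i) |Y_{{v}} − n^{0.2}| ≤ n^{0.19} for every vertex v; (ii) Y_{{u,v}} ≤ 2 for every pair of distinct vertices u, v; (iii) Y_e ≤ 1 for every edge e ∈ E(H); (iv) | |R_i ∩ A|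 − n^{0.1}/k | ≤ n^{0.07} and | |R_i ∩ B| − n^{0.1} | ≤ n^{0.07} for every i; (v) for every i and every v ∈ R_i ∩ A, the degree of v in the induced subhypergraph H[R_i] is greater than C(|R_i ∩ B|, k) − C(|R_i ∩ B| − ⌊m·n^{−0.9}⌋, k) − 3ρ·|R_i ∩ B|^k; (vi) | |R_i ∩ A_j| − |A_j|·n^{−0.9} | ≤ n^{0.07} for every i and every j ∈ {1,2,3,4}. -/
/-- One-variable Hoeffding bound for uniform averages. -/
theorem sum_exp_le_of_abs_sub_le {α : Type*} [Fintype α] [Nonempty α] (g : α → ℝ) (c t : ℝ)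
    (hc : 0 < c) (hg : ∀ a b, |g a - g b| ≤ c) :
    ∑ a, Real.exp (t * g a) ≤
      Fintype.card α * Real.exp (t * ((∑ a, g a) / Fintype.card α) + t ^ 2 * c ^ 2 / 2) := by
  have hcard : (0 : ℝ) < Fintype.card α := by exact_mod_cast Fintype.card_pos
  set μ : ℝ := (∑ a, g a) / Fintype.card α with hμ
  have hsum : ∑ a, (g a - μ) = 0 := by
    rw [Finset.sum_sub_distrib, Finset.sum_const, Finset.card_univ, nsmul_eq_mul, hμ]
    field_simp
    ring
  have hdev : ∀ a, |g a - μ| ≤ c := by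
    intro a
    have h1 : (Fintype.card α : ℝ) * (g a - μ) = ∑ b, (g a - g b) := by
      rw [Finset.sum_sub_distrib, Finset.sum_const, Finset.card_univ, nsmul_eq_mul, hμ]
      field_simp
    have h2 : |(Fintype.card α : ℝ) * (g a - μ)| ≤ Fintype.card α * c := by
      rw [h1]
      refine (Finset.abs_sum_le_sum_abs _ _).trans ?_
      refine (Finset.sum_le_sum fun b _ => hg a b).trans ?_
      simp
    rw [abs_mul, abs_of_pos hcard] at h2
    exact le_of_mul_le_mul_left h2 hcard
  have hpt : ∀ a, Real.exp (t * (g a - μ)) ≤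
      Real.cosh (t * c) + (g a - μ) * (Real.sinh (t * c) / c) := by
    intro a
    obtain ⟨h1, h2⟩ := abs_le.mp (hdev a)
    have hconv := And.right convexOn_exp (Set.mem_univ (t * c)) (Set.mem_univ (-(t * c)))
      (show 0 ≤ (c + (g a - μ)) / (2 * c) from div_nonneg (by linarith) (by linarith))
      (show 0 ≤ (c - (g a - μ)) / (2 * c) from div_nonneg (by linarith) (by linarith))
      (by field_simp; ring)
    have e1 : ((c + (g a - μ)) / (2 * c)) • (t * c) + ((c - (g a - μ)) / (2 * c)) • (-(t * c))
        = t * (g a - μ) := by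
      simp only [smul_eq_mul]; field_simp; ring
    rw [e1] at hconv
    refine hconv.trans (le_of_eq ?_)
    rw [Real.cosh_eq, Real.sinh_eq]
    simp only [smul_eq_mul]
    field_simp
    ring
  calc ∑ a, Real.exp (t * g a)
      = Real.exp (t * μ) * ∑ a, Real.exp (t * (g a - μ)) := by
        rw [Finset.mul_sum]
        refine Finset.sum_congr rfl fun a _ => ?_
        rw [← Real.exp_add]; ring_nf
    _ ≤ Real.exp (t * μ) * ∑ a, (Real.cosh (t * c) + (g a - μ) * (Real.sinh (t * c) / c)) := by
        gcongr with a; exact hpt a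
    _ = Real.exp (t * μ) * (Fintype.card α * Real.cosh (t * c)) := by
        rw [Finset.sum_add_distrib, ← Finset.sum_mul, hsum]; simp
    _ ≤ Real.exp (t * μ) * (Fintype.card α * Real.exp ((t * c) ^ 2 / 2)) := by
        gcongr; exact Real.cosh_le_exp_half_sq _
    _ = _ := by rw [Real.exp_add]; ring_nf

theorem sum_exp_le_of_bounded_differences_fin (c t : ℝ) (hc : 0 < c) :
    ∀ (r : ℕ) (α : Fin r → Type) [∀ i, Fintype (α i)] [∀ i, Nonempty (α i)]
      (f : (∀ i, α i) → ℝ),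
      (∀ i x y, (∀ j, j ≠ i → x j = y j) → |f x - f y| ≤ c) →
      ∑ x, Real.exp (t * f x) ≤ Fintype.card (∀ i, α i) *
        Real.exp (t * ((∑ x, f x) / Fintype.card (∀ i, α i)) + r * (t ^ 2 * c ^ 2 / 2)) := by
  intro r
  induction r with
  | zero =>
    intro α _ _ f _
    simp [Fintype.card_unique]
  | succ r ih =>
    intro α _ _ f hf
    set C : ℝ := (Fintype.card (∀ i : Fin r, α i.succ) : ℝ) with hC
    have hCpos : 0 < C := by rw [hC]; exact_mod_cast Fintype.card_pos
    have hA : (0 : ℝ) < Fintype.card (α 0) := by exact_mod_cast Fintype.card_pos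
    have hsplit : ∀ F : (∀ i, α i) → ℝ,
        ∑ x, F x = ∑ a : α 0, ∑ x : ∀ i : Fin r, α i.succ, F (Fin.cons a x) := by
      intro F
      rw [← Fintype.sum_prod_type' (f := fun a x => F (Fin.cons a x))]
      exact (Fintype.sum_equiv (Fin.consEquiv α) _ _ fun x => rfl).symm
    have hcard : (Fintype.card (∀ i, α i) : ℝ) = Fintype.card (α 0) * C := by
      rw [hC, ← Nat.cast_mul, ← Fintype.card_prod]
      exact_mod_cast (Fintype.card_congr (Fin.consEquiv α)).symm
    set μ : α 0 → ℝ := fun a => (∑ x : ∀ i : Fin r, α i.succ, f (Fin.cons a x)) / C with hμ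
    have hμd : ∀ a b, |μ a - μ b| ≤ c := by
      intro a b
      rw [hμ]
      simp only
      rw [← sub_div, ← Finset.sum_sub_distrib, abs_div, abs_of_pos hCpos, div_le_iff₀ hCpos]
      refine (Finset.abs_sum_le_sum_abs _ _).trans ?_
      refine (Finset.sum_le_sum fun x _ => hf 0 (Fin.cons a x) (Fin.cons b x) ?_).trans ?_
      · intro j hj
        obtain ⟨j, rfl⟩ := Fin.exists_succ_eq.mpr hj
        simp
      · rw [Finset.sum_const, Finset.card_univ, nsmul_eq_mul, hC, mul_comm]
    have hone := sum_exp_le_of_abs_sub_le μ c t hc hμd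
    have hmean : (∑ x, f x) / (Fintype.card (∀ i, α i) : ℝ) =
        (∑ a, μ a) / Fintype.card (α 0) := by
      rw [hsplit, hcard, hμ]
      simp only
      rw [← Finset.sum_div]
      field_simp
    rw [hsplit, hmean, hcard]
    calc ∑ a : α 0, ∑ x : ∀ i : Fin r, α i.succ, Real.exp (t * f (Fin.cons a x))
        ≤ ∑ a : α 0, C * Real.exp (t * μ a + r * (t ^ 2 * c ^ 2 / 2)) := by
          refine Finset.sum_le_sum fun a _ => ?_
          refine ih (fun i => α i.succ) (fun x => f (Fin.cons a x)) ?_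
          intro i x y hxy
          refine hf i.succ _ _ ?_
          intro j hj
          refine Fin.cases ?_ (fun j hj => ?_) j hj
          · intro _; simp
          · simpa using hxy j (fun h => hj (by rw [h]))
      _ = C * Real.exp (r * (t ^ 2 * c ^ 2 / 2)) * ∑ a : α 0, Real.exp (t * μ a) := by
          rw [Finset.mul_sum]
          refine Finset.sum_congr rfl fun a _ => ?_
          rw [Real.exp_add]; ring
      _ ≤ C * Real.exp (r * (t ^ 2 * c ^ 2 / 2)) * (Fintype.card (α 0) *
          Real.exp (t * ((∑ a, μ a) / Fintype.card (α 0)) + t ^ 2 * c ^ 2 / 2)) := by gcongr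
      _ = _ := by
          rw [Nat.cast_succ, add_mul, one_mul, Real.exp_add, Real.exp_add, Real.exp_add]; ring

/-- Bounded differences inequality (McDiarmid) for the uniform distribution on a finite product. -/
theorem card_upper_tail_le_of_bounded_differences {β : Type} [Fintype β] (α : β → Type)
    [DecidableEq β] [∀ b, Fintype (α b)] [∀ b, Nonempty (α b)] [Nonempty β]
    (f : (∀ b, α b) → ℝ) (c lam : ℝ)
    (hc : 0 < c) (hlam : 0 ≤ lam)
    (hf : ∀ b x y, (∀ j, j ≠ b → x j = y j) → |f x - f y| ≤ c) :
    ((Finset.univ.filter fun x =>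
        (∑ x, f x) / Fintype.card (∀ b, α b) + lam < f x).card : ℝ) ≤
      Fintype.card (∀ b, α b) * Real.exp (-(lam ^ 2 / (2 * Fintype.card β * c ^ 2))) := by
  set r := Fintype.card β with hr
  have hrpos : (0 : ℝ) < r := by rw [hr]; exact_mod_cast Fintype.card_pos
  set μ : ℝ := (∑ x, f x) / Fintype.card (∀ b, α b) with hμ
  set t : ℝ := lam / (r * c ^ 2) with ht
  have ht0 : 0 ≤ t := by positivity
  have hmgf : ∑ x, Real.exp (t * f x) ≤ Fintype.card (∀ b, α b) *
        Real.exp (t * μ + r * (t ^ 2 * c ^ 2 / 2)) := by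
    let e : Fin r ≃ β := (Fintype.equivFin β).symm
    let E := Equiv.piCongrLeft α e
    have h := sum_exp_le_of_bounded_differences_fin c t hc r (fun i => α (e i))
      (fun x => f (E x)) (by
        intro i x y hxy
        refine hf (e i) _ _ ?_
        intro j hj
        obtain ⟨j, rfl⟩ := e.surjective j
        rw [Equiv.piCongrLeft_apply_apply, Equiv.piCongrLeft_apply_apply]
        exact hxy j fun h => hj (by rw [h]))
    have h1 : ∑ x, Real.exp (t * f (E x)) = ∑ x, Real.exp (t * f x) :=
      Equiv.sum_comp E fun x => Real.exp (t * f x)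
    have h2 : ∑ x, f (E x) = ∑ x, f x := Equiv.sum_comp E f
    rw [h1, h2, Fintype.card_congr E] at h
    exact h
  have hmarkov : ((Finset.univ.filter fun x => μ + lam < f x).card : ℝ) *
      Real.exp (t * (μ + lam)) ≤ ∑ x, Real.exp (t * f x) := by
    rw [← nsmul_eq_mul, ← Finset.sum_const]
    refine (Finset.sum_le_sum fun x hx => ?_).trans
      (Finset.sum_le_sum_of_subset_of_nonneg (Finset.filter_subset _ _) fun x _ _ =>
        (Real.exp_pos (t * f x)).le)
    exact Real.exp_le_exp.mpr (mul_le_mul_of_nonneg_left (Finset.mem_filter.mp hx).2.le ht0)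
  have h := hmarkov.trans hmgf
  rw [← le_div_iff₀ (Real.exp_pos _), mul_div_assoc, ← Real.exp_sub] at h
  refine h.trans (le_of_eq ?_)
  congr 2
  rw [ht]
  field_simp
  ring

section BlockSample

variable {V β : Type} [Fintype V] {m : β → ℕ}

/-- The transversal of the blocks of `φ` that picks position `z b` in block `b`. -/
def blockSample (φ : V ≃ Σ b, ZMod (m b)) (z : ∀ b, ZMod (m b)) : Finset V :=
  Finset.univ.filter fun v => (φ v).2 = z (φ v).1

theorem mem_blockSample {φ : V ≃ Σ b, ZMod (m b)} {z : ∀ b, ZMod (m b)} {v : V} :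
    v ∈ blockSample φ z ↔ (φ v).2 = z (φ v).1 := by
  simp [blockSample]

theorem apply_eq_of_mem_blockSample {φ : V ≃ Σ b, ZMod (m b)} {z : ∀ b, ZMod (m b)} {v : V}
    (hv : v ∈ blockSample φ z) {b : β} (hb : (φ v).1 = b) : φ v = ⟨b, z b⟩ := by
  subst hb
  exact Sigma.ext rfl (heq_of_eq (mem_blockSample.mp hv))

theorem eq_of_mem_blockSample {φ : V ≃ Σ b, ZMod (m b)} {z : ∀ b, ZMod (m b)} {u v : V}
    (hu : u ∈ blockSample φ z) (hv : v ∈ blockSample φ z) (huv : (φ u).1 = (φ v).1) : u = v :=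
  φ.injective ((apply_eq_of_mem_blockSample hu huv).trans
    (apply_eq_of_mem_blockSample hv rfl).symm)

theorem symm_mem_blockSample (φ : V ≃ Σ b, ZMod (m b)) (z : ∀ b, ZMod (m b)) (b : β) :
    φ.symm ⟨b, z b⟩ ∈ blockSample φ z := by
  have h : ∀ p : Σ b, ZMod (m b), p = ⟨b, z b⟩ → p.2 = z p.1 := by
    rintro _ rfl
    rfl
  exact mem_blockSample.mpr (h _ (Equiv.apply_symm_apply _ _))

theorem card_filter_blockSample [Fintype β] (φ : V ≃ Σ b, ZMod (m b)) (z : ∀ b, ZMod (m b))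
    (p : β → Prop) [DecidablePred p] :
    ((blockSample φ z).filter fun v => p (φ v).1).card = (Finset.univ.filter p).card := by
  refine Finset.card_nbij' (fun v => (φ v).1) (fun b => φ.symm ⟨b, z b⟩) ?_ ?_ ?_ ?_
  · intro v hv
    simpa using (Finset.mem_filter.mp hv).2
  · intro b hb
    simpa [symm_mem_blockSample] using hb
  · intro v hv
    rw [Equiv.symm_apply_eq]
    exact (apply_eq_of_mem_blockSample (Finset.mem_filter.mp hv).1 rfl).symm
  · intro b _
    simp

theorem card_blockSample [Fintype β] (φ : V ≃ Σ b, ZMod (m b)) (z : ∀ b, ZMod (m b)) :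
    (blockSample φ z).card = Fintype.card β := by
  simpa using card_filter_blockSample φ z fun _ => True

variable [DecidableEq V] [Fintype β]

/-- A fixed set `T` lies in a uniformly random transversal with probability at most `M ^ (-|T|)`. -/
theorem card_subset_blockSample_mul_le [DecidableEq β] [∀ b, NeZero (m b)]
    (φ : V ≃ Σ b, ZMod (m b)) {M : ℕ} (hM : ∀ b, M ≤ m b)
    (c : ∀ b, ZMod (m b)) (T : Finset V) :
    (Finset.univ.filter fun y => T ⊆ blockSample φ (c + y)).card * M ^ T.card ≤
      Fintype.card (∀ b, ZMod (m b)) := by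
  by_cases hinj : Set.InjOn (fun v => (φ v).1) (T : Set V)
  · set K : Finset β := T.image fun v => (φ v).1 with hK
    have hKcard : K.card = T.card := Finset.card_image_of_injOn hinj
    let S : ∀ b, Finset (ZMod (m b)) := fun b =>
      Finset.univ.filter fun w => ∀ v ∈ T, (φ v).1 = b → φ v = ⟨b, c b + w⟩
    have hsub : (Finset.univ.filter fun y => T ⊆ blockSample φ (c + y)) ⊆
        Fintype.piFinset S := by
      intro y hy
      rw [Fintype.mem_piFinset]
      intro b
      refine Finset.mem_filter.mpr ⟨Finset.mem_univ _, fun v hv hb => ?_⟩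
      exact apply_eq_of_mem_blockSample ((Finset.mem_filter.mp hy).2 hv) hb
    have hS : ∀ b, (S b).card * (if b ∈ K then M else 1) ≤ m b := by
      intro b
      have htriv : (S b).card ≤ m b := (Finset.card_le_univ _).trans (ZMod.card (m b)).le
      split_ifs with hb
      · have h1 : (S b).card ≤ 1 := by
          obtain ⟨v, hv, hvb⟩ := Finset.mem_image.mp hb
          refine Finset.card_le_one.mpr fun w hw w' hw' => ?_
          have h1 := (Finset.mem_filter.mp hw).2 v hv hvb
          have h2 := (Finset.mem_filter.mp hw').2 v hv hvb
          have h3 := h1.symm.trans h2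
          simpa using h3
        calc (S b).card * M ≤ 1 * m b := Nat.mul_le_mul h1 (hM b)
          _ = m b := one_mul _
      · simpa using htriv
    calc (Finset.univ.filter fun y => T ⊆ blockSample φ (c + y)).card * M ^ T.card
        ≤ (Fintype.piFinset S).card * M ^ K.card := by
          rw [hKcard]; exact Nat.mul_le_mul_right _ (Finset.card_le_card hsub)
      _ = ∏ b, ((S b).card * (if b ∈ K then M else 1)) := by
          rw [Finset.prod_mul_distrib, Fintype.card_piFinset]
          simp
      _ ≤ ∏ b, m b := Finset.prod_le_prod' fun b _ => hS b
      _ = Fintype.card (∀ b, ZMod (m b)) := by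
          rw [Fintype.card_pi]; simp [ZMod.card]
  · have hempty : (Finset.univ.filter fun y => T ⊆ blockSample φ (c + y)) = ∅ := by
      refine Finset.filter_eq_empty_iff.mpr fun y _ hy => hinj ?_
      intro u hu v hv huv
      exact eq_of_mem_blockSample (hy hu) (hy hv) huv
    rw [hempty]
    simp

theorem card_powersetCard_filter_mem_le {W : Type*} [DecidableEq W] (S : Finset W) (v : W) (κ : ℕ) :
    ((S.powersetCard κ).filter fun T => v ∈ T).card ≤ S.card ^ (κ - 1) := by
  calc ((S.powersetCard κ).filter fun T => v ∈ T).card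
      ≤ (S.powersetCard (κ - 1)).card := by
        refine Finset.card_le_card_of_injOn (fun T => T.erase v) ?_ ?_
        · intro T hT
          obtain ⟨h1, h2⟩ := Finset.mem_filter.mp hT
          obtain ⟨h3, h4⟩ := Finset.mem_powersetCard.mp h1
          exact Finset.mem_powersetCard.mpr
            ⟨(Finset.erase_subset _ _).trans h3, by rw [Finset.card_erase_of_mem h2, h4]⟩
        · intro T hT T' hT' h
          have h1 := (Finset.mem_filter.mp hT).2
          have h2 := (Finset.mem_filter.mp hT').2
          rw [← Finset.insert_erase h1, ← Finset.insert_erase h2]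
          exact congrArg (insert v) h
    _ = S.card.choose (κ - 1) := Finset.card_powersetCard _ _
    _ ≤ S.card ^ (κ - 1) := Nat.choose_le_pow _ _

/-- Moving one position changes the number of sampled members of a `κ`-uniform family little. -/
theorem card_filter_subset_blockSample_le (φ : V ≃ Σ b, ZMod (m b)) (c : ∀ b, ZMod (m b))
    (F : Finset (Finset V)) {κ : ℕ} (hF : ∀ T ∈ F, T.card = κ) (b : β)
    (x y : ∀ b, ZMod (m b)) (hxy : ∀ j, j ≠ b → x j = y j) :
    (F.filter fun T => T ⊆ blockSample φ (c + x)).card ≤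
      (F.filter fun T => T ⊆ blockSample φ (c + y)).card + Fintype.card β ^ (κ - 1) := by
  set v : V := φ.symm ⟨b, (c + x) b⟩ with hv
  have hsub : (F.filter fun T => T ⊆ blockSample φ (c + x)) ⊆
      (F.filter fun T => T ⊆ blockSample φ (c + y)) ∪
        (((blockSample φ (c + x)).powersetCard κ).filter fun T => v ∈ T) := by
    intro T hT
    obtain ⟨hTF, hTx⟩ := Finset.mem_filter.mp hT
    by_cases hTy : T ⊆ blockSample φ (c + y)
    · exact Finset.mem_union_left _ (Finset.mem_filter.mpr ⟨hTF, hTy⟩)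
    · refine Finset.mem_union_right _ (Finset.mem_filter.mpr
        ⟨Finset.mem_powersetCard.mpr ⟨hTx, hF T hTF⟩, ?_⟩)
      obtain ⟨u, huT, huy⟩ := Finset.not_subset.mp hTy
      have hux := mem_blockSample.mp (hTx huT)
      have hub : (φ u).1 = b := by
        by_contra hne
        refine huy (mem_blockSample.mpr ?_)
        rw [hux, Pi.add_apply, Pi.add_apply, hxy _ hne]
      have : u = v := by
        rw [hv, Equiv.eq_symm_apply]
        exact apply_eq_of_mem_blockSample (hTx huT) hub
      exact this ▸ huT
  refine (Finset.card_le_card hsub).trans ((Finset.card_union_le _ _).trans ?_)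
  gcongr
  rw [← card_blockSample φ (c + x)]
  exact card_powersetCard_filter_mem_le _ _ _

/-- One choice of random shifts works for finitely many translates and uniform families. -/
theorem exists_forall_card_filter_subset_blockSample_le [DecidableEq β] [Nonempty β]
    [∀ b, NeZero (m b)]
    (φ : V ≃ Σ b, ZMod (m b)) {M : ℕ} (hM0 : 0 < M) (hM : ∀ b, M ≤ m b)
    {I J : Type*} [Fintype I] [Fintype J] (c : I → ∀ b, ZMod (m b))
    (F : J → Finset (Finset V)) (κ : J → ℕ) (hF : ∀ j, ∀ T ∈ F j, T.card = κ j)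
    (lam : J → ℝ) (hlam : ∀ j, 0 ≤ lam j)
    (hsum : (Fintype.card I : ℝ) * ∑ j, Real.exp (-((lam j) ^ 2 /
      (2 * Fintype.card β * ((Fintype.card β : ℝ) ^ (κ j - 1)) ^ 2))) < 1) :
    ∃ y : ∀ b, ZMod (m b), ∀ i j,
      (((F j).filter fun T => T ⊆ blockSample φ (c i + y)).card : ℝ) ≤
        (F j).card / (M : ℝ) ^ κ j + lam j := by
  classical
  set Ω : ℝ := (Fintype.card (∀ b, ZMod (m b)) : ℝ) with hΩ
  have hΩpos : 0 < Ω := by rw [hΩ]; exact_mod_cast Fintype.card_pos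
  let f : I → J → (∀ b, ZMod (m b)) → ℝ := fun i j y =>
    (((F j).filter fun T => T ⊆ blockSample φ (c i + y)).card : ℝ)
  have hmean : ∀ i j, (∑ y, f i j y) / Ω ≤ (F j).card / (M : ℝ) ^ κ j := by
    intro i j
    have hM' : (0 : ℝ) < (M : ℝ) ^ κ j := by positivity
    rw [div_le_div_iff₀ hΩpos hM']
    have hswap : ∑ y, f i j y = ∑ T ∈ F j,
        ((Finset.univ.filter fun y => T ⊆ blockSample φ (c i + y)).card : ℝ) := by
      simp only [f, Finset.card_filter, Nat.cast_sum]
      exact Finset.sum_comm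
    rw [hswap, Finset.sum_mul, ← nsmul_eq_mul, ← Finset.sum_const]
    refine Finset.sum_le_sum fun T hT => ?_
    rw [← hF j T hT, hΩ]
    exact_mod_cast card_subset_blockSample_mul_le φ hM (c i) T
  have htail : ∀ i j, ((Finset.univ.filter fun y =>
      (F j).card / (M : ℝ) ^ κ j + lam j < f i j y).card : ℝ) ≤
      Ω * Real.exp (-((lam j) ^ 2 /
        (2 * Fintype.card β * ((Fintype.card β : ℝ) ^ (κ j - 1)) ^ 2))) := by
    intro i j
    refine le_trans ?_ (card_upper_tail_le_of_bounded_differences (fun b => ZMod (m b)) (f i j)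
      ((Fintype.card β : ℝ) ^ (κ j - 1)) (lam j) ?_ (hlam j) ?_)
    · refine Nat.cast_le.mpr (Finset.card_le_card fun y hy => ?_)
      refine Finset.mem_filter.mpr ⟨Finset.mem_univ _, lt_of_le_of_lt ?_ (Finset.mem_filter.mp hy).2⟩
      have := hmean i j
      linarith
    · have : (0 : ℝ) < Fintype.card β := by exact_mod_cast Fintype.card_pos
      positivity
    · intro b x y hxy
      have h1 := card_filter_subset_blockSample_le φ (c i) (F j) (hF j) b x y hxy
      have h2 := card_filter_subset_blockSample_le φ (c i) (F j) (hF j) b y x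
        fun j hj => (hxy j hj).symm
      have h1' : f i j x ≤ f i j y + (Fintype.card β : ℝ) ^ (κ j - 1) := by
        simp only [f]
        exact_mod_cast h1
      have h2' : f i j y ≤ f i j x + (Fintype.card β : ℝ) ^ (κ j - 1) := by
        simp only [f]
        exact_mod_cast h2
      rw [abs_le]
      constructor <;> linarith
  by_contra hcon
  push Not at hcon
  have hcover : (Finset.univ : Finset (∀ b, ZMod (m b))) ⊆
      Finset.univ.biUnion fun p : I × J => Finset.univ.filter fun y =>
        (F p.2).card / (M : ℝ) ^ κ p.2 + lam p.2 < f p.1 p.2 y := by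
    intro y _
    obtain ⟨i, j, hij⟩ := hcon y
    exact Finset.mem_biUnion.mpr ⟨(i, j), Finset.mem_univ _,
      Finset.mem_filter.mpr ⟨Finset.mem_univ _, hij⟩⟩
  have h1 := (Finset.card_le_card hcover).trans Finset.card_biUnion_le
  have h2 : Ω ≤ ∑ p : I × J, ((Finset.univ.filter fun y =>
        (F p.2).card / (M : ℝ) ^ κ p.2 + lam p.2 < f p.1 p.2 y).card : ℝ) := by
    rw [hΩ, ← Finset.card_univ]; exact_mod_cast h1
  have h3 := h2.trans (Finset.sum_le_sum fun p _ => htail p.1 p.2)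
  rw [Fintype.sum_prod_type] at h3
  simp only at h3
  rw [Finset.sum_const, Finset.card_univ, nsmul_eq_mul,
    ← Finset.mul_sum] at h3
  have h4 := mul_lt_mul_of_pos_left hsum hΩpos
  linarith

end BlockSample

section GroupShift

variable {V β : Type} [Fintype V] {m : β → ℕ}

/-- The offset of the `i`-th sample in block `b`: samples come in groups of `M`, and within each
group the samples run through the positions of every block. -/
def groupShift (m : β → ℕ) (M : ℕ) (idx : β → ℕ) (i : ℕ) (b : β) : ZMod (m b) :=
  ((i % M + 2 * (i / M) * idx b : ℕ) : ZMod (m b))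

theorem abs_le_one_of_abs_mul_lt {M n a : ℤ} (hM : 0 < M) (hn : M ≤ n) (h : |n * a| < 2 * M) :
    -1 ≤ a ∧ a ≤ 1 := by
  obtain ⟨h1, h2⟩ := abs_lt.mp h
  constructor
  · by_contra hc
    nlinarith
  · by_contra hc
    nlinarith

theorem eq_of_nearly_equal_moduli_dvd {M W δ x x' m₁ m₂ : ℤ} (hM : 2 * W + 1 < M)
    (hδ : |δ| < M) (hx : |2 * x| ≤ W) (hx' : |2 * x'| ≤ W)
    (h₁ : m₁ = M ∨ m₁ = M + 1) (h₂ : m₂ = M ∨ m₂ = M + 1)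
    (hd₁ : m₁ ∣ δ + 2 * x) (hd₂ : m₂ ∣ δ + 2 * x') : x = x' := by
  obtain ⟨a, ha⟩ := hd₁
  obtain ⟨a', ha'⟩ := hd₂
  rw [abs_lt] at hδ
  rw [abs_le] at hx hx'
  obtain ⟨l, u⟩ := abs_le_one_of_abs_mul_lt (M := M) (n := m₁) (a := a) (by omega) (by omega)
    (by rw [← ha, abs_lt]; omega)
  obtain ⟨l', u'⟩ := abs_le_one_of_abs_mul_lt (M := M) (n := m₂) (a := a') (by omega) (by omega)
    (by rw [← ha', abs_lt]; omega)
  obtain rfl | rfl | rfl : a = -1 ∨ a = 0 ∨ a = 1 := by omega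
  all_goals
    obtain rfl | rfl | rfl : a' = -1 ∨ a' = 0 ∨ a' = 1 := by omega
    all_goals omega

theorem natCast_eq_iff_int_dvd {n a b : ℕ} :
    ((a : ℕ) : ZMod n) = (b : ZMod n) ↔ (n : ℤ) ∣ (a : ℤ) - b := by
  rw [eq_comm, ZMod.natCast_eq_natCast_iff, Nat.modEq_iff_dvd]

/-- Two distinct vertices lie together in at most one sample. -/
theorem eq_of_pair_mem_blockSample (φ : V ≃ Σ b, ZMod (m b)) {M W N : ℕ} {idx : β → ℕ}
    (hm : ∀ b, m b = M ∨ m b = M + 1) (hidx : Function.Injective idx)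
    (hW : ∀ i < N, ∀ b, 2 * (i / M) * idx b ≤ W) (hWM : 2 * W + 1 < M)
    (y : ∀ b, ZMod (m b)) {u v : V} (huv : u ≠ v) {i i' : ℕ} (hi : i < N) (hi' : i' < N)
    (hui : u ∈ blockSample φ (groupShift m M idx i + y))
    (hvi : v ∈ blockSample φ (groupShift m M idx i + y))
    (hui' : u ∈ blockSample φ (groupShift m M idx i' + y))
    (hvi' : v ∈ blockSample φ (groupShift m M idx i' + y)) : i = i' := by
  have hM0 : 0 < M := by omega
  have hblk : (φ u).1 ≠ (φ v).1 := fun h => huv (eq_of_mem_blockSample hui hvi h)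
  have key : ∀ w, w ∈ blockSample φ (groupShift m M idx i + y) →
      w ∈ blockSample φ (groupShift m M idx i' + y) →
      ((m (φ w).1 : ℕ) : ℤ) ∣ ((i % M : ℕ) - (i' % M : ℕ) : ℤ) +
        2 * ((((i / M : ℕ) : ℤ) - (i' / M : ℕ)) * (idx (φ w).1 : ℕ)) := by
    intro w h h'
    have e := (mem_blockSample.mp h).symm.trans (mem_blockSample.mp h')
    have e' := add_right_cancel e
    have := natCast_eq_iff_int_dvd.mp e'
    convert this using 1
    push_cast
    ring
  have hδ : |((i % M : ℕ) - (i' % M : ℕ) : ℤ)| < M := by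
    have h1 := Nat.mod_lt i hM0
    have h2 := Nat.mod_lt i' hM0
    rw [abs_lt]
    omega
  have hbd : ∀ b, |2 * ((((i / M : ℕ) : ℤ) - (i' / M : ℕ)) * (idx b : ℕ))| ≤ (W : ℤ) := by
    intro b
    have h1 := hW i hi b
    have h2 := hW i' hi' b
    have h3 : 2 * ((((i / M : ℕ) : ℤ) - (i' / M : ℕ)) * (idx b : ℕ)) =
      ((2 * (i / M) * idx b : ℕ) : ℤ) - ((2 * (i' / M) * idx b : ℕ) : ℤ) := by
      push_cast; ring
    rw [h3, abs_le]
    omega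
  have hmz : ∀ b, ((m b : ℕ) : ℤ) = M ∨ ((m b : ℕ) : ℤ) = M + 1 := by
    intro b
    have := hm b
    omega
  have hx := eq_of_nearly_equal_moduli_dvd (M := M) (W := W) (by exact_mod_cast hWM) hδ
    (hbd (φ u).1) (hbd (φ v).1) (hmz _) (hmz _) (key u hui hui') (key v hvi hvi')
  have hg : ((i / M : ℕ) : ℤ) = (i' / M : ℕ) := by
    by_contra hne
    have h1 := mul_left_cancel₀ (sub_ne_zero.mpr hne) hx
    exact hblk (hidx (by exact_mod_cast h1))
  have hd := key u hui hui'
  rw [hg, sub_self, zero_mul, mul_zero, add_zero] at hd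
  have h0 := Int.eq_zero_of_abs_lt_dvd hd
    (hδ.trans_le (by rcases hmz (φ u).1 with h | h <;> omega))
  have hg' : i / M = i' / M := by exact_mod_cast hg
  have hr : i % M = i' % M := by omega
  rw [← Nat.div_add_mod i M, ← Nat.div_add_mod i' M, hg', hr]

theorem card_samples_containing_le [DecidableEq V]
    (φ : V ≃ Σ b, ZMod (m b)) {M N : ℕ} {idx : β → ℕ} (hM0 : 0 < M)
    (hm : ∀ b, m b = M ∨ m b = M + 1) (y : ∀ b, ZMod (m b)) (v : V) :
    ((Finset.range N).filter fun i =>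
      v ∈ blockSample φ (groupShift m M idx i + y)).card ≤ N / M + 1 := by
  rw [← Finset.card_range (N / M + 1)]
  refine Finset.card_le_card_of_injOn (fun i => i / M) ?_ ?_
  · intro i hi
    have h1 := Finset.mem_range.mp (Finset.mem_filter.mp hi).1
    have h2 : i / M ≤ N / M := Nat.div_le_div_right h1.le
    simp only [Finset.coe_range, Set.mem_Iio]
    omega
  · intro i hi i' hi' hg
    have hg : i / M = i' / M := hg
    have e := (mem_blockSample.mp (Finset.mem_filter.mp hi).2).symm.trans
      (mem_blockSample.mp (Finset.mem_filter.mp hi').2)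
    have e₀ : groupShift m M idx i (φ v).1 = groupShift m M idx i' (φ v).1 := add_right_cancel e
    have e' := natCast_eq_iff_int_dvd.mp e₀
    rw [hg] at e'
    have h1 := Nat.mod_lt i hM0
    have h2 := Nat.mod_lt i' hM0
    have h0 := Int.eq_zero_of_abs_lt_dvd e' (by
      rw [abs_lt]; rcases hm (φ v).1 with h | h <;> push_cast <;> omega)
    have hr : i % M = i' % M := by push_cast at h0; omega
    rw [← Nat.div_add_mod i M, ← Nat.div_add_mod i' M, hg, hr]

theorem le_card_samples_containing [DecidableEq V] [∀ b, NeZero (m b)]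
    (φ : V ≃ Σ b, ZMod (m b)) {M W N : ℕ} {idx : β → ℕ}
    (hm : ∀ b, m b = M ∨ m b = M + 1) (hidx : ∀ b, 0 < idx b)
    (hW : ∀ i < N, ∀ b, 2 * (i / M) * idx b ≤ W) (hWM : 2 * W + 1 < M)
    (y : ∀ b, ZMod (m b)) (v : V) :
    N / M ≤ ((Finset.range N).filter fun i =>
      v ∈ blockSample φ (groupShift m M idx i + y)).card + 1 := by
  classical
  have hM0 : 0 < M := by omega
  set b := (φ v).1 with hb
  let j : ℕ → ℕ := fun g => ((φ v).2 - y b - ((2 * g * idx b : ℕ) : ZMod (m b))).val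
  have hj : ∀ g, ((j g : ℕ) : ZMod (m b)) = (φ v).2 - y b - ((2 * g * idx b : ℕ) : ZMod (m b)) :=
    fun g => ZMod.natCast_zmod_val _
  have hjlt : ∀ g, j g < m b := fun g => ZMod.val_lt _
  have hlt : ∀ g < N / M, ∀ r < M, g * M + r < N := by
    intro g hg r hr
    calc g * M + r < (g + 1) * M := by rw [add_mul, one_mul]; omega
      _ ≤ N / M * M := Nat.mul_le_mul_right _ hg
      _ ≤ N := Nat.div_mul_le_self N M
  have hgood : ((Finset.range (N / M)).filter fun g => j g < M).card ≤
      ((Finset.range N).filter fun i =>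
        v ∈ blockSample φ (groupShift m M idx i + y)).card := by
    refine Finset.card_le_card_of_injOn (fun g => g * M + j g) ?_ ?_
    · intro g hg
      obtain ⟨h1, h2⟩ := Finset.mem_filter.mp hg
      refine Finset.mem_coe.mpr (Finset.mem_filter.mpr
        ⟨Finset.mem_range.mpr (hlt g (Finset.mem_range.mp h1) _ h2), mem_blockSample.mpr ?_⟩)
      have e1 : (g * M + j g) % M = j g := by
        rw [Nat.mul_add_mod_self_right, Nat.mod_eq_of_lt h2]
      have e2 : (g * M + j g) / M = g := by
        rw [mul_comm, Nat.mul_add_div hM0, Nat.div_eq_of_lt h2, add_zero]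
      rw [Pi.add_apply, groupShift, e1, e2, Nat.cast_add, hj]
      abel
    · intro g hg g' hg' h
      have h1 := (Finset.mem_filter.mp hg).2
      have h2 := (Finset.mem_filter.mp hg').2
      have h3 := congrArg (· / M) h
      simp only at h3
      rwa [mul_comm, Nat.mul_add_div hM0, Nat.div_eq_of_lt h1, add_zero, mul_comm g' M,
        Nat.mul_add_div hM0, Nat.div_eq_of_lt h2, add_zero] at h3
  have hbad : ((Finset.range (N / M)).filter fun g => ¬ j g < M).card ≤ 1 := by
    refine Finset.card_le_one.mpr fun g hg g' hg' => ?_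
    obtain ⟨h1, h2⟩ := Finset.mem_filter.mp hg
    obtain ⟨h1', h2'⟩ := Finset.mem_filter.mp hg'
    have e : j g = j g' := by
      have := hjlt g
      have := hjlt g'
      rcases hm b with h | h <;> omega
    have e1 := (hj g).symm.trans ((congrArg _ e).trans (hj g'))
    have e2 := natCast_eq_iff_int_dvd.mp (sub_right_injective e1)
    have w : ∀ g ∈ Finset.range (N / M), 2 * g * idx b ≤ W := by
      intro g hg
      have := hW (g * M + 0) (hlt g (Finset.mem_range.mp hg) 0 hM0) b
      rwa [add_zero, Nat.mul_div_cancel _ hM0] at this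
    have w1 := w g h1
    have w2 := w g' h1'
    have h0 := Int.eq_zero_of_abs_lt_dvd e2 (by
      rw [abs_lt]; rcases hm b with h | h <;> rw [h] <;> omega)
    have h3 : 2 * g * idx b = 2 * g' * idx b := by omega
    have h4 := Nat.eq_of_mul_eq_mul_right (hidx b) h3
    omega
  have hsplit := Finset.card_filter_add_card_filter_not (s := Finset.range (N / M))
    (fun g => j g < M)
  rw [Finset.card_range] at hsplit
  omega

end GroupShift

theorem exists_equiv_sigma_zmod {q s M t : ℕ} (hM : 0 < M) (ht : t ≤ s) (hq : s * M + t = q) :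
    ∃ m : Fin s → ℕ, (∀ b, m b = M ∨ m b = M + 1) ∧
      Nonempty (Fin q ≃ Σ b, ZMod (m b)) := by
  refine ⟨fun b => M + if (b : ℕ) < t then 1 else 0, fun b => ?_, ?_⟩
  · dsimp only
    split_ifs <;> simp
  · have : ∀ b : Fin s, NeZero (M + if (b : ℕ) < t then 1 else 0) := fun b => ⟨by omega⟩
    refine ⟨Fintype.equivOfCardEq ?_⟩
    rw [Fintype.card_fin, Fintype.card_sigma]
    simp only [ZMod.card, Finset.sum_add_distrib, Finset.sum_const, Finset.card_univ,
      Fintype.card_fin, smul_eq_mul]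
    rw [Finset.sum_boole, Fin.card_filter_val_lt, min_eq_right ht, Nat.cast_id, hq]

/-- Both sides of the vertex set split into blocks of sizes `q / s` and `q / s + 1`. -/
theorem exists_block_decomposition {k q n s : ℕ} (hn : k * q = n) (hs : 0 < s) (hM : 0 < q / s) :
    ∃ m : Fin s ⊕ Fin (k * s) → ℕ, (∀ b, m b = q / s ∨ m b = q / s + 1) ∧
      ∃ φ : Fin q ⊕ Fin n ≃ Σ b, ZMod (m b), ∀ v, (φ v).1.isLeft = v.isLeft := by
  have ht : q % s ≤ s := (Nat.mod_lt q hs).le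
  have hq := Nat.div_add_mod q s
  obtain ⟨m₁, hm₁, ⟨e₁⟩⟩ := exists_equiv_sigma_zmod hM ht hq
  obtain ⟨m₂, hm₂, ⟨e₂⟩⟩ := exists_equiv_sigma_zmod (q := n) hM (Nat.mul_le_mul_left k ht)
    (by rw [mul_assoc, ← mul_add, hq, hn])
  refine ⟨Sum.elim m₁ m₂, ?_,
    (Equiv.sumCongr e₁ e₂).trans (Equiv.sumSigmaDistrib fun b => ZMod (Sum.elim m₁ m₂ b)).symm, ?_⟩
  · rintro (b | b)
    · exact hm₁ b
    · exact hm₂ b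
  · rintro (v | v) <;> rfl

/-- Balanced samples with equidistributed vertices, at most one common sample for each pair, and
upper concentration for the number of sampled members of given uniform families. -/
theorem exists_balanced_samples {k q n s N : ℕ} (hn : k * q = n) (hs : 0 < s)
    (hgap : 2 * (2 * (N / (q / s)) * ((k + 1) * s)) + 1 < q / s)
    {J : Type*} [Fintype J] (F : J → Finset (Finset (Fin q ⊕ Fin n))) (κ : J → ℕ)
    (hF : ∀ j, ∀ T ∈ F j, T.card = κ j) (lam : J → ℝ) (hlam : ∀ j, 0 ≤ lam j)
    (hsum : (N : ℝ) * ∑ j, Real.exp (-((lam j) ^ 2 /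
      (2 * ((k + 1) * s : ℕ) * ((((k + 1) * s : ℕ) : ℝ) ^ (κ j - 1)) ^ 2))) < 1) :
    ∃ R : ℕ → Finset (Fin q ⊕ Fin n),
      (∀ i, ((R i).filter fun v => v.isLeft = true).card = s) ∧
      (∀ i, ((R i).filter fun v => v.isRight = true).card = k * s) ∧
      (∀ v, ((Finset.range N).filter fun i => v ∈ R i).card ≤ N / (q / s) + 1) ∧
      (∀ v, N / (q / s) ≤ ((Finset.range N).filter fun i => v ∈ R i).card + 1) ∧
      (∀ u v, u ≠ v → ∀ i < N, ∀ i' < N, u ∈ R i → v ∈ R i → u ∈ R i' → v ∈ R i' → i = i') ∧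
      (∀ i < N, ∀ j, (((F j).filter fun T => T ⊆ R i).card : ℝ) ≤
        (F j).card / ((q / s : ℕ) : ℝ) ^ κ j + lam j) := by
  have hM0 : 0 < q / s := by omega
  obtain ⟨m, hm, φ, hφ⟩ := exists_block_decomposition hn hs hM0
  set M := q / s with hM
  have : ∀ b, NeZero (m b) := fun b => ⟨by rcases hm b with h | h <;> omega⟩
  have : Nonempty (Fin s ⊕ Fin (k * s)) := ⟨Sum.inl ⟨0, hs⟩⟩
  have hcard : Fintype.card (Fin s ⊕ Fin (k * s)) = (k + 1) * s := by
    simp only [Fintype.card_sum, Fintype.card_fin]; ring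
  let idx : Fin s ⊕ Fin (k * s) → ℕ :=
    Sum.elim (fun b => (b : ℕ) + 1) (fun b => s + (b : ℕ) + 1)
  have hidx_pos : ∀ b, 0 < idx b := by rintro (b | b) <;> simp [idx]
  have hidx_le : ∀ b, idx b ≤ (k + 1) * s := by
    rw [add_mul, one_mul]
    rintro (b | b) <;> simp only [idx, Sum.elim_inl, Sum.elim_inr] <;> omega
  have hidx_inj : Function.Injective idx := by
    rintro (b | b) (b' | b') h <;> simp only [idx, Sum.elim_inl, Sum.elim_inr] at h
    · exact congrArg _ (Fin.ext (by omega))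
    · omega
    · omega
    · exact congrArg _ (Fin.ext (by omega))
  have hW : ∀ i < N, ∀ b, 2 * (i / M) * idx b ≤ 2 * (N / M) * ((k + 1) * s) := by
    intro i hi b
    have h1 : i / M ≤ N / M := Nat.div_le_div_right hi.le
    exact Nat.mul_le_mul (Nat.mul_le_mul_left 2 h1) (hidx_le b)
  obtain ⟨y, hy⟩ := exists_forall_card_filter_subset_blockSample_le φ hM0
    (fun b => by rcases hm b with h | h <;> omega)
    (fun i : Fin N => groupShift m M idx i) F κ hF lam hlam (by
      rw [hcard, Fintype.card_fin]; exact hsum)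
  refine ⟨fun i => blockSample φ (groupShift m M idx i + y), ?_, ?_, ?_, ?_, ?_, ?_⟩
  · intro i
    have := card_filter_blockSample φ (groupShift m M idx i + y) fun b => b.isLeft = true
    simp only [hφ] at this
    rw [this, Finset.card_filter, Fintype.sum_sum_type]
    simp
  · intro i
    have := card_filter_blockSample φ (groupShift m M idx i + y) fun b => b.isRight = true
    simp only [← Sum.not_isLeft, hφ] at this ⊢
    rw [this, Finset.card_filter, Fintype.sum_sum_type]
    simp
  · exact fun v => card_samples_containing_le φ hM0 hm y v
  · exact fun v => le_card_samples_containing φ hm hidx_pos hW hgap y v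
  · intro u v huv i hi i' hi' h1 h2 h3 h4
    exact eq_of_pair_mem_blockSample φ hm hidx_inj hW hgap y huv hi hi' h1 h2 h3 h4
  · exact fun i hi j => hy ⟨i, hi⟩ j

section Link

variable {q n : ℕ}

/-- The `k`-sets on the right side that do not form an edge together with the left vertex `v`. -/
def missingLink (H : Finset (Finset (Fin q ⊕ Fin n))) (k : ℕ) (v : Fin q) :
    Finset (Finset (Fin q ⊕ Fin n)) :=
  (((Finset.univ : Finset (Fin n)).map Function.Embedding.inr).powersetCard k).filter
    fun T => insert (Sum.inl v) T ∉ H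

theorem card_of_mem_missingLink {H : Finset (Finset (Fin q ⊕ Fin n))} {k : ℕ} {v : Fin q}
    {T : Finset (Fin q ⊕ Fin n)} (hT : T ∈ missingLink H k v) : T.card = k :=
  (Finset.mem_powersetCard.mp (Finset.mem_filter.mp hT).1).2

theorem card_missingLink_add_degree_le {H : Finset (Finset (Fin q ⊕ Fin n))} {k : ℕ}
    (hH : ∀ e ∈ H, (e.filter fun v => v.isLeft = true).card = 1 ∧ e.card = k + 1) (v : Fin q) :
    (missingLink H k v).card + (H.filter fun e => Sum.inl v ∈ e).card ≤ n.choose k := by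
  set P := ((Finset.univ : Finset (Fin n)).map
    (Function.Embedding.inr : Fin n ↪ Fin q ⊕ Fin n)).powersetCard k with hP
  have hPcard : P.card = n.choose k := by
    rw [hP, Finset.card_powersetCard, Finset.card_map, Finset.card_univ, Fintype.card_fin]
  have hsplit := Finset.card_filter_add_card_filter_not (s := P)
    (fun T => insert (Sum.inl v) T ∈ H)
  have hle : (H.filter fun e => Sum.inl v ∈ e).card ≤
      (P.filter fun T => insert (Sum.inl v) T ∈ H).card := by
    refine Finset.card_le_card_of_injOn (fun e => e.erase (Sum.inl v)) ?_ ?_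
    · intro e he
      obtain ⟨heH, hve⟩ := Finset.mem_filter.mp he
      obtain ⟨h1, h2⟩ := hH e heH
      refine Finset.mem_coe.mpr (Finset.mem_filter.mpr
        ⟨Finset.mem_powersetCard.mpr ⟨?_, ?_⟩, ?_⟩)
      · intro w hw
        obtain ⟨hne, hwe⟩ := Finset.mem_erase.mp hw
        rcases w with a | b
        · exact absurd (Finset.card_le_one.mp h1.le _ (Finset.mem_filter.mpr ⟨hwe, rfl⟩) _
            (Finset.mem_filter.mpr ⟨hve, rfl⟩)) hne
        · simp
      · rw [Finset.card_erase_of_mem hve, h2, Nat.add_sub_cancel]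
      · rwa [Finset.insert_erase hve]
    · intro e he e' he' h
      rw [← Finset.insert_erase (Finset.mem_filter.mp he).2,
        ← Finset.insert_erase (Finset.mem_filter.mp he').2]
      exact congrArg (insert (Sum.inl v)) h
  have hm : (missingLink H k v).card = (P.filter fun T => ¬ insert (Sum.inl v) T ∈ H).card := rfl
  omega

theorem choose_card_right_le {H : Finset (Finset (Fin q ⊕ Fin n))} {k : ℕ} {v : Fin q}
    {R : Finset (Fin q ⊕ Fin n)} (hv : Sum.inl v ∈ R) :
    (R.filter fun w => w.isRight = true).card.choose k ≤
      (H.filter fun e => Sum.inl v ∈ e ∧ e ⊆ R).card +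
        ((missingLink H k v).filter fun T => T ⊆ R).card := by
  set X := R.filter fun w => w.isRight = true with hX
  have hsplit := Finset.card_filter_add_card_filter_not (s := X.powersetCard k)
    (fun T => insert (Sum.inl v) T ∈ H)
  rw [Finset.card_powersetCard] at hsplit
  have hnot : ∀ T ⊆ X, Sum.inl v ∉ T := fun T hT hvT => by
    have := (Finset.mem_filter.mp (hT hvT)).2
    simp at this
  have h1 : ((X.powersetCard k).filter fun T => insert (Sum.inl v) T ∈ H).card ≤
      (H.filter fun e => Sum.inl v ∈ e ∧ e ⊆ R).card := by
    refine Finset.card_le_card_of_injOn (fun T => insert (Sum.inl v) T) ?_ ?_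
    · intro T hT
      obtain ⟨hTX, hTH⟩ := Finset.mem_filter.mp hT
      refine Finset.mem_coe.mpr (Finset.mem_filter.mpr
        ⟨hTH, Finset.mem_insert_self _ _, Finset.insert_subset hv ?_⟩)
      exact (Finset.mem_powersetCard.mp hTX).1.trans (Finset.filter_subset _ _)
    · intro T hT T' hT' h
      have hT := hnot T (Finset.mem_powersetCard.mp (Finset.mem_filter.mp hT).1).1
      have hT' := hnot T' (Finset.mem_powersetCard.mp (Finset.mem_filter.mp hT').1).1
      rw [← Finset.erase_insert hT, ← Finset.erase_insert hT']
      exact congrArg (fun T => T.erase (Sum.inl v)) h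
  have h2 : ((X.powersetCard k).filter fun T => ¬ insert (Sum.inl v) T ∈ H).card ≤
      ((missingLink H k v).filter fun T => T ⊆ R).card := by
    refine Finset.card_le_card fun T hT => ?_
    obtain ⟨hTX, hTH⟩ := Finset.mem_filter.mp hT
    obtain ⟨hsub, hcard⟩ := Finset.mem_powersetCard.mp hTX
    refine Finset.mem_filter.mpr ⟨Finset.mem_filter.mpr
      ⟨Finset.mem_powersetCard.mpr ⟨fun w hw => ?_, hcard⟩, hTH⟩,
      hsub.trans (Finset.filter_subset _ _)⟩
    have := (Finset.mem_filter.mp (hsub hw)).2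
    rcases w with a | b
    · simp at this
    · simp
  omega

theorem card_powersetCard_one_filter_subset {W : Type*} [DecidableEq W] (S R : Finset W) :
    ((S.powersetCard 1).filter fun T => T ⊆ R).card = (R.filter fun w => w ∈ S).card := by
  have : ((S.powersetCard 1).filter fun T => T ⊆ R) =
      (R.filter fun w => w ∈ S).powersetCard 1 := by
    ext T
    simp only [Finset.mem_filter, Finset.mem_powersetCard, Finset.subset_iff]
    grind
  rw [this, Finset.card_powersetCard, Nat.choose_one_right]

theorem card_filter_left_add_compl (R : Finset (Fin q ⊕ Fin n)) (S : Finset (Fin q)) :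
    (R.filter fun v => v ∈ S.map Function.Embedding.inl).card +
      (R.filter fun v => v ∈ Sᶜ.map Function.Embedding.inl).card =
      (R.filter fun v => v.isLeft = true).card := by
  rw [← Finset.card_union_of_disjoint]
  · congr 1
    ext v
    rcases v with a | b <;> simp [← and_or_left, em]
  · rw [Finset.disjoint_left]
    rintro (a | b) <;> simp +contextual

theorem card_filter_right_add_compl (R : Finset (Fin q ⊕ Fin n)) (S : Finset (Fin n)) :
    (R.filter fun v => v ∈ S.map Function.Embedding.inr).card +
      (R.filter fun v => v ∈ Sᶜ.map Function.Embedding.inr).card =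
      (R.filter fun v => v.isRight = true).card := by
  rw [← Finset.card_union_of_disjoint]
  · congr 1
    ext v
    rcases v with a | b <;> simp [← and_or_left, em]
  · rw [Finset.disjoint_left]
    rintro (a | b) <;> simp +contextual

end Link

section Estimates

/-- Upper bounds for a set and its complement give two-sided control. -/
theorem abs_sub_mul_le_of_upper {a a' S S' Q M P σ τ lam : ℝ} (hM : 0 < M)
    (ha : a ≤ S / M + lam) (ha' : a' ≤ S' / M + lam) (hσ : a + a' = σ) (hQ : S + S' = Q)
    (hS : 0 ≤ S) (hS' : 0 ≤ S') (hQ0 : 0 < Q)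
    (h1 : σ ≤ Q / M) (h2 : Q / M ≤ σ + τ) (h3 : σ ≤ Q * P) (h4 : Q * P ≤ σ + τ) :
    |a - S * P| ≤ lam + 2 * τ := by
  have hfrac : 0 ≤ S / Q ∧ S / Q ≤ 1 :=
    ⟨div_nonneg hS hQ0.le, (div_le_one hQ0).mpr (by linarith)⟩
  have e1 : S / M - S * P = S / Q * (Q / M - Q * P) := by field_simp
  have hdiff : |S / M - S * P| ≤ τ := by
    rw [e1, abs_mul, abs_of_nonneg hfrac.1]
    have : |Q / M - Q * P| ≤ τ := by rw [abs_le]; constructor <;> linarith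
    calc S / Q * |Q / M - Q * P| ≤ 1 * |Q / M - Q * P| := by gcongr; exact hfrac.2
      _ ≤ τ := by linarith
  obtain ⟨l, u⟩ := abs_le.mp hdiff
  have e2 : S / M + S' / M = Q / M := by rw [← add_div, hQ]
  rw [abs_le]
  constructor <;> linarith

theorem pow_le_pow_add_mul_sub {y z : ℝ} (hz : 0 ≤ z) (hzy : z ≤ y) (k : ℕ) :
    y ^ k ≤ z ^ k + k * (y - z) * y ^ (k - 1) := by
  induction k with
  | zero => simp
  | succ k ih =>
    rcases k with _ | k
    · simp
    · simp only [Nat.add_sub_cancel] at ih ⊢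
      have hy : 0 ≤ y := hz.trans hzy
      have h1 := mul_le_mul_of_nonneg_left ih hy
      have h2 : z ^ (k + 1) ≤ y ^ (k + 1) := by gcongr
      have h3 := mul_le_mul_of_nonneg_right h2 (sub_nonneg.mpr hzy)
      push_cast at h1 ⊢
      have e : y ^ (k + 1 + 1) = y * y ^ (k + 1) := by ring
      have e' : y * (z ^ (k + 1) + (k + 1) * (y - z) * y ^ k) =
        z ^ (k + 1 + 1) + z ^ (k + 1) * (y - z) + (k + 1) * (y - z) * y ^ (k + 1) := by ring
      rw [e]
      linarith

theorem pow_le_pow_add_small {k : ℕ} (hk : 1 ≤ k) {ε y z r : ℝ} (hε : 0 < ε) (hz : 0 ≤ z)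
    (hzy : z ≤ y) (hyr : y ≤ 2 * r) (hgap : y - z ≤ 2 * k + 1) (hr : 0 < r)
    (hr0 : k * (2 * k + 1) * 2 ^ (k - 1) / ε ≤ r) : y ^ k ≤ z ^ k + ε * r ^ k := by
  have h := pow_le_pow_add_mul_sub hz hzy k
  have hy : 0 ≤ y := hz.trans hzy
  have h1 : k * (y - z) * y ^ (k - 1) ≤ k * (2 * k + 1) * (2 * r) ^ (k - 1) := by gcongr
  rw [div_le_iff₀ hε] at hr0
  have h2 : k * (2 * k + 1) * (2 * r) ^ (k - 1) ≤ ε * r ^ k := by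
    calc k * (2 * k + 1) * (2 * r) ^ (k - 1)
        = (k * (2 * k + 1) * 2 ^ (k - 1)) * r ^ (k - 1) := by rw [mul_pow]; ring
      _ ≤ (r * ε) * r ^ (k - 1) := by gcongr
      _ = ε * (r ^ (k - 1) * r) := by ring
      _ = ε * r ^ k := by rw [← pow_succ, Nat.sub_add_cancel hk]
  linarith

theorem missing_count_lt {k n' a r : ℕ} {ρ n M h : ℝ} (hk : 1 ≤ k) (hρ0 : 0 < ρ) (hρ1 : ρ < 1)
    (hM : 0 < M) (hn : 0 ≤ n) (hka : k ≤ a) (har : a ≤ r) (hkr : k + 1 ≤ r)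
    (hr0 : k * (2 * k + 1) * 2 ^ (k - 1) / (ρ / 4) ≤ (r : ℝ))
    (hnM : n / M ≤ r + k) (hn'M : (n' : ℝ) / M ≤ a + k + 1)
    (hh : h ≤ (n'.choose k + ρ * n ^ k) / M ^ k + ρ / 2 * (r : ℝ) ^ k) :
    h < a.choose k + 3 * ρ * (r : ℝ) ^ k := by
  have hrpos : (0 : ℝ) < r := by exact_mod_cast (by omega : 0 < r)
  have hkaR : (k : ℝ) ≤ a := by exact_mod_cast hka
  have harR : (a : ℝ) ≤ r := by exact_mod_cast har
  have hkrR : (k : ℝ) + 1 ≤ r := by exact_mod_cast hkr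
  have hrk : 0 < (r : ℝ) ^ k := by positivity
  have hfact : (1 : ℝ) ≤ k.factorial := by exact_mod_cast k.factorial_pos
  have hfpos : (0 : ℝ) < k.factorial := by linarith
  have h1 : (n'.choose k : ℝ) / M ^ k ≤ ((a : ℝ) + k + 1) ^ k / k.factorial := by
    calc (n'.choose k : ℝ) / M ^ k ≤ ((n' : ℝ) ^ k / k.factorial) / M ^ k := by
          gcongr; exact Nat.choose_le_pow_div k n'
      _ = ((n' : ℝ) / M) ^ k / k.factorial := by rw [div_pow]; ring
      _ ≤ _ := by gcongr
  have h2 : ((a : ℝ) - k) ^ k / k.factorial ≤ a.choose k := by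
    rw [div_le_iff₀ hfpos]
    have e1 := Nat.pow_sub_le_descFactorial a k
    rw [Nat.descFactorial_eq_factorial_mul_choose] at e1
    have e2 : ((a : ℝ) - k) ^ k ≤ (((a + 1 - k) ^ k : ℕ) : ℝ) := by
      rw [Nat.cast_pow, Nat.cast_sub (by omega)]
      have : (0 : ℝ) ≤ a - k := by linarith
      gcongr
      linarith
    have e3 : (((a + 1 - k) ^ k : ℕ) : ℝ) ≤ ((k.factorial * a.choose k : ℕ) : ℝ) := by
      exact_mod_cast e1
    push_cast at e3 e2
    linarith
  have h3 := pow_le_pow_add_small hk (ε := ρ / 4) (y := a + k + 1) (z := a - k) (r := r)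
    (by positivity) (by linarith) (by linarith) (by linarith) (by linarith) hrpos hr0
  have h4 := pow_le_pow_add_small hk (ε := ρ / 4) (y := r + k) (z := r) (r := r)
    (by positivity) hrpos.le (by linarith [(Nat.cast_nonneg k : (0 : ℝ) ≤ k)]) (by linarith)
    (by linarith [(Nat.cast_nonneg k : (0 : ℝ) ≤ k)]) hrpos hr0
  have h5 : ((a : ℝ) + k + 1) ^ k / k.factorial ≤
      ((a : ℝ) - k) ^ k / k.factorial + ρ / 4 * (r : ℝ) ^ k := by
    calc ((a : ℝ) + k + 1) ^ k / k.factorial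
        ≤ (((a : ℝ) - k) ^ k + ρ / 4 * (r : ℝ) ^ k) / k.factorial := by gcongr
      _ = ((a : ℝ) - k) ^ k / k.factorial + ρ / 4 * (r : ℝ) ^ k / k.factorial := add_div _ _ _
      _ ≤ _ := by
          gcongr
          exact div_le_self (by positivity) hfact
  have h6 : ρ * n ^ k / M ^ k ≤ ρ * ((r : ℝ) ^ k + ρ / 4 * (r : ℝ) ^ k) := by
    rw [mul_div_assoc, ← div_pow]
    gcongr
    refine le_trans ?_ h4
    gcongr
  have h7 : ρ * (ρ / 4 * (r : ℝ) ^ k) ≤ 1 * (ρ / 4 * (r : ℝ) ^ k) := by gcongr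
  rw [add_div] at hh
  nlinarith [mul_pos hρ0 hrk]

end Estimates

section Scale

/-- The numerical facts used about `s` blocks on the left side, blocks of size `M` or `M + 1`,
and `N` samples, where the number of vertices on the right side is `n = x ^ 100`. -/
structure SampleScale (k : ℕ) (ρ x : ℝ) (q s M N : ℕ) : Prop where
  s_ge : k + 1 ≤ s
  r_ge : k * (2 * k + 1) * 2 ^ (k - 1) / (ρ / 4) ≤ ((k * s : ℕ) : ℝ)
  s_le : (s : ℝ) ≤ x ^ 10 / k
  le_s : x ^ 10 / k ≤ s + 1
  M_pos : 0 < M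
  s_le_div : (s : ℝ) ≤ q / M
  div_le : (q : ℝ) / M ≤ s + 1
  gap : 2 * (2 * (N / M) * ((k + 1) * s)) + 1 < M
  tail : (N : ℝ) * (q * Real.exp (-((ρ / 2 * ((k * s : ℕ) : ℝ) ^ k) ^ 2 /
      (2 * ((k + 1) * s : ℕ) * ((((k + 1) * s : ℕ) : ℝ) ^ (k - 1)) ^ 2))) +
    6 * Real.exp (-((x ^ 7 / 2) ^ 2 / (2 * ((k + 1) * s : ℕ))))) < 1
  dev : x ^ 7 / 2 + 2 * k ≤ x ^ 7
  count : k * x ^ 10 + k + 4 ≤ x ^ 19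

theorem eventually_pow_mul_exp_neg_lt (C : ℝ) (j : ℕ) {c : ℝ} (hc : 0 < c) :
    ∀ᶠ x : ℝ in Filter.atTop, C * (x ^ j * Real.exp (-(c * x))) < 1 := by
  have h := (tendsto_rpow_mul_exp_neg_mul_atTop_nhds_zero j c hc).const_mul C
  rw [mul_zero] at h
  filter_upwards [h.eventually (gt_mem_nhds one_pos)] with x hx
  rwa [Real.rpow_natCast, neg_mul] at hx

theorem le_tail_exponent {k : ℕ} (hk : 1 ≤ k) {ρ x r D : ℝ} (hρ : 0 < ρ) (hD : 0 < D)
    (hrD : D / 2 ≤ r) (hxD : x / 2 ≤ D) :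
    ρ ^ 2 / (16 * 4 ^ k) * x ≤ (ρ / 2 * r ^ k) ^ 2 / (2 * D * (D ^ (k - 1)) ^ 2) := by
  rw [le_div_iff₀ (by positivity)]
  have h1 : (D / 2) ^ k ≤ r ^ k := by gcongr
  have e : D ^ k = D ^ (k - 1) * D := by rw [← pow_succ, Nat.sub_add_cancel hk]
  have e4 : (4 : ℝ) ^ k = (2 ^ k) ^ 2 := by rw [← pow_mul, mul_comm, pow_mul]; norm_num
  calc ρ ^ 2 / (16 * 4 ^ k) * x * (2 * D * (D ^ (k - 1)) ^ 2)
      = ρ ^ 2 / (4 * 4 ^ k) * (x / 2) * D * (D ^ (k - 1)) ^ 2 := by field_simp; ring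
    _ ≤ ρ ^ 2 / (4 * 4 ^ k) * D * D * (D ^ (k - 1)) ^ 2 := by gcongr
    _ = (ρ / 2 * (D / 2) ^ k) ^ 2 := by rw [div_pow, e, e4]; field_simp; ring
    _ ≤ (ρ / 2 * r ^ k) ^ 2 := by gcongr

set_option maxHeartbeats 800000 in
theorem exists_sampleScale (k : ℕ) (hk : 3 ≤ k) (ρ : ℝ) (hρ0 : 0 < ρ) (hρ1 : ρ < 1) :
    ∀ᶠ x : ℝ in Filter.atTop, ∀ q : ℕ, (k : ℝ) * q = x ^ 100 →
      SampleScale k ρ x q ⌊x ^ 10 / k⌋₊ (q / ⌊x ^ 10 / k⌋₊) ⌈x ^ 110⌉₊ := by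
  set c : ℝ := ρ ^ 2 / (16 * 4 ^ k) with hc
  have hcpos : 0 < c := by positivity
  set K : ℝ := k * (2 * k + 1) * 2 ^ (k - 1) / (ρ / 4) with hK
  have hKpos : 0 ≤ K := by positivity
  filter_upwards [eventually_pow_mul_exp_neg_lt 14 210 hcpos, Filter.eventually_ge_atTop (2 : ℝ),
    Filter.eventually_ge_atTop (K + k), Filter.eventually_ge_atTop ((k : ℝ) * (k + 2)),
    Filter.eventually_ge_atTop ((4 : ℝ) * k + 4)] with x hexp hx2 hxK hxk hx4 q hq
  have hkR : (3 : ℝ) ≤ k := by exact_mod_cast hk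
  have hk0 : (0 : ℝ) < k := by linarith
  have hx1 : 1 ≤ x := by linarith
  have hx0 : 0 < x := by linarith
  set s := ⌊x ^ 10 / k⌋₊ with hs
  set M := q / s with hMdef
  set N := ⌈x ^ 110⌉₊ with hN
  have hx10 : x ≤ x ^ 10 := le_self_pow₀ hx1 (by norm_num)
  have s_le : (s : ℝ) ≤ x ^ 10 / k := Nat.floor_le (by positivity)
  have le_s : x ^ 10 / k ≤ s + 1 := (Nat.lt_floor_add_one _).le
  have hks_le : (k : ℝ) * s ≤ x ^ 10 := by
    rw [le_div_iff₀ hk0] at s_le; linarith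
  have hks_ge : x ^ 10 - k ≤ (k : ℝ) * s := by
    rw [div_le_iff₀ hk0] at le_s; linarith
  have s_ge : k + 1 ≤ s := by
    refine Nat.le_floor ?_
    rw [le_div_iff₀ hk0]
    push_cast
    linarith
  have hs0 : 0 < s := by omega
  have hsR : (0 : ℝ) < s := by exact_mod_cast hs0
  have hqR : (q : ℝ) = x ^ 100 / k := by field_simp; linarith
  have hdm : q = s * M + q % s := (Nat.div_add_mod q s).symm
  have hmod : q % s < s := Nat.mod_lt q hs0
  have hqlt : (q : ℝ) < s * (M + 1) := by
    have : q < s * (M + 1) := by rw [mul_add, mul_one]; omega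
    exact_mod_cast this
  have hqge : (s : ℝ) * M ≤ q := by
    have : s * M ≤ q := by omega
    exact_mod_cast this
  have hM90 : x ^ 90 < M + 1 := by
    have h1 : x ^ 10 / k * x ^ 90 < x ^ 10 / k * (M + 1) := by
      calc x ^ 10 / k * x ^ 90 = q := by rw [hqR]; ring
        _ < s * (M + 1) := hqlt
        _ ≤ x ^ 10 / k * (M + 1) := by gcongr
    exact lt_of_mul_lt_mul_left h1 (by positivity)
  have hx30 : (1 : ℝ) ≤ x ^ 30 := one_le_pow₀ hx1
  have hx90 : 128 * x ^ 30 ≤ x ^ 90 := by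
    calc 128 * x ^ 30 = 2 ^ 7 * x ^ 30 := by norm_num
      _ ≤ x ^ 7 * x ^ 30 := by gcongr
      _ = x ^ 37 := by rw [← pow_add]
      _ ≤ x ^ 90 := pow_le_pow_right₀ hx1 (by norm_num)
  have hMhalf : x ^ 90 / 2 ≤ M := by linarith
  have hMR : (0 : ℝ) < M := lt_of_lt_of_le (by positivity) hMhalf
  have hM0 : 0 < M := by exact_mod_cast hMR
  have hs_ks : (s : ℝ) ≤ k * s := le_mul_of_one_le_left hsR.le (by linarith)
  have hs_x : (s : ℝ) ≤ x ^ 10 :=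
    hs_ks.trans hks_le
  have hx1030 : x ^ 10 ≤ x ^ 30 := pow_le_pow_right₀ hx1 (by norm_num)
  have hsM : (s : ℝ) ≤ M := by linarith
  have hd_le : ((k : ℝ) + 1) * s ≤ 2 * x ^ 10 := by linarith
  have hNle : (N : ℝ) ≤ 2 * x ^ 110 := by
    have h1 := (Nat.ceil_lt_add_one (show 0 ≤ x ^ 110 by positivity)).le
    have h2 : (1 : ℝ) ≤ x ^ 110 := one_le_pow₀ hx1
    rw [← hN] at h1
    linarith
  have hNM : ((N / M : ℕ) : ℝ) ≤ 4 * x ^ 20 := by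
    refine Nat.cast_div_le.trans ?_
    rw [div_le_iff₀ hMR]
    calc (N : ℝ) ≤ 2 * x ^ 110 := hNle
      _ = 4 * x ^ 20 * (x ^ 90 / 2) := by ring
      _ ≤ _ := by gcongr
  have hD : (0 : ℝ) < ((k + 1) * s : ℕ) := by exact_mod_cast (by positivity)
  refine ⟨s_ge, ?_, s_le, le_s, hM0, ?_, ?_, ?_, ?_, ?_, ?_⟩
  · push_cast; linarith
  · rwa [le_div_iff₀ hMR]
  · rw [div_le_iff₀ hMR]; linarith
  · have : (2 * (2 * ((N / M : ℕ) : ℝ) * (((k : ℝ) + 1) * s))) + 1 < M := by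
      have h1 : 2 * ((N / M : ℕ) : ℝ) * (((k : ℝ) + 1) * s) ≤ 2 * (4 * x ^ 20) * (2 * x ^ 10) := by
        gcongr
      have h2 : 2 * (4 * x ^ 20) * (2 * x ^ 10) = 16 * x ^ 30 := by ring
      linarith
    exact_mod_cast this
  · have h1 : c * x ≤ (ρ / 2 * ((k * s : ℕ) : ℝ) ^ k) ^ 2 /
        (2 * ((k + 1) * s : ℕ) * ((((k + 1) * s : ℕ) : ℝ) ^ (k - 1)) ^ 2) := by
      refine le_tail_exponent (by omega) hρ0 hD ?_ ?_
      · push_cast; linarith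
      · push_cast; linarith
    have hc16 : c ≤ 1 / 16 := by
      rw [hc, div_le_div_iff₀ (by positivity) (by norm_num)]
      have h4 : (1 : ℝ) ≤ 4 ^ k := one_le_pow₀ (by norm_num)
      have hρ2 : ρ ^ 2 ≤ 1 := pow_le_one₀ hρ0.le hρ1.le
      linarith
    have h2 : c * x ≤ (x ^ 7 / 2) ^ 2 / (2 * ((k + 1) * s : ℕ)) := by
      rw [le_div_iff₀ (by positivity)]
      push_cast
      have hx4' : x ≤ x ^ 4 := le_self_pow₀ hx1 (by norm_num)
      calc c * x * (2 * (((k : ℝ) + 1) * s)) ≤ 1 / 16 * x ^ 4 * (2 * (2 * x ^ 10)) := by gcongr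
        _ = (x ^ 7 / 2) ^ 2 := by ring
    have hqx : (q : ℝ) ≤ x ^ 100 := by
      rw [hqR]; exact div_le_self (by positivity) (by linarith)
    have hx100 : (1 : ℝ) ≤ x ^ 100 := one_le_pow₀ hx1
    have e1 := Real.exp_le_exp.mpr (neg_le_neg h1)
    have e2 := Real.exp_le_exp.mpr (neg_le_neg h2)
    refine lt_of_le_of_lt ?_ hexp
    calc _ ≤ 2 * x ^ 110 * (x ^ 100 * Real.exp (-(c * x)) + 6 * Real.exp (-(c * x))) := by
          gcongr
      _ = 2 * x ^ 110 * (x ^ 100 + 6) * Real.exp (-(c * x)) := by ring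
      _ ≤ 2 * x ^ 110 * (x ^ 100 + 6 * x ^ 100) * Real.exp (-(c * x)) := by
          gcongr; linarith
      _ = _ := by ring
  · have : x ≤ x ^ 7 := le_self_pow₀ hx1 (by norm_num)
    linarith
  · have h9 : x ≤ x ^ 9 := le_self_pow₀ hx1 (by norm_num)
    have h10 : (1 : ℝ) ≤ x ^ 10 := one_le_pow₀ hx1
    have hk4 : ((k : ℝ) + 4) * 1 ≤ (k + 4) * x ^ 10 := by gcongr
    calc k * x ^ 10 + k + 4 ≤ (2 * k + 4) * x ^ 10 := by linarith
      _ ≤ x ^ 9 * x ^ 10 := by gcongr; linarith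
      _ = x ^ 19 := by ring

end Scale

section Assembly

variable {k q n s N m : ℕ} {ρ x : ℝ}

theorem abs_count_sub_le {Y : ℕ} (hk : 0 < k) (hx : 1 ≤ x) (hq : (k : ℝ) * q = x ^ 100)
    {M : ℕ} (hsc : SampleScale k ρ x q s M ⌈x ^ 110⌉₊) (hYle : Y ≤ ⌈x ^ 110⌉₊ / M + 1)
    (hleY : ⌈x ^ 110⌉₊ / M ≤ Y + 1) : |(Y : ℝ) - x ^ 20| ≤ x ^ 19 := by
  have hx0 : 0 < x := by linarith
  have hkR : (0 : ℝ) < k := by exact_mod_cast hk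
  have hMR : (0 : ℝ) < M := by exact_mod_cast hsc.M_pos
  have hqR : (q : ℝ) = x ^ 100 / k := by field_simp; linarith
  have hq0 : (0 : ℝ) < q := by rw [hqR]; positivity
  obtain ⟨hN1, hN2⟩ : x ^ 110 ≤ (⌈x ^ 110⌉₊ : ℝ) ∧ (⌈x ^ 110⌉₊ : ℝ) ≤ x ^ 110 + 1 :=
    ⟨Nat.le_ceil _, (Nat.ceil_lt_add_one (by positivity)).le⟩
  have hcount := hsc.count
  have hdiff : |(q : ℝ) / M - x ^ 10 / k| ≤ 1 := by
    rw [abs_le]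
    constructor <;> linarith [hsc.s_le, hsc.le_s, hsc.s_le_div, hsc.div_le]
  set N := ⌈x ^ 110⌉₊
  have hNq : (N : ℝ) / q ≤ k * x ^ 10 + k := by
    rw [div_le_iff₀ hq0, hqR]
    have h1 : (1 : ℝ) ≤ x ^ 100 := one_le_pow₀ hx
    calc (N : ℝ) ≤ x ^ 110 + 1 := hN2
      _ ≤ x ^ 110 + x ^ 100 := by gcongr
      _ = (k * x ^ 10 + k) * (x ^ 100 / k) := by field_simp
  have hNM : |(N : ℝ) / M - N / x ^ 90| ≤ k * x ^ 10 + k := by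
    have e : (N : ℝ) / M - N / x ^ 90 = N / q * (q / M - x ^ 10 / k) := by
      rw [mul_sub, div_mul_div_cancel₀ hq0.ne', hqR]
      field_simp
    rw [e, abs_mul, abs_of_nonneg (by positivity)]
    calc (N : ℝ) / q * |(q : ℝ) / M - x ^ 10 / k| ≤ N / q * 1 := by gcongr
      _ ≤ _ := by linarith
  have hNx1 : x ^ 20 ≤ N / x ^ 90 := by
    rw [le_div_iff₀ (by positivity), ← pow_add]; exact hN1
  have hNx2 : N / x ^ 90 ≤ x ^ 20 + 1 := by
    have e : x ^ 20 * x ^ 90 = x ^ 110 := by rw [← pow_add]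
    rw [div_le_iff₀ (by positivity), add_mul, e]
    linarith [one_le_pow₀ hx (n := 90)]
  have hfl1 : ((N / M : ℕ) : ℝ) ≤ N / M := Nat.cast_div_le
  have hfl2 : (N : ℝ) / M ≤ (N / M : ℕ) + 1 := by
    rw [← Nat.floor_div_eq_div (K := ℝ)]
    exact (Nat.lt_floor_add_one _).le
  have hYle' : (Y : ℝ) ≤ (N / M : ℕ) + 1 := by exact_mod_cast hYle
  have hleY' : ((N / M : ℕ) : ℝ) ≤ Y + 1 := by exact_mod_cast hleY
  obtain ⟨l, u⟩ := abs_le.mp hNM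
  rw [abs_le]
  constructor <;> linarith

theorem choose_sub_choose_lt_degree (hk3 : 3 ≤ k) (hρ0 : 0 < ρ) (hρ1 : ρ < 1) (hx : 0 < x)
    (hq : (k : ℝ) * q = x ^ 100) (hn : k * q = n) (hmq : m ≤ q) {M : ℕ}
    (hsc : SampleScale k ρ x q s M N) {H : Finset (Finset (Fin q ⊕ Fin n))}
    (hH : ∀ e ∈ H, (e.filter fun v => v.isLeft = true).card = 1 ∧ e.card = k + 1) {v : Fin q}
    (hdeg : (n.choose k : ℝ) - ((n - m).choose k : ℝ) - ρ * (n : ℝ) ^ k ≤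
      ((H.filter fun e => Sum.inl v ∈ e).card : ℝ))
    {R : Finset (Fin q ⊕ Fin n)} (hv : Sum.inl v ∈ R)
    (hR : (R.filter fun w => w.isRight = true).card = k * s)
    (htail : (((missingLink H k v).filter fun T => T ⊆ R).card : ℝ) ≤
      (missingLink H k v).card / (M : ℝ) ^ k + ρ / 2 * ((k * s : ℕ) : ℝ) ^ k) :
    ((k * s).choose k : ℝ) - ((k * s - ⌊(m : ℝ) * (x ^ 90)⁻¹⌋₊).choose k : ℝ) -
      3 * ρ * ((k * s : ℕ) : ℝ) ^ k < ((H.filter fun e => Sum.inl v ∈ e ∧ e ⊆ R).card : ℝ) := by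
  have hkR : (3 : ℝ) ≤ k := by exact_mod_cast hk3
  have hk0 : (0 : ℝ) < k := by linarith
  have hMR : (0 : ℝ) < M := by exact_mod_cast hsc.M_pos
  have hqR : (q : ℝ) = x ^ 100 / k := by field_simp; linarith
  have hq0 : (0 : ℝ) < q := by rw [hqR]; positivity
  have hnR : (n : ℝ) = k * q := by rw [← hn]; push_cast; ring
  have hqP : (q : ℝ) * (x ^ 90)⁻¹ = x ^ 10 / k := by rw [hqR]; field_simp
  have hmqR : (m : ℝ) ≤ q := by exact_mod_cast hmq
  have hmn : m ≤ n := hmq.trans (hn ▸ Nat.le_mul_of_pos_left q (by omega))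
  set m' := ⌊(m : ℝ) * (x ^ 90)⁻¹⌋₊ with hm'
  have hm'le : (m' : ℝ) ≤ m * (x ^ 90)⁻¹ := Nat.floor_le (by positivity)
  have hm's : m' ≤ s + 1 := by
    have h1 : (m : ℝ) * (x ^ 90)⁻¹ ≤ q * (x ^ 90)⁻¹ := by gcongr
    have : (m' : ℝ) ≤ s + 1 := by linarith [hsc.le_s]
    exact_mod_cast this
  have hs := hsc.s_ge
  have h3s : 3 * s ≤ k * s := Nat.mul_le_mul_right s hk3
  have hmM : (m' : ℝ) - 1 ≤ m / M := by
    have hfrac : (m : ℝ) / q ≤ 1 := (div_le_one hq0).mpr hmqR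
    have hfrac0 : (0 : ℝ) ≤ (m : ℝ) / q := by positivity
    have e : (m : ℝ) / M - m * (x ^ 90)⁻¹ = m / q * (q / M - x ^ 10 / k) := by
      rw [← hqP]; field_simp
    have hlow : (-1 : ℝ) ≤ q / M - x ^ 10 / k := by linarith [hsc.s_le_div, hsc.le_s]
    have := mul_le_mul_of_nonneg_left hlow hfrac0
    linarith
  have hnM : (n : ℝ) / M ≤ (k * s : ℕ) + k := by
    rw [hnR, mul_div_assoc]
    push_cast
    calc (k : ℝ) * (q / M) ≤ k * (s + 1) := by gcongr; exact hsc.div_le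
      _ = k * s + k := by ring
  have hchoose := choose_card_right_le (H := H) (k := k) hv
  rw [hR] at hchoose
  have hchoose' : ((k * s).choose k : ℝ) ≤ ((H.filter fun e => Sum.inl v ∈ e ∧ e ⊆ R).card : ℝ) +
      (((missingLink H k v).filter fun T => T ⊆ R).card : ℝ) := by exact_mod_cast hchoose
  have hmiss : ((missingLink H k v).card : ℝ) + ((H.filter fun e => Sum.inl v ∈ e).card : ℝ) ≤
      n.choose k := by exact_mod_cast card_missingLink_add_degree_le hH v
  have key := missing_count_lt (k := k) (n' := n - m) (a := k * s - m') (r := k * s) (ρ := ρ)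
    (n := n) (M := M) (h := (((missingLink H k v).filter fun T => T ⊆ R).card : ℝ)) (by omega) hρ0 hρ1
    hMR (Nat.cast_nonneg n) (by omega) (by omega) (by omega) hsc.r_ge hnM
    (by
      rw [Nat.cast_sub hmn, Nat.cast_sub (by omega), sub_div]
      linarith)
    (by
      refine htail.trans ?_
      gcongr
      linarith)
  linarith


theorem abs_card_filter_left_sub_le {k q n s M N : ℕ} {ρ x : ℝ} (hk : 1 ≤ k) (hx : 0 < x)
    (hq : (k : ℝ) * q = x ^ 100) (hsc : SampleScale k ρ x q s M N)
    {R : Finset (Fin q ⊕ Fin n)} (hR : (R.filter fun w => w.isLeft = true).card = s)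
    (S : Finset (Fin q))
    (hS : ((R.filter fun w => w ∈ S.map Function.Embedding.inl).card : ℝ) ≤
      S.card / M + x ^ 7 / 2)
    (hS' : ((R.filter fun w => w ∈ Sᶜ.map Function.Embedding.inl).card : ℝ) ≤
      Sᶜ.card / M + x ^ 7 / 2) :
    |((R.filter fun w => ∃ a ∈ S, w = Sum.inl a).card : ℝ) - S.card * (x ^ 90)⁻¹| ≤ x ^ 7 := by
  have hkR : (1 : ℝ) ≤ k := by exact_mod_cast hk
  have hk0 : (0 : ℝ) < k := by linarith
  have hqR : (q : ℝ) = x ^ 100 / k := by field_simp; linarith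
  have hqP : (q : ℝ) * (x ^ 90)⁻¹ = x ^ 10 / k := by rw [hqR]; field_simp
  have hsum : ((R.filter fun w => w ∈ S.map Function.Embedding.inl).card : ℝ) +
      ((R.filter fun w => w ∈ Sᶜ.map Function.Embedding.inl).card : ℝ) = s := by
    exact_mod_cast (card_filter_left_add_compl R S).trans hR
  have hcompl : (S.card : ℝ) + (Sᶜ.card : ℝ) = q := by
    exact_mod_cast (Finset.card_add_card_compl S).trans (Fintype.card_fin q)
  have key := abs_sub_mul_le_of_upper (τ := 1) (P := (x ^ 90)⁻¹)
    (by exact_mod_cast hsc.M_pos) hS hS' hsum hcompl (Nat.cast_nonneg _) (Nat.cast_nonneg _)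
    (by rw [hqR]; positivity) hsc.s_le_div hsc.div_le (by rw [hqP]; exact hsc.s_le)
    (by rw [hqP]; exact hsc.le_s)
  have e : (R.filter fun w => ∃ a ∈ S, w = Sum.inl a) =
      R.filter fun w => w ∈ S.map Function.Embedding.inl := by
    refine Finset.filter_congr fun w _ => ?_
    simp [eq_comm]
  rw [e]
  linarith [hsc.dev]

theorem abs_card_filter_right_sub_le {k q n s M N : ℕ} {ρ x : ℝ} (hk : 1 ≤ k) (hx : 0 < x)
    (hq : (k : ℝ) * q = x ^ 100) (hn : k * q = n) (hsc : SampleScale k ρ x q s M N)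
    {R : Finset (Fin q ⊕ Fin n)} (hR : (R.filter fun w => w.isRight = true).card = k * s)
    (S : Finset (Fin n))
    (hS : ((R.filter fun w => w ∈ S.map Function.Embedding.inr).card : ℝ) ≤
      S.card / M + x ^ 7 / 2)
    (hS' : ((R.filter fun w => w ∈ Sᶜ.map Function.Embedding.inr).card : ℝ) ≤
      Sᶜ.card / M + x ^ 7 / 2) :
    |((R.filter fun w => ∃ a ∈ S, w = Sum.inr a).card : ℝ) - S.card * (x ^ 90)⁻¹| ≤ x ^ 7 := by
  have hkR : (1 : ℝ) ≤ k := by exact_mod_cast hk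
  have hk0 : (0 : ℝ) < k := by linarith
  have hnP : (k : ℝ) * q * (x ^ 90)⁻¹ = x ^ 10 := by rw [hq]; field_simp
  have hsum : ((R.filter fun w => w ∈ S.map Function.Embedding.inr).card : ℝ) +
      ((R.filter fun w => w ∈ Sᶜ.map Function.Embedding.inr).card : ℝ) = k * s := by
    exact_mod_cast (card_filter_right_add_compl R S).trans hR
  have hcompl : (S.card : ℝ) + (Sᶜ.card : ℝ) = k * q := by
    exact_mod_cast ((Finset.card_add_card_compl S).trans (Fintype.card_fin n)).trans hn.symm
  have hs_le := hsc.s_le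
  have hle_s := hsc.le_s
  rw [le_div_iff₀ hk0] at hs_le
  rw [div_le_iff₀ hk0] at hle_s
  have key := abs_sub_mul_le_of_upper (τ := k) (P := (x ^ 90)⁻¹)
    (by exact_mod_cast hsc.M_pos) hS hS' hsum hcompl (Nat.cast_nonneg _) (Nat.cast_nonneg _)
    (by rw [hq]; positivity)
    (by rw [mul_div_assoc]; exact mul_le_mul_of_nonneg_left hsc.s_le_div hk0.le)
    (by
      rw [mul_div_assoc]
      linarith [mul_le_mul_of_nonneg_left hsc.div_le hk0.le])
    (by rw [hnP]; linarith) (by rw [hnP]; linarith)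
  have e : (R.filter fun w => ∃ a ∈ S, w = Sum.inr a) =
      R.filter fun w => w ∈ S.map Function.Embedding.inr := by
    refine Finset.filter_congr fun w _ => ?_
    simp [eq_comm]
  rw [e]
  linarith [hsc.dev]

/-- The samples of `exists_balanced_samples` at a given scale, applied to the missing links of all
left vertices and to six prescribed vertex sets. -/
theorem exists_samples_of_scale {k q n s N : ℕ} {ρ x : ℝ} (hρ0 : 0 < ρ)
    (hx : 0 < x) (hn : k * q = n) (hsc : SampleScale k ρ x q s (q / s) N)
    (H : Finset (Finset (Fin q ⊕ Fin n))) (S : Fin 6 → Finset (Fin q ⊕ Fin n)) :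
    ∃ R : ℕ → Finset (Fin q ⊕ Fin n),
      (∀ i, ((R i).filter fun v => v.isLeft = true).card = s) ∧
      (∀ i, ((R i).filter fun v => v.isRight = true).card = k * s) ∧
      (∀ v, ((Finset.range N).filter fun i => v ∈ R i).card ≤ N / (q / s) + 1) ∧
      (∀ v, N / (q / s) ≤ ((Finset.range N).filter fun i => v ∈ R i).card + 1) ∧
      (∀ u v, u ≠ v → ∀ i < N, ∀ i' < N, u ∈ R i → v ∈ R i → u ∈ R i' → v ∈ R i' → i = i') ∧
      (∀ i < N, ∀ v, (((missingLink H k v).filter fun T => T ⊆ R i).card : ℝ) ≤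
        (missingLink H k v).card / ((q / s : ℕ) : ℝ) ^ k + ρ / 2 * ((k * s : ℕ) : ℝ) ^ k) ∧
      (∀ i < N, ∀ j, (((R i).filter fun w => w ∈ S j).card : ℝ) ≤
        (S j).card / ((q / s : ℕ) : ℝ) + x ^ 7 / 2) := by
  obtain ⟨R, h1, h2, h3, h4, h5, h6⟩ := exists_balanced_samples (N := N) hn
    (by have := hsc.s_ge; omega) hsc.gap
    (Sum.elim (missingLink H k) fun j => (S j).powersetCard 1)
    (Sum.elim (fun _ => k) fun _ => 1)
    (by
      rintro (v | j) T hT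
      · exact card_of_mem_missingLink hT
      · exact (Finset.mem_powersetCard.mp hT).2)
    (Sum.elim (fun _ => ρ / 2 * ((k * s : ℕ) : ℝ) ^ k) fun _ => x ^ 7 / 2)
    (by rintro (v | j) <;> simp only [Sum.elim_inl, Sum.elim_inr] <;> positivity)
    (by
      have := hsc.tail
      rw [Fintype.sum_sum_type]
      simpa only [Sum.elim_inl, Sum.elim_inr, Finset.sum_const, Finset.card_univ,
        Fintype.card_fin, nsmul_eq_mul, Nat.sub_self, pow_zero, one_pow, mul_one,
        Nat.cast_ofNat] using this)
  refine ⟨R, h1, h2, h3, h4, h5, fun i hi v => h6 i hi (Sum.inl v), fun i hi j => ?_⟩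
  have := h6 i hi (Sum.inr j)
  simpa only [Sum.elim_inr, card_powersetCard_one_filter_subset, Finset.card_powersetCard,
    Nat.choose_one_right, pow_one] using this

theorem card_filter_univ_fin_eq_range (N : ℕ) (p : ℕ → Prop) [DecidablePred p] :
    (Finset.univ.filter fun i : Fin N => p i).card =
      ((Finset.range N).filter p).card := by
  rw [Finset.card_filter, Finset.card_filter, Finset.sum_range]

end Assembly

/-- Deterministic form of Lemma 6.3 of the paper: existence of the random samples
`R_1, …, R_N` with all the listed properties. Here the left class is `A = Fin q` with
`k·q = n` and the right class is `B = Fin n`. -/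
theorem stmt_10 (k : ℕ) (hk : 3 ≤ k) (ρ : ℝ) (hρ0 : 0 < ρ) (hρ1 : ρ < 1) :
    ∃ n₀ : ℕ, ∀ n : ℕ, n₀ ≤ n → ∀ q : ℕ, k * q = n →
    ∀ m : ℕ, (n : ℝ) / k ^ 3 ≤ m → (m : ℝ) ≤ (n : ℝ) / k →
    ∀ H : Finset (Finset (Fin q ⊕ Fin n)),
      (∀ e ∈ H, (e.filter fun v => v.isLeft = true).card = 1 ∧ e.card = k + 1) →
      ∀ A₁ : Finset (Fin q),
        (n : ℝ) / (3 * k ^ 2) ≤ A₁.card → (n : ℝ) / (3 * k ^ 2) ≤ A₁ᶜ.card →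
      ∀ A₃ : Finset (Fin q), A₃.card = ⌈(n : ℝ) ^ (0.99 : ℝ)⌉₊ →
      ∀ A₄ : Finset (Fin n), A₄.card = ⌈(n : ℝ) ^ (0.99 : ℝ)⌉₊ →
      (∀ v : Fin q,
        (Nat.choose n k : ℝ) - (Nat.choose (n - m) k : ℝ) - ρ * (n : ℝ) ^ k ≤
          ((H.filter fun e => Sum.inl v ∈ e).card : ℝ)) →
      ∃ R : Fin (⌈(n : ℝ) ^ (1.1 : ℝ)⌉₊) → Finset (Fin q ⊕ Fin n),
        -- each `R_i` is balanced with cardinality divisible by `k+1`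
        (∀ i, ((R i).filter fun v => v.isRight = true).card
            = k * ((R i).filter fun v => v.isLeft = true).card) ∧
        (∀ i, (k + 1) ∣ (R i).card) ∧
        -- (i)
        (∀ v : Fin q ⊕ Fin n,
          |((Finset.univ.filter fun i => ({v} : Finset _) ⊆ R i).card : ℝ) - (n : ℝ) ^ (0.2 : ℝ)|
            ≤ (n : ℝ) ^ (0.19 : ℝ)) ∧
        -- (ii)
        (∀ u v : Fin q ⊕ Fin n, u ≠ v →
          (Finset.univ.filter fun i => ({u, v} : Finset _) ⊆ R i).card ≤ 2) ∧
        -- (iii)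
        (∀ e ∈ H, (Finset.univ.filter fun i => e ⊆ R i).card ≤ 1) ∧
        -- (iv)
        (∀ i, |(((R i).filter fun v => v.isLeft = true).card : ℝ) - (n : ℝ) ^ (0.1 : ℝ) / k|
            ≤ (n : ℝ) ^ (0.07 : ℝ) ∧
          |(((R i).filter fun v => v.isRight = true).card : ℝ) - (n : ℝ) ^ (0.1 : ℝ)|
            ≤ (n : ℝ) ^ (0.07 : ℝ)) ∧
        -- (v)
        (∀ i, ∀ v : Fin q, Sum.inl v ∈ R i →
          (Nat.choose (((R i).filter fun v => v.isRight = true).card) k : ℝ)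
            - (Nat.choose ((((R i).filter fun v => v.isRight = true).card)
                - ⌊(m : ℝ) * (n : ℝ) ^ (-0.9 : ℝ)⌋₊) k : ℝ)
            - 3 * ρ * ((((R i).filter fun v => v.isRight = true).card : ℝ)) ^ k
          < ((H.filter fun e => Sum.inl v ∈ e ∧ e ⊆ R i).card : ℝ)) ∧
        -- (vi)
        (∀ i,
          |(((R i).filter fun v => ∃ a ∈ A₁, v = Sum.inl a).card : ℝ)
              - A₁.card * (n : ℝ) ^ (-0.9 : ℝ)| ≤ (n : ℝ) ^ (0.07 : ℝ) ∧
          |(((R i).filter fun v => ∃ a ∈ A₁ᶜ, v = Sum.inl a).card : ℝ)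
              - (A₁ᶜ.card : ℝ) * (n : ℝ) ^ (-0.9 : ℝ)| ≤ (n : ℝ) ^ (0.07 : ℝ) ∧
          |(((R i).filter fun v => ∃ a ∈ A₃, v = Sum.inl a).card : ℝ)
              - A₃.card * (n : ℝ) ^ (-0.9 : ℝ)| ≤ (n : ℝ) ^ (0.07 : ℝ) ∧
          |(((R i).filter fun v => ∃ a ∈ A₄, v = Sum.inr a).card : ℝ)
              - A₄.card * (n : ℝ) ^ (-0.9 : ℝ)| ≤ (n : ℝ) ^ (0.07 : ℝ)) := by
  have hscale := ((tendsto_rpow_atTop (y := (0.01 : ℝ)) (by norm_num)).comp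
    tendsto_natCast_atTop_atTop).eventually
      ((exists_sampleScale k hk ρ hρ0 hρ1).and (Filter.eventually_ge_atTop 1))
  obtain ⟨n₀, hn₀⟩ := Filter.eventually_atTop.mp hscale
  refine ⟨n₀, fun n hn q hkq m _ hmn H hH A₁ _ _ A₃ _ A₄ _ hdeg => ?_⟩
  obtain ⟨hsc, hx1⟩ := hn₀ n hn
  simp only [Function.comp_apply] at hsc hx1
  set x : ℝ := (n : ℝ) ^ (0.01 : ℝ) with hx
  have hx0 : 0 < x := by linarith
  have hpow : ∀ j : ℕ, (n : ℝ) ^ ((0.01 : ℝ) * j) = x ^ j := fun j =>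
    Real.rpow_mul_natCast (Nat.cast_nonneg n) _ _
  have p100 : x ^ 100 = n := by rw [← hpow]; norm_num
  have p110 : (n : ℝ) ^ (1.1 : ℝ) = x ^ 110 := by rw [← hpow]; norm_num
  have p20 : (n : ℝ) ^ (0.2 : ℝ) = x ^ 20 := by rw [← hpow]; norm_num
  have p19 : (n : ℝ) ^ (0.19 : ℝ) = x ^ 19 := by rw [← hpow]; norm_num
  have p10 : (n : ℝ) ^ (0.1 : ℝ) = x ^ 10 := by rw [← hpow]; norm_num
  have p7 : (n : ℝ) ^ (0.07 : ℝ) = x ^ 7 := by rw [← hpow]; norm_num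
  have p90 : (n : ℝ) ^ (-0.9 : ℝ) = (x ^ 90)⁻¹ := by
    rw [← hpow, ← Real.rpow_neg (Nat.cast_nonneg n)]; norm_num
  rw [p110, p20, p19, p10, p7, p90]
  have hkR : (3 : ℝ) ≤ k := by exact_mod_cast hk
  have hk0 : (0 : ℝ) < k := by linarith
  have hq : (k : ℝ) * q = x ^ 100 := by rw [p100]; exact_mod_cast hkq
  have hmq : m ≤ q := by
    have : (m : ℝ) ≤ q := by
      rw [← p100, ← hq] at hmn
      rwa [mul_div_cancel_left₀ _ hk0.ne'] at hmn
    exact_mod_cast this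
  replace hsc := hsc q hq
  set s := ⌊x ^ 10 / k⌋₊
  obtain ⟨R, hleft, hright, hYle, hleY, hpair, hmiss, hdev⟩ :=
    exists_samples_of_scale hρ0 hx0 hkq hsc H
      ![A₁.map Function.Embedding.inl, A₁ᶜ.map Function.Embedding.inl,
        A₃.map Function.Embedding.inl, A₃ᶜ.map Function.Embedding.inl,
        A₄.map Function.Embedding.inr, A₄ᶜ.map Function.Embedding.inr]
  have hunique : ∀ e : Finset (Fin q ⊕ Fin n), 1 < e.card →
      (Finset.univ.filter fun i : Fin ⌈x ^ 110⌉₊ => e ⊆ R i).card ≤ 1 := by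
    intro e he
    obtain ⟨u, hu, v, hv, huv⟩ := Finset.one_lt_card.mp he
    refine Finset.card_le_one.mpr fun i hi j hj => Fin.ext ?_
    simp only [Finset.mem_filter, Finset.mem_univ, true_and] at hi hj
    exact hpair u v huv i i.2 j j.2 (hi hu) (hi hv) (hj hu) (hj hv)
  have hs_le := hsc.s_le
  have hle_s := hsc.le_s
  have hdev7 := hsc.dev
  have hx7 : 0 < x ^ 7 := by positivity
  have hleft_dev : ∀ i, ∀ S S' : Finset (Fin q), S' = Sᶜ →
      (((R i).filter fun w => w ∈ S.map Function.Embedding.inl).card : ℝ) ≤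
        (S.map (Function.Embedding.inl (β := Fin n))).card / ((q / s : ℕ) : ℝ) + x ^ 7 / 2 →
      (((R i).filter fun w => w ∈ S'.map Function.Embedding.inl).card : ℝ) ≤
        (S'.map (Function.Embedding.inl (β := Fin n))).card / ((q / s : ℕ) : ℝ) + x ^ 7 / 2 →
      |(((R i).filter fun w => ∃ a ∈ S, w = Sum.inl a).card : ℝ) - S.card * (x ^ 90)⁻¹| ≤
        x ^ 7 := by
    intro i S S' hS' h h'
    subst hS'
    rw [Finset.card_map] at h h'
    exact abs_card_filter_left_sub_le (by omega) hx0 hq hsc (hleft i) S h h'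
  refine ⟨fun i => R i, fun i => by rw [hleft, hright], fun i => ⟨s, ?_⟩, fun v => ?_,
    fun u v huv => ?_, fun e he => hunique e (by rw [(hH e he).2]; omega), fun i => ⟨?_, ?_⟩,
    fun i v hv => ?_, fun i => ⟨?_, ?_, ?_, ?_⟩⟩
  · have := Finset.card_filter_add_card_filter_not (s := R i) fun v => v.isLeft = true
    simp only [Bool.not_eq_true, Sum.isLeft_eq_false] at this
    rw [← this, hleft, hright]
    ring
  · simp only [Finset.singleton_subset_iff]
    rw [card_filter_univ_fin_eq_range ⌈x ^ 110⌉₊ fun i => v ∈ R i]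
    exact abs_count_sub_le (by omega) hx1 hq hsc (hYle v) (hleY v)
  · exact (hunique {u, v} (by rw [Finset.card_pair huv]; norm_num)).trans one_le_two
  · rw [hleft, abs_le]
    constructor <;> linarith
  · rw [le_div_iff₀ hk0] at hs_le
    rw [div_le_iff₀ hk0] at hle_s
    rw [hright, abs_le]
    push_cast
    constructor <;> linarith
  · rw [hright]
    exact choose_sub_choose_lt_degree hk hρ0 hρ1 hx0 hq hkq hmq hsc hH (hdeg v) hv
      (hright i) (hmiss i i.2 v)
  · exact hleft_dev i A₁ A₁ᶜ rfl (hdev i i.2 0) (hdev i i.2 1)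
  · exact hleft_dev i A₁ᶜ A₁ (compl_compl A₁).symm (hdev i i.2 1) (hdev i i.2 0)
  · exact hleft_dev i A₃ A₃ᶜ rfl (hdev i i.2 2) (hdev i i.2 3)
  · have h := hdev i i.2 4
    have h' := hdev i i.2 5
    refine abs_card_filter_right_sub_le (by omega) hx0 hq hkq hsc (hright i) A₄ ?_ ?_
    · rw [← Finset.card_map (s := A₄) (Function.Embedding.inr (α := Fin q))]; exact h
    · rw [← Finset.card_map (s := A₄ᶜ) (Function.Embedding.inr (α := Fin q))]; exact h'
end
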